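/- arXiv:0712.1081 — 2 statements merged into one kernel-verified Lean document; each statement's English description precedes it below -/
import Mathlib

section
/- For every ε > 0 there exists x₀ such that for all real x ≥ x₀, for every real A ≥ 0 and every real N with N ≥ exp(3x/log log x), one has |#(S_x ∩ (A, A+N]) − N/(2^{π(x)+1} e^γ log x)| ≤ ε · N/(2^{π(x)+1} e^γ log x). That is, uniformly for such A and N, #(S_x ∩ (A, A+N]) = (1+o(1)) · N/(2^{π(x)+1} e^γ log x) as x → ∞. -/
open scoped BigOperators

/-- The finset of primes `p ≤ x`. -/
noncomputable def primesUpTo (x : ℝ) : Finset ℕ := (Finset.Iic ⌊x⌋₊).filter Nat.Prime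

/-- `M(x)`: the product of all primes `p ≤ x`. -/
noncomputable def Mx (x : ℝ) : ℕ := ∏ p ∈ primesUpTo x, p

/-- `π(x)`: the number of primes `p ≤ x`. -/
noncomputable def piX (x : ℝ) : ℕ := (primesUpTo x).card

/-- The Legendre symbol `(a/p)` (junk value `0` if `p` is not prime). -/
noncomputable def legendre (p : ℕ) (a : ℤ) : ℤ :=
  if hp : p.Prime then @legendreSym p ⟨hp⟩ a else 0

/-- An `x`-pseudosquare: a positive integer that is not a perfect square, is `≡ 1 (mod 8)`,
and has Legendre symbol `(n/p) = 1` for every odd prime `p ≤ x`. -/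
def IsPseudosquare (x : ℝ) (n : ℕ) : Prop :=
  0 < n ∧ ¬ IsSquare n ∧ n % 8 = 1 ∧
    ∀ p : ℕ, p.Prime → p ≠ 2 → (p : ℝ) ≤ x → legendre p (n : ℤ) = 1

/-- `#(S_x ∩ (A, A+N])`: the number of `x`-pseudosquares in the interval `(A, A+N]`. -/
noncomputable def pseudosquaresIn (x A N : ℝ) : ℕ :=
  Set.ncard {n : ℕ | IsPseudosquare x n ∧ A < (n : ℝ) ∧ (n : ℝ) ≤ A + N}

section Stepanov

open Polynomial

variable {p : ℕ} [Fact p.Prime]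

/-- If `f` has a root of odd multiplicity, `f * r ^ 2` is never a nonzero scalar multiple of a
square. -/
theorem eq_zero_of_mul_sq_eq {F : Type*} [Field F] {f r s : F[X]} {α b : F}
    (hα : f.rootMultiplicity α = 1) (hb : b ≠ 0) (h : f * r ^ 2 = C b * s ^ 2) :
    r = 0 ∧ s = 0 := by
  have hf : f ≠ 0 := by
    rintro rfl
    simp at hα
  have hCb : (C b : F[X]) ≠ 0 := C_ne_zero.2 hb
  by_cases hr : r = 0
  · subst hr
    refine ⟨rfl, ?_⟩
    have h' : C b * s ^ 2 = 0 := by rw [← h]; simp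
    simpa [hb] using h'
  · exfalso
    have hl : f * r ^ 2 ≠ 0 := mul_ne_zero hf (pow_ne_zero _ hr)
    have hs : s ≠ 0 := by
      rintro rfl
      exact hl (by rw [h]; simp)
    have h1 := congrArg (rootMultiplicity α) h
    rw [rootMultiplicity_mul hl, rootMultiplicity_mul (h ▸ hl), rootMultiplicity_C, hα, sq, sq,
      rootMultiplicity_mul (mul_ne_zero hr hr), rootMultiplicity_mul (mul_ne_zero hs hs)] at h1
    omega

theorem X_pow_dvd_pow_sub_C (f : (ZMod p)[X]) : X ^ p ∣ f ^ p - C (f.eval 0) := by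
  have h : (X : (ZMod p)[X]) ∣ f - C (f.eval 0) := by
    rw [X_dvd_iff]
    simp [coeff_zero_eq_eval_zero]
  have h' := map_dvd (expand (ZMod p) p) h
  rwa [map_sub, expand_X, expand_C, ZMod.expand_card] at h'

/-- The auxiliary polynomial of Stepanov's method does not vanish identically. -/
theorem stepanov_aux_eq_zero {f : (ZMod p)[X]} {α : ZMod p} (hp2 : p ≠ 2)
    (hα : f.rootMultiplicity α = 1) (h0 : f.eval 0 ≠ 0) {B : ℕ} (hB : 2 * B + f.natDegree ≤ p)
    (J : ℕ) (r s : ℕ → (ZMod p)[X])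
    (hr : ∀ j < J, (r j).natDegree < B) (hs : ∀ j < J, (s j).natDegree < B)
    (h : ∑ j ∈ Finset.range J, (r j + s j * f ^ (p / 2)) * X ^ (p * j) = 0) :
    ∀ j < J, r j = 0 ∧ s j = 0 := by
  induction J generalizing r s with
  | zero => intro j hj; omega
  | succ J ih =>
    have hpodd : p / 2 + p / 2 + 1 = p := by
      have := (Fact.out : p.Prime).eq_two_or_odd
      omega
    rw [Finset.sum_range_succ'] at h
    have hshift : ∑ j ∈ Finset.range J, (r (j + 1) + s (j + 1) * f ^ (p / 2)) * X ^ (p * (j + 1))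
        = X ^ p * ∑ j ∈ Finset.range J, (r (j + 1) + s (j + 1) * f ^ (p / 2)) * X ^ (p * j) := by
      rw [Finset.mul_sum]
      refine Finset.sum_congr rfl fun j _ => ?_
      rw [mul_add, mul_one, pow_add]
      ring
    rw [hshift] at h
    have hdvd : X ^ p ∣ r 0 + s 0 * f ^ (p / 2) := by
      refine ⟨-∑ j ∈ Finset.range J, (r (j + 1) + s (j + 1) * f ^ (p / 2)) * X ^ (p * j), ?_⟩
      simp only [mul_zero, pow_zero, mul_one] at h
      linear_combination h
    have hdvd2 : X ^ p ∣ f * r 0 ^ 2 - C (f.eval 0) * s 0 ^ 2 := by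
      have hpow : f ^ p = f * f ^ (p / 2) * f ^ (p / 2) := by
        rw [mul_assoc, ← pow_add, ← pow_succ', hpodd]
      have : f * r 0 ^ 2 - C (f.eval 0) * s 0 ^ 2
          = (r 0 + s 0 * f ^ (p / 2)) * (f * (r 0 - s 0 * f ^ (p / 2)))
            + (f ^ p - C (f.eval 0)) * s 0 ^ 2 := by
        rw [hpow]; ring
      rw [this]
      exact dvd_add (hdvd.mul_right _) ((X_pow_dvd_pow_sub_C f).mul_right _)
    have hr0 := hr 0 (by omega)
    have hs0 := hs 0 (by omega)
    have hdeg : (f * r 0 ^ 2 - C (f.eval 0) * s 0 ^ 2).natDegree < (X ^ p : (ZMod p)[X]).natDegree := by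
      rw [natDegree_X_pow]
      refine (natDegree_sub_le _ _).trans_lt (max_lt ?_ ?_)
      · refine natDegree_mul_le.trans_lt ?_
        have := natDegree_pow_le (p := r 0) (n := 2)
        omega
      · refine (natDegree_C_mul_le _ _).trans_lt ?_
        have := natDegree_pow_le (p := s 0) (n := 2)
        omega
    have hz := sub_eq_zero.1 (eq_zero_of_dvd_of_natDegree_lt hdvd2 hdeg)
    obtain ⟨hr00, hs00⟩ := eq_zero_of_mul_sq_eq hα h0 hz
    have hrest : ∑ j ∈ Finset.range J, (r (j + 1) + s (j + 1) * f ^ (p / 2)) * X ^ (p * j) = 0 := by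
      rw [hr00, hs00] at h
      simpa using h
    have := ih (fun j => r (j + 1)) (fun j => s (j + 1)) (fun j hj => hr _ (by omega))
      (fun j hj => hs _ (by omega)) hrest
    intro j hj
    cases j with
    | zero => exact ⟨hr00, hs00⟩
    | succ j => exact this j (by omega)

/-- The operator with `(f ^ e * u)⁽ⁱ⁾ = f ^ (e - i) * twistedDeriv f e i u`. -/
noncomputable def twistedDeriv {F : Type*} [Field F] (f : F[X]) (e : ℕ) : ℕ → F[X] →ₗ[F] F[X]
  | 0 => LinearMap.id
  | i + 1 => (LinearMap.mulLeft F f ∘ₗ derivative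
      + LinearMap.mulLeft F (((e - i : ℕ) : F[X]) * derivative f)) ∘ₗ twistedDeriv f e i

theorem twistedDeriv_succ {F : Type*} [Field F] (f : F[X]) (e i : ℕ) (u : F[X]) :
    twistedDeriv f e (i + 1) u = f * derivative (twistedDeriv f e i u)
      + ((e - i : ℕ) : F[X]) * derivative f * twistedDeriv f e i u := by
  simp [twistedDeriv, mul_assoc]

theorem natDegree_twistedDeriv_le {F : Type*} [Field F] (f : F[X]) (e i : ℕ) (u : F[X]) :
    (twistedDeriv f e i u).natDegree ≤ u.natDegree + i * f.natDegree := by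
  induction i with
  | zero => simp [twistedDeriv]
  | succ i ih =>
    rw [twistedDeriv_succ]
    refine (natDegree_add_le _ _).trans (max_le ?_ ?_)
    · refine natDegree_mul_le.trans ?_
      have := natDegree_derivative_le (twistedDeriv f e i u)
      rw [add_mul, one_mul]
      omega
    · refine natDegree_mul_le.trans ?_
      have h1 : (((e - i : ℕ) : F[X]) * derivative f).natDegree ≤ f.natDegree := by
        refine natDegree_mul_le.trans ?_
        rw [natDegree_natCast]
        have := natDegree_derivative_le f
        omega
      rw [add_mul, one_mul]
      omega

theorem iterate_derivative_pow_mul (f : (ZMod p)[X]) (e j i : ℕ) (hi : i ≤ e) (u : (ZMod p)[X]) :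
    derivative^[i] (f ^ e * u * X ^ (p * j))
      = f ^ (e - i) * twistedDeriv f e i u * X ^ (p * j) := by
  induction i with
  | zero => simp [twistedDeriv]
  | succ i ih =>
    rw [Function.iterate_succ_apply', ih (by omega), twistedDeriv_succ]
    obtain ⟨d, hd⟩ : ∃ d, e - i = d + 1 := ⟨e - i - 1, by omega⟩
    have hd' : e - (i + 1) = d := by omega
    rw [hd, hd']
    have hX : derivative (X ^ (p * j) : (ZMod p)[X]) = 0 := by
      rw [derivative_X_pow]
      simp
    rw [derivative_mul, hX, derivative_mul, derivative_pow]
    simp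
    ring


theorem mem_degreeLT_of_natDegree_lt {F : Type*} [Field F] {n : ℕ} {u : F[X]}
    (h : u.natDegree < n) : u ∈ degreeLT F n := by
  rw [mem_degreeLT]
  exact degree_le_natDegree.trans_lt (by exact_mod_cast h)

theorem natDegree_lt_of_mem_degreeLT {F : Type*} [Field F] {n : ℕ} (hn : 0 < n) {u : F[X]}
    (h : u ∈ degreeLT F n) : u.natDegree < n := by
  rw [mem_degreeLT] at h
  by_cases hu : u = 0
  · simpa [hu] using hn
  · exact (natDegree_lt_iff_degree_lt hu).2 h

/-- The linear system of Stepanov's method has a nontrivial solution as soon as it has more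
unknowns than equations. -/
theorem exists_stepanov_coefficients {F : Type*} [Field F] (f : F[X]) (a : F) (e B J l : ℕ)
    (hB : 0 < B) (hdim : l * (B + l * f.natDegree + J) < 2 * (J * B)) :
    ∃ r s : ℕ → F[X], (∀ j, (r j).natDegree < B) ∧ (∀ j, (s j).natDegree < B) ∧
      (∃ j < J, ¬ (r j = 0 ∧ s j = 0)) ∧
      ∀ i < l, ∑ j ∈ Finset.range J,
        X ^ j * (twistedDeriv f l i (r j) + C a * twistedDeriv f e i (s j)) = 0 := by
  let V := (Fin J → degreeLT F B) × (Fin J → degreeLT F B)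
  let n := B + l * f.natDegree + J
  let Φ : Fin l → V →ₗ[F] F[X] := fun i => ∑ j : Fin J, LinearMap.mulLeft F (X ^ (j : ℕ)) ∘ₗ
    (twistedDeriv f l i ∘ₗ Submodule.subtype _ ∘ₗ LinearMap.proj j ∘ₗ LinearMap.fst F _ _
      + LinearMap.mulLeft F (C a) ∘ₗ twistedDeriv f e i ∘ₗ Submodule.subtype _ ∘ₗ
        LinearMap.proj j ∘ₗ LinearMap.snd F _ _)
  have hΦ : ∀ i v, Φ i v = ∑ j : Fin J, X ^ (j : ℕ) *
      (twistedDeriv f l i (v.1 j) + C a * twistedDeriv f e i (v.2 j)) := by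
    intro i v
    simp [Φ, LinearMap.sum_apply]
    rfl
  have hmem : ∀ i v, Φ i v ∈ degreeLT F n := by
    intro i v
    rw [hΦ]
    refine Submodule.sum_mem _ fun j _ => mem_degreeLT_of_natDegree_lt ?_
    refine natDegree_mul_le.trans_lt ?_
    rw [natDegree_X_pow]
    have h1 := natDegree_lt_of_mem_degreeLT hB (v.1 j).2
    have h2 := natDegree_lt_of_mem_degreeLT hB (v.2 j).2
    have h3 := natDegree_twistedDeriv_le f l i (v.1 j : F[X])
    have h4 := natDegree_twistedDeriv_le f e i (v.2 j : F[X])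
    have h5 := natDegree_C_mul_le a (twistedDeriv f e i (v.2 j : F[X]))
    have h6 : (i : ℕ) * f.natDegree ≤ l * f.natDegree := Nat.mul_le_mul_right _ i.2.le
    have h7 := natDegree_add_le (twistedDeriv f l i (v.1 j : F[X]))
      (C a * twistedDeriv f e i (v.2 j : F[X]))
    have h8 := j.2
    simp only [n]
    omega
  let Ψ : V →ₗ[F] (Fin l → degreeLT F n) :=
    LinearMap.pi fun i => LinearMap.codRestrict _ (Φ i) (hmem i)
  have hfd : ∀ m : ℕ, FiniteDimensional F (degreeLT F m) := fun m =>
    (degreeLTEquiv F m).symm.finiteDimensional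
  have hfr : ∀ m : ℕ, Module.finrank F (degreeLT F m) = m := fun m => by
    rw [(degreeLTEquiv F m).finrank_eq]; simp
  have hlt : Module.finrank F (Fin l → degreeLT F n) < Module.finrank F V := by
    have := hfd B
    have := hfd n
    rw [Module.finrank_pi_fintype, Module.finrank_prod, Module.finrank_pi_fintype]
    simp only [hfr, Finset.sum_const, Finset.card_univ, Fintype.card_fin, smul_eq_mul]
    simp only [n]
    omega
  have hker : LinearMap.ker Ψ ≠ ⊥ := by
    have := hfd B
    have := hfd n
    exact LinearMap.ker_ne_bot_of_finrank_lt hlt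
  obtain ⟨v, hv, hv0⟩ := (Submodule.ne_bot_iff _).1 hker
  refine ⟨fun j => if h : j < J then (v.1 ⟨j, h⟩ : F[X]) else 0,
    fun j => if h : j < J then (v.2 ⟨j, h⟩ : F[X]) else 0, ?_, ?_, ?_, ?_⟩
  · intro j
    dsimp only
    split_ifs
    · exact natDegree_lt_of_mem_degreeLT hB (v.1 _).2
    · simpa using hB
  · intro j
    dsimp only
    split_ifs
    · exact natDegree_lt_of_mem_degreeLT hB (v.2 _).2
    · simpa using hB
  · by_contra! hall
    apply hv0
    refine Prod.ext (funext fun j => Subtype.ext ?_) (funext fun j => Subtype.ext ?_)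
    · simpa using (hall j j.2).1
    · simpa using (hall j j.2).2
  · intro i hi
    have h1 : Φ ⟨i, hi⟩ v = 0 := by
      have := congrFun (LinearMap.mem_ker.1 hv) ⟨i, hi⟩
      simpa [Ψ, Subtype.ext_iff] using this
    rw [hΦ] at h1
    rw [Finset.sum_range]
    simpa using h1

/-- Stepanov's bound for the number of solutions of `f(x) ^ ((p - 1) / 2) = a` with `a = ± 1`. -/
theorem stepanov_card_le {f : (ZMod p)[X]} {α a : ZMod p} (hp2 : p ≠ 2)
    (hα : f.rootMultiplicity α = 1) (h0 : f.eval 0 ≠ 0) (B J l : ℕ) (hB0 : 0 < B)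
    (hB : 2 * B + f.natDegree ≤ p) (hl : 0 < l) (hlp : l ≤ p)
    (hdim : l * (B + l * f.natDegree + J) < 2 * (J * B)) :
    l * (Finset.univ.filter fun x : ZMod p => f.eval x ^ (p / 2) = a).card
      ≤ (l + p / 2) * f.natDegree + B + p * J := by
  obtain ⟨r, s, hr, hs, ⟨j₀, hj₀, hne⟩, hsys⟩ :=
    exists_stepanov_coefficients f a (l + p / 2) B J l hB0 hdim
  set R : (ZMod p)[X] := ∑ j ∈ Finset.range J,
    (f ^ l * r j * X ^ (p * j) + f ^ (l + p / 2) * s j * X ^ (p * j)) with hRdef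
  have hf : f ≠ 0 := by
    rintro rfl
    simp at h0
  have hR : R ≠ 0 := by
    intro hR0
    have hfac : R = f ^ l * ∑ j ∈ Finset.range J, (r j + s j * f ^ (p / 2)) * X ^ (p * j) := by
      rw [hRdef, Finset.mul_sum]
      refine Finset.sum_congr rfl fun j _ => ?_
      rw [pow_add]; ring
    have hz : ∑ j ∈ Finset.range J, (r j + s j * f ^ (p / 2)) * X ^ (p * j) = 0 := by
      rw [hR0] at hfac
      exact (mul_eq_zero.1 hfac.symm).resolve_left (pow_ne_zero _ hf)
    exact hne (stepanov_aux_eq_zero hp2 hα h0 hB J r s (fun j _ => hr j) (fun j _ => hs j) hz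
      j₀ hj₀)
  have hroot : ∀ x ∈ Finset.univ.filter (fun x : ZMod p => f.eval x ^ (p / 2) = a),
      (X - C x) ^ l ∣ R := by
    intro x hx
    rw [Finset.mem_filter] at hx
    rw [← le_rootMultiplicity_iff hR]
    have hfact : ((l - 1).factorial : ZMod p) ∈ nonZeroDivisors (ZMod p) := by
      rw [mem_nonZeroDivisors_iff_ne_zero, Ne, ZMod.natCast_eq_zero_iff,
        (Fact.out : p.Prime).dvd_factorial]
      omega
    have := (lt_rootMultiplicity_iff_isRoot_iterate_derivative_of_mem_nonZeroDivisors (t := x)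
      hR hfact).2 ?_
    · omega
    intro i hi
    have hil : i < l := by omega
    rw [IsRoot.def, hRdef, iterate_derivative_sum, eval_finsetSum]
    have hterm : ∀ j ∈ Finset.range J, eval x (derivative^[i] (f ^ l * r j * X ^ (p * j)
        + f ^ (l + p / 2) * s j * X ^ (p * j))) = f.eval x ^ (l - i) *
        eval x (X ^ j * (twistedDeriv f l i (r j) + C a * twistedDeriv f (l + p / 2) i (s j))) := by
      intro j _
      rw [iterate_map_add, iterate_derivative_pow_mul _ _ _ _ hil.le,
        iterate_derivative_pow_mul _ _ _ _ (by omega)]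
      have he : l + p / 2 - i = (l - i) + p / 2 := by omega
      rw [he]
      simp only [eval_add, eval_mul, eval_pow, eval_X, eval_C, pow_add, pow_mul, ZMod.pow_card,
        hx.2]
      ring
    rw [Finset.sum_congr rfl hterm, ← Finset.mul_sum, ← eval_finsetSum, hsys i hil]
    simp
  have hdvd : ∏ x ∈ Finset.univ.filter (fun x : ZMod p => f.eval x ^ (p / 2) = a),
      (X - C x) ^ l ∣ R := by
    refine Finset.prod_dvd_of_coprime ?_ hroot
    intro x _ y _ hxy
    exact (pairwise_coprime_X_sub_C (s := fun x : ZMod p => x) Function.injective_id hxy).pow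
  have hdeg := natDegree_le_of_dvd hdvd hR
  rw [natDegree_prod _ _ (fun x _ => pow_ne_zero _ (X_sub_C_ne_zero x))] at hdeg
  simp only [natDegree_pow, natDegree_X_sub_C, mul_one, Finset.sum_const, smul_eq_mul] at hdeg
  rw [mul_comm]
  refine hdeg.trans (natDegree_sum_le_of_forall_le _ _ fun j hj => ?_)
  rw [Finset.mem_range] at hj
  have hpj : p * j ≤ p * J := Nat.mul_le_mul_left _ hj.le
  have hr' := hr j
  have hs' := hs j
  have hle : l * f.natDegree ≤ (l + p / 2) * f.natDegree := Nat.mul_le_mul_right _ (by omega)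
  refine (natDegree_add_le _ _).trans (max_le ?_ ?_)
  · refine natDegree_mul_le.trans ?_
    have := natDegree_mul_le (p := f ^ l) (q := r j)
    have := natDegree_pow_le (p := f) (n := l)
    rw [natDegree_X_pow]
    omega
  · refine natDegree_mul_le.trans ?_
    have := natDegree_mul_le (p := f ^ (l + p / 2)) (q := s j)
    have := natDegree_pow_le (p := f) (n := l + p / 2)
    rw [natDegree_X_pow]
    omega

theorem abs_sum_quadraticChar_prod_le_of_zero_notMem (hp2 : p ≠ 2) (S : Finset (ZMod p))
    (hS : S.Nonempty) (hS0 : 0 ∉ S) (t : ℕ) (ht : 0 < t) (h : 16 * (t ^ 2 * S.card) < p) :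
    |∑ x : ZMod p, ((quadraticChar (ZMod p) (∏ s ∈ S, (x + s)) : ℤ) : ℝ)|
      ≤ 5 * p * S.card / t := by
  set f : (ZMod p)[X] := ∏ s ∈ S, (X - C (-s)) with hf
  have hfeval : ∀ x, f.eval x = ∏ s ∈ S, (x + s) := by
    intro x
    rw [hf, eval_prod]
    simp
  have hdeg : f.natDegree = S.card := by
    rw [hf, natDegree_prod _ _ (fun s _ => X_sub_C_ne_zero (-s))]
    simp only [natDegree_X_sub_C, Finset.sum_const, smul_eq_mul, mul_one]
  have h0 : f.eval 0 ≠ 0 := by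
    rw [hfeval]
    simp only [zero_add]
    exact Finset.prod_ne_zero_iff.2 fun s hs hs0 => hS0 (hs0 ▸ hs)
  obtain ⟨s₀, hs₀⟩ := hS
  have hα : f.rootMultiplicity (-s₀) = 1 := by
    have hf' : f = ∏ a ∈ S.image (fun s => -s), (X - C a) := by
      rw [Finset.prod_image (fun a _ b _ hab => neg_injective hab)]
    rw [← count_roots, hf', roots_prod_X_sub_C]
    exact Multiset.count_eq_one_of_mem (Finset.nodup _) (Finset.mem_image_of_mem _ hs₀)
  have hD : 0 < S.card := Finset.card_pos.2 ⟨s₀, hs₀⟩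
  set D := S.card with hDdef
  have ht2D : t ≤ t ^ 2 * D := by nlinarith [Nat.mul_le_mul ht hD, Nat.mul_le_mul_left (t * t) hD]
  have hDt : D ≤ t ^ 2 * D := Nat.le_mul_of_pos_left _ (by positivity)
  have ht2 : t ^ 2 ≤ t ^ 2 * D := Nat.le_mul_of_pos_right _ hD
  have key : ∀ a : ZMod p,
      ((Finset.univ.filter fun x : ZMod p => f.eval x ^ (p / 2) = a).card : ℝ)
        ≤ p / 2 + D + p * D / t := by
    intro a
    have hdim : 2 * t * ((p - D) / 2 + 2 * t * f.natDegree + (t + 1))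
        < 2 * ((t + 1) * ((p - D) / 2)) := by
      rw [hdeg]
      have h2B : p - D - 1 ≤ 2 * ((p - D) / 2) := by omega
      have : 4 * (t ^ 2 * D) + 2 * t ^ 2 + 2 * t < 2 * ((p - D) / 2) := by omega
      nlinarith
    have hb := stepanov_card_le (a := a) hp2 hα h0 ((p - D) / 2) (t + 1) (2 * t) (by omega)
      (by omega) (by omega) (by omega) hdim
    rw [hdeg] at hb
    have hb' := (Nat.cast_le (α := ℝ)).2 hb
    push_cast at hb'
    have hhalf : ((p / 2 : ℕ) : ℝ) ≤ p / 2 := Nat.cast_div_le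
    have hBle : (((p - D) / 2 : ℕ) : ℝ) ≤ p / 2 := by
      refine le_trans ?_ hhalf
      exact_mod_cast Nat.div_le_div_right (Nat.sub_le _ _)
    have ht' : (0 : ℝ) < t := by exact_mod_cast ht
    have hD' : (1 : ℝ) ≤ D := by exact_mod_cast hD
    have hp' : (0 : ℝ) ≤ p := by positivity
    refine le_of_mul_le_mul_left ?_ (by positivity : (0 : ℝ) < 2 * t)
    refine hb'.trans ?_
    have e1 : 2 * (t : ℝ) * (p / 2 + D + p * D / t) = p * t + 2 * t * D + 2 * (p * D) := by
      field_simp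
    rw [e1]
    have := mul_le_mul_of_nonneg_right hhalf (by positivity : (0 : ℝ) ≤ D)
    nlinarith [mul_le_mul_of_nonneg_left hD' hp']
  set χ := quadraticChar (ZMod p) with hχ
  have hchar : ringChar (ZMod p) ≠ 2 := by rwa [ZMod.ringChar_zmod_n]
  have hχpow : ∀ y : ZMod p, ((χ y : ℤ) : ZMod p) = y ^ (p / 2) := by
    intro y
    have := quadraticChar_eq_pow_of_char_ne_two' hchar y
    rwa [ZMod.card] at this
  let n : ℤ → ℕ := fun a => (Finset.univ.filter fun x : ZMod p => χ (f.eval x) = a).card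
  have hn : ∀ a : ℤ, (n a : ℝ) ≤ p / 2 + D + p * D / t := by
    intro a
    refine le_trans ?_ (key (a : ZMod p))
    refine Nat.cast_le.2 (Finset.card_le_card fun x hx => ?_)
    rw [Finset.mem_filter] at hx ⊢
    exact ⟨hx.1, by rw [← hχpow, hx.2]⟩
  have hn0 : n 0 ≤ D := by
    have hsub : (Finset.univ.filter fun x : ZMod p => χ (f.eval x) = 0) ⊆ f.roots.toFinset := by
      intro x hx
      rw [Finset.mem_filter] at hx
      have hf0 : f ≠ 0 := by
        intro hz
        rw [hz] at h0
        simp at h0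
      rw [Multiset.mem_toFinset, mem_roots hf0]
      exact quadraticChar_eq_zero_iff.1 hx.2
    calc n 0 ≤ f.roots.toFinset.card := Finset.card_le_card hsub
      _ ≤ f.roots.card := Multiset.toFinset_card_le _
      _ ≤ D := hdeg ▸ card_roots' f
  have htri : ∀ x, χ (f.eval x) = 0 ∨ χ (f.eval x) = 1 ∨ χ (f.eval x) = -1 := by
    intro x
    by_cases hx : f.eval x = 0
    · left; exact quadraticChar_eq_zero_iff.2 hx
    · right; exact quadraticChar_dichotomy hx
  have hsum1 : (n 0 : ℝ) + n 1 + n (-1) = p := by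
    have : ∑ x : ZMod p, ((if χ (f.eval x) = 0 then (1 : ℝ) else 0)
        + (if χ (f.eval x) = 1 then (1 : ℝ) else 0)
        + (if χ (f.eval x) = -1 then (1 : ℝ) else 0)) = ∑ x : ZMod p, (1 : ℝ) := by
      refine Finset.sum_congr rfl fun x _ => ?_
      rcases htri x with h | h | h <;> simp [h]
    simp only [Finset.sum_add_distrib, Finset.sum_boole] at this
    simpa [n, ZMod.card] using this
  have hsum2 : ∑ x : ZMod p, ((χ (∏ s ∈ S, (x + s)) : ℤ) : ℝ) = (n 1 : ℝ) - n (-1) := by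
    have : ∑ x : ZMod p, ((if χ (f.eval x) = 1 then (1 : ℝ) else 0)
        - (if χ (f.eval x) = -1 then (1 : ℝ) else 0))
        = ∑ x : ZMod p, ((χ (∏ s ∈ S, (x + s)) : ℤ) : ℝ) := by
      refine Finset.sum_congr rfl fun x _ => ?_
      rw [← hfeval]
      rcases htri x with h | h | h <;> simp [h]
    rw [← this]
    simp only [Finset.sum_sub_distrib, Finset.sum_boole]
    rfl
  rw [hsum2]
  have h1 := hn 1
  have h2 := hn (-1)
  have h3 : (n 0 : ℝ) ≤ D := by exact_mod_cast hn0
  have ht' : (0 : ℝ) < t := by exact_mod_cast ht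
  have htp : (t : ℝ) ≤ p := by
    have : t ≤ p := by omega
    exact_mod_cast this
  have h4 : (D : ℝ) ≤ p * D / t := by
    rw [le_div_iff₀ ht', mul_comm]
    exact mul_le_mul_of_nonneg_right htp (by positivity)
  have e2 : 5 * (p : ℝ) * D / t = 5 * (p * D / t) := by ring
  rw [e2, abs_le]
  constructor <;> linarith

/-- A nontrivial bound for complete quadratic character sums over products of distinct linear
factors. -/
theorem abs_sum_quadraticChar_prod_le (hp2 : p ≠ 2) (S : Finset (ZMod p))
    (hS : S.Nonempty) (t : ℕ) (ht : 0 < t) (h : 16 * (t ^ 2 * S.card) < p) :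
    |∑ x : ZMod p, ((quadraticChar (ZMod p) (∏ s ∈ S, (x + s)) : ℤ) : ℝ)|
      ≤ 5 * p * S.card / t := by
  have hDt : S.card ≤ t ^ 2 * S.card := Nat.le_mul_of_pos_left _ (by positivity)
  obtain ⟨y, hy⟩ : ∃ y, y ∉ S := by
    by_contra! hall
    have : S = Finset.univ := Finset.eq_univ_iff_forall.2 hall
    rw [this, Finset.card_univ, ZMod.card] at hDt h
    omega
  have hinj : Function.Injective fun s : ZMod p => s - y := sub_left_injective
  have hcard : (S.image fun s => s - y).card = S.card := Finset.card_image_of_injective _ hinj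
  have := abs_sum_quadraticChar_prod_le_of_zero_notMem hp2 (S.image fun s => s - y)
    (hS.image _) (by simpa [sub_eq_zero] using hy) t ht (by rwa [hcard])
  rw [hcard] at this
  convert this using 2
  rw [← Equiv.sum_comp (Equiv.subRight y)]
  refine Finset.sum_congr rfl fun x _ => ?_
  rw [Finset.prod_image (fun a _ b _ hab => hinj hab)]
  congr 3 with s
  simp only [Equiv.subRight_apply]
  ring

end Stepanov

section GowersAverages

/-- Iterated differencing averages: `boxAvg k f` is the average of `|𝔼 n, ∏ f (n + ω • a)|` over
all `k`-fold pairs of shifts. -/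
noncomputable def boxAvg {α : Type*} [AddCommGroup α] [Fintype α] : ℕ → (α → ℝ) → ℝ
  | 0, f => |𝔼 n, f n|
  | k + 1, f => 𝔼 a, 𝔼 b, boxAvg k fun n => f (n + a) * f (n + b)

variable {α β : Type*} [AddCommGroup α] [Fintype α] [AddCommGroup β] [Fintype β]

theorem boxAvg_nonneg (k : ℕ) (f : α → ℝ) : 0 ≤ boxAvg k f := by
  induction k generalizing f with
  | zero => exact abs_nonneg _
  | succ k ih => exact Finset.expect_nonneg fun a _ => Finset.expect_nonneg fun b _ => ih _

theorem abs_mul_le_one {u v : ℝ} (hu : |u| ≤ 1) (hv : |v| ≤ 1) : |u * v| ≤ 1 := by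
  rw [abs_mul]
  exact mul_le_one₀ hu (abs_nonneg _) hv

theorem boxAvg_le_one (k : ℕ) (f : α → ℝ) (hf : ∀ n, |f n| ≤ 1) : boxAvg k f ≤ 1 := by
  induction k generalizing f with
  | zero =>
    exact (Finset.abs_expect_le _ _).trans (Finset.expect_le Finset.univ_nonempty fun n _ => hf n)
  | succ k ih =>
    exact Finset.expect_le Finset.univ_nonempty fun a _ =>
      Finset.expect_le Finset.univ_nonempty fun b _ => ih _ fun n => abs_mul_le_one (hf _) (hf _)

theorem boxAvg_comp_equiv (e : α ≃+ β) (k : ℕ) (f : β → ℝ) :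
    boxAvg k (fun n => f (e n)) = boxAvg k f := by
  induction k generalizing f with
  | zero => exact congrArg abs (Fintype.expect_equiv e.toEquiv _ _ fun _ => rfl)
  | succ k ih =>
    refine Fintype.expect_equiv e.toEquiv _ _ fun a => Fintype.expect_equiv e.toEquiv _ _ fun b => ?_
    simp only [map_add]
    exact ih fun n => f (n + e a) * f (n + e b)

theorem boxAvg_prod (k : ℕ) (f : α → ℝ) (g : β → ℝ) :
    boxAvg k (fun n : α × β => f n.1 * g n.2) = boxAvg k f * boxAvg k g := by
  induction k generalizing f g with
  | zero =>
    simp only [boxAvg]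
    rw [← abs_mul, Fintype.expect_mul_expect, ← Finset.univ_product_univ, Finset.expect_product]
  | succ k ih =>
    have : ∀ a b : α × β, (boxAvg k fun n : α × β =>
        (f (n + a).1 * g (n + a).2) * (f (n + b).1 * g (n + b).2))
        = (boxAvg k fun n => f (n + a.1) * f (n + b.1)) *
          boxAvg k fun n => g (n + a.2) * g (n + b.2) := by
      intro a b
      rw [← ih]
      congr 1
      ext n
      simp only [Prod.fst_add, Prod.snd_add]
      ring
    simp only [boxAvg, this]
    rw [Fintype.expect_mul_expect, ← Finset.univ_product_univ, Finset.expect_product]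
    refine Finset.expect_congr rfl fun a _ => Finset.expect_congr rfl fun b _ => ?_
    rw [Fintype.expect_mul_expect, Finset.expect_product]

theorem boxAvg_const_mul (k : ℕ) (c : ℝ) (hc : c ^ 2 = 1) (f : α → ℝ) :
    boxAvg k (fun n => c * f n) = boxAvg k f := by
  cases k with
  | zero =>
    have hc' : |c| = 1 := by
      rw [← sq_eq_sq₀ (abs_nonneg _) zero_le_one, sq_abs, hc, one_pow]
    simp only [boxAvg]
    rw [← Finset.mul_expect, abs_mul, hc', one_mul]
  | succ k =>
    simp only [boxAvg]
    refine Finset.expect_congr rfl fun a _ => Finset.expect_congr rfl fun b _ =>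
      congrArg (boxAvg k) (funext fun n => ?_)
    linear_combination f (n + a) * f (n + b) * hc

theorem boxAvg_quadraticChar_prod_le {p : ℕ} [Fact p.Prime] (hp2 : p ≠ 2) (k : ℕ)
    (S : Finset (ZMod p)) (hS : S.Nonempty) (t : ℕ) (ht : 0 < t)
    (h : 16 * (t ^ 2 * (2 ^ k * S.card)) < p) :
    boxAvg k (fun n : ZMod p => ((quadraticChar (ZMod p) (∏ s ∈ S, (n + s)) : ℤ) : ℝ))
      ≤ 5 * (2 ^ k * S.card) / t + (4 ^ k - 1) * S.card ^ 2 / p := by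
  have hp0 : (0 : ℝ) < p := by exact_mod_cast (Fact.out : p.Prime).pos
  induction k generalizing S with
  | zero =>
    simp only [boxAvg]
    rw [Fintype.expect_eq_sum_div_card, ZMod.card, abs_div, Nat.abs_cast, div_le_iff₀ hp0]
    refine (abs_sum_quadraticChar_prod_le hp2 S hS t ht (by simpa using h)).trans (le_of_eq ?_)
    field_simp
    ring
  | succ k ih =>
    set C : ℝ := 5 * (2 ^ (k + 1) * S.card) / t + (4 ^ k - 1) * (2 * S.card) ^ 2 / p with hC
    have h4 : (1 : ℝ) ≤ 4 ^ k := one_le_pow₀ (by norm_num)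
    have hC0 : 0 ≤ C := by
      have : (0 : ℝ) ≤ 4 ^ k - 1 := by linarith
      positivity
    have hpt : ∀ a b : ZMod p, boxAvg k (fun n : ZMod p =>
        ((quadraticChar (ZMod p) (∏ s ∈ S, (n + a + s)) : ℤ) : ℝ) *
          ((quadraticChar (ZMod p) (∏ s ∈ S, (n + b + s)) : ℤ) : ℝ)) ≤
        C + ∑ s ∈ S, ∑ r ∈ S, if a + s - r = b then (1 : ℝ) else 0 := by
      intro a b
      by_cases hd : ∃ s ∈ S, ∃ r ∈ S, a + s - r = b
      · obtain ⟨s, hs, r, hr, hsr⟩ := hd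
        have h1 : (1 : ℝ) ≤ ∑ s ∈ S, ∑ r ∈ S, if a + s - r = b then (1 : ℝ) else 0 := by
          refine le_trans ?_ (Finset.single_le_sum (f := fun s => ∑ r ∈ S,
            if a + s - r = b then (1 : ℝ) else 0) (fun i _ => Finset.sum_nonneg fun j _ => by
              positivity) hs)
          refine le_trans ?_ (Finset.single_le_sum (f := fun r =>
            if a + s - r = b then (1 : ℝ) else 0) (fun i _ => by positivity) hr)
          simp [hsr]
        refine (boxAvg_le_one k _ fun n => abs_mul_le_one ?_ ?_).trans (by linarith)
        all_goals
          rw [← Int.cast_abs]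
          rcases quadraticChar_isQuadratic (ZMod p) _ with h | h | h <;> rw [h] <;> norm_num
      · push Not at hd
        let e (c : ZMod p) : ZMod p ↪ ZMod p := addLeftEmbedding c
        have hdisj : Disjoint (S.map (e a)) (S.map (e b)) := by
          rw [Finset.disjoint_left]
          intro y hy hy'
          rw [Finset.mem_map] at hy hy'
          obtain ⟨s, hs, rfl⟩ := hy
          obtain ⟨r, hr, hrs⟩ := hy'
          refine hd s hs r hr ?_
          simp only [e, addLeftEmbedding_apply] at hrs
          rw [← hrs]; ring
        have hcard : ((S.map (e a)).disjUnion (S.map (e b)) hdisj).card = 2 * S.card := by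
          rw [Finset.card_disjUnion, Finset.card_map, Finset.card_map, two_mul]
        have := ih ((S.map (e a)).disjUnion (S.map (e b)) hdisj)
          (by rw [← Finset.card_pos, hcard]; have := hS.card_pos; omega)
          (by rw [hcard]; convert h using 3; ring)
        have hle : ∀ u v : ℝ, u ≤ C → 0 ≤ v → u ≤ C + v := fun u v h1 h2 => by linarith
        refine hle _ _ ?_ (Finset.sum_nonneg fun i _ => Finset.sum_nonneg fun j _ => by
          positivity)
        rw [hcard] at this
        convert this using 1
        · congr 1
          ext n
          rw [Finset.prod_disjUnion, Finset.prod_map, Finset.prod_map, map_mul, Int.cast_mul]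
          simp only [e, addLeftEmbedding_apply, add_assoc]
        · rw [hC]; push_cast; ring
    have hbad : 𝔼 a : ZMod p, 𝔼 b : ZMod p, (∑ s ∈ S, ∑ r ∈ S,
        if a + s - r = b then (1 : ℝ) else 0) = S.card ^ 2 / p := by
      simp only [Finset.expect_sum_comm]
      simp only [Fintype.expect_eq_sum_div_card, ZMod.card]
      simp [Finset.sum_const, hp0.ne']
      field_simp
    calc boxAvg (k + 1) _ ≤ 𝔼 a : ZMod p, 𝔼 b : ZMod p, (C + ∑ s ∈ S, ∑ r ∈ S,
        if a + s - r = b then (1 : ℝ) else 0) :=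
          Finset.expect_le_expect fun a _ => Finset.expect_le_expect fun b _ => hpt a b
      _ = C + S.card ^ 2 / p := by
        simp only [Finset.expect_add_distrib]
        rw [hbad, Fintype.expect_const, Fintype.expect_const]
      _ ≤ _ := by
        rw [hC, add_assoc]
        gcongr
        rw [← add_div]
        gcongr
        rw [pow_succ (4 : ℝ) k]
        nlinarith [sq_nonneg (S.card : ℝ)]

end GowersAverages

section VanDerCorput

theorem sum_range_mul_natCast {q : ℕ} [NeZero q] (f : ZMod q → ℝ) (m : ℕ) :
    ∑ i ∈ Finset.range (q * m), f i = m * ∑ a, f a := by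
  have h1 : ∑ i ∈ Finset.range q, f i = ∑ a, f a := by
    refine Finset.sum_bij' (fun i _ => (i : ZMod q)) (fun a _ => a.val) ?_ ?_ ?_ ?_ ?_
    · simp
    · intro a _; simpa using ZMod.val_lt a
    · intro i hi; exact ZMod.val_cast_of_lt (Finset.mem_range.1 hi)
    · intro a _; simp
    · intro i _; rfl
  induction m with
  | zero => simp
  | succ m ih =>
    rw [mul_add, mul_one, Finset.sum_range_add, ih]
    simp [h1]
    ring

/-- Averages over `range q` of a function on `ZMod q`. -/
theorem expect_range_natCast {q : ℕ} [NeZero q] (f : ZMod q → ℝ) :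
    𝔼 i ∈ Finset.range q, f i = 𝔼 a, f a := by
  have := sum_range_mul_natCast f 1
  rw [Finset.expect_eq_sum_div_card, Fintype.expect_eq_sum_div_card, ZMod.card, Finset.card_range]
  simpa using congrArg (· / (q : ℝ)) this

theorem abs_sum_range_sub_le {q : ℕ} [NeZero q] (f : ZMod q → ℝ) (hf : ∀ a, |f a| ≤ 1) (L : ℕ) :
    |∑ i ∈ Finset.range L, f i - L * 𝔼 a, f a| ≤ 2 * q := by
  have hq : (0 : ℝ) < q := by exact_mod_cast Nat.pos_of_neZero q
  have hE : |𝔼 a, f a| ≤ 1 :=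
    (Finset.abs_expect_le _ _).trans (Finset.expect_le Finset.univ_nonempty fun n _ => hf n)
  have hL : (L : ℝ) = q * (L / q : ℕ) + (L % q : ℕ) := by exact_mod_cast (Nat.div_add_mod L q).symm
  have hr : ((L % q : ℕ) : ℝ) ≤ q := by exact_mod_cast (Nat.mod_lt L (Nat.pos_of_neZero q)).le
  have hS : ∑ a, f a = q * 𝔼 a, f a := by
    rw [Fintype.expect_eq_sum_div_card, ZMod.card]
    field_simp
  have h1 : ∑ i ∈ Finset.range L, f i - L * 𝔼 a, f a
      = ∑ i ∈ Finset.range (L % q), f ((q * (L / q) + i : ℕ)) - (L % q : ℕ) * 𝔼 a, f a := by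
    conv_lhs => rw [hL]
    conv_lhs => rw [← Nat.div_add_mod L q, Finset.sum_range_add, sum_range_mul_natCast, hS,
      Nat.div_add_mod L q]
    ring
  rw [h1]
  have h2 : |∑ i ∈ Finset.range (L % q), f ((q * (L / q) + i : ℕ))| ≤ (L % q : ℕ) := by
    refine (Finset.abs_sum_le_sum_abs _ _).trans ?_
    refine (Finset.sum_le_sum fun i _ => hf _).trans (by simp)
  have h3 : |((L % q : ℕ) : ℝ) * 𝔼 a, f a| ≤ (L % q : ℕ) := by
    rw [abs_mul, Nat.abs_cast]
    exact mul_le_of_le_one_right (Nat.cast_nonneg _) hE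
  refine (abs_sub _ _).trans ?_
  linarith

theorem pow_le_pow_add_mul {u v e : ℝ} (hu0 : 0 ≤ u) (hu : u ≤ 1) (hv0 : 0 ≤ v) (hv : v ≤ 1)
    (he : 0 ≤ e) (h : u ≤ v + e) (m : ℕ) : u ^ m ≤ v ^ m + m * e := by
  induction m with
  | zero => simp
  | succ m ih =>
    have h1 : v ^ m ≤ 1 := pow_le_one₀ hv0 hv
    have h2 : 0 ≤ v ^ m := pow_nonneg hv0 m
    calc u ^ (m + 1) = u ^ m * u := pow_succ _ _
      _ ≤ (v ^ m + m * e) * u := by gcongr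
      _ = v ^ m * u + m * e * u := by ring
      _ ≤ v ^ m * (v + e) + m * e * 1 := by gcongr
      _ ≤ v ^ (m + 1) + (m + 1 : ℕ) * e := by
        push_cast
        rw [pow_succ]
        nlinarith [mul_le_mul_of_nonneg_right h1 he]

theorem abs_sum_range_sub_sum_range_shift_le (F : ℕ → ℝ) (hF : ∀ i, |F i| ≤ 1) (L s : ℕ) :
    |∑ i ∈ Finset.range L, F i - ∑ i ∈ Finset.range L, F (i + s)| ≤ 2 * s := by
  have h1 : ∑ i ∈ Finset.range L, F i - ∑ i ∈ Finset.range L, F (i + s)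
      = ∑ i ∈ Finset.range s, F i - ∑ i ∈ Finset.range s, F (L + i) := by
    have e1 := Finset.sum_range_add F L s
    have e2 := Finset.sum_range_add F s L
    rw [add_comm s L] at e2
    simp only [add_comm s] at e2
    linarith
  have hb : ∀ G : ℕ → ℝ, (∀ i, |G i| ≤ 1) → |∑ i ∈ Finset.range s, G i| ≤ s := fun G hG =>
    (Finset.abs_sum_le_sum_abs _ _).trans ((Finset.sum_le_sum fun i _ => hG i).trans (by simp))
  rw [h1]
  refine (abs_sub _ _).trans ?_
  linarith [hb F hF, hb (fun i => F (L + i)) fun i => hF _]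

theorem expect_pow_le {ι : Type*} (s : Finset ι) (hs : s.Nonempty) (f : ι → ℝ)
    (hf : ∀ i ∈ s, 0 ≤ f i) (n : ℕ) : (𝔼 i ∈ s, f i) ^ n ≤ 𝔼 i ∈ s, f i ^ n := by
  have hc : (0 : ℝ) < s.card := by exact_mod_cast hs.card_pos
  have := Real.pow_arith_mean_le_arith_mean_pow s (fun _ => (s.card : ℝ)⁻¹) f
    (fun _ _ => by positivity) (by simp [hc.ne']) hf n
  rw [Finset.expect_eq_sum_div_card, Finset.expect_eq_sum_div_card]
  rw [← Finset.mul_sum, ← Finset.mul_sum, inv_mul_eq_div, inv_mul_eq_div] at this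
  exact this

/-- Repeated van der Corput differencing with shifts divisible by the successive moduli `d j`,
which removes the `d j`-periodic factors one at a time. -/
theorem vanDerCorput {q : ℕ} [NeZero q] (D : ℕ) (d : ℕ → ℕ) (k : ℕ)
    (hdq : ∀ j < k, (d j).Coprime q) (hd : ∀ j < k, d j ≤ D) (hD : 0 < D)
    (f : ZMod q → ℝ) (hf : ∀ a, |f a| ≤ 1) (G : ℕ → ℕ → ℝ) (hG : ∀ j n, |G j n| ≤ 1)
    (hper : ∀ j < k, Function.Periodic (G j) (d j)) (L : ℕ) (hL : 0 < L) :
    (|∑ i ∈ Finset.range L, f i * ∏ j ∈ Finset.range k, G j i| / L) ^ 2 ^ k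
      ≤ boxAvg k f + 4 * 2 ^ k * (q * D / L) := by
  have hq : (0 : ℝ) < q := by exact_mod_cast Nat.pos_of_neZero q
  have hL' : (0 : ℝ) < L := by exact_mod_cast hL
  have hD' : (1 : ℝ) ≤ D := by exact_mod_cast hD
  induction k generalizing f G with
  | zero =>
    simp only [Finset.range_zero, Finset.prod_empty, mul_one, pow_zero, pow_one, boxAvg]
    rw [div_le_iff₀ hL', add_mul]
    have h1 := abs_sum_range_sub_le f hf L
    have h2 := abs_sub_abs_le_abs_sub (∑ i ∈ Finset.range L, f i) (L * 𝔼 a, f a)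
    rw [abs_mul, Nat.abs_cast] at h2
    have h3 : 4 * (q * D / L : ℝ) * L = 4 * (q * D) := by field_simp
    rw [h3]
    nlinarith
  | succ k ih =>
    set dk := d k with hdk
    have hdk1 : (dk : ℝ) ≤ D := by exact_mod_cast hd k (Nat.lt_succ_self k)
    have hco : dk.Coprime q := hdq k (Nat.lt_succ_self k)
    set F : ℕ → ℝ := fun i => f i * ∏ j ∈ Finset.range k, G j i with hF
    have hprod : ∀ i, |∏ j ∈ Finset.range k, G j i| ≤ 1 := fun i => by
      rw [Finset.abs_prod]
      exact Finset.prod_le_one (fun _ _ => abs_nonneg _) fun j _ => hG j i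
    have hF1 : ∀ i, |F i| ≤ 1 := fun i => abs_mul_le_one (hf _) (hprod i)
    have hper' : ∀ i h, G k (i + h * dk) = G k i := fun i h => by
      simpa using (hper k (Nat.lt_succ_self k)).nat_mul h i
    have hRne : (Finset.range q).Nonempty := by simpa using NeZero.ne q
    -- averaging over shifts by multiples of `dk`
    set V : ℝ := |∑ i ∈ Finset.range L, G k i * 𝔼 h ∈ Finset.range q, F (i + h * dk)| / L with hV
    set u : ℝ := |∑ i ∈ Finset.range L, f i * ∏ j ∈ Finset.range (k + 1), G j i| / L with hu
    have hsumle : ∀ H : ℕ → ℝ, (∀ i, |H i| ≤ 1) → |∑ i ∈ Finset.range L, H i| / L ≤ 1 := by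
      intro H hH
      rw [div_le_one hL']
      exact (Finset.abs_sum_le_sum_abs _ _).trans
        ((Finset.sum_le_sum fun i _ => hH i).trans (by simp))
    have hu1 : u ≤ 1 := hsumle _ fun i => by
      rw [Finset.prod_range_succ, ← mul_assoc]
      exact abs_mul_le_one (hF1 i) (hG k i)
    have hV1 : V ≤ 1 := hsumle _ fun i => abs_mul_le_one (hG k i)
      ((Finset.abs_expect_le _ _).trans (Finset.expect_le hRne fun h _ => hF1 _))
    have huV : u ≤ V + 2 * (q * D / L) := by
      have key : |∑ i ∈ Finset.range L, F i * G k i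
          - ∑ i ∈ Finset.range L, G k i * 𝔼 h ∈ Finset.range q, F (i + h * dk)| ≤ 2 * (q * D) := by
        have : ∑ i ∈ Finset.range L, F i * G k i
            - ∑ i ∈ Finset.range L, G k i * 𝔼 h ∈ Finset.range q, F (i + h * dk)
            = 𝔼 h ∈ Finset.range q, (∑ i ∈ Finset.range L, F i * G k i
              - ∑ i ∈ Finset.range L, F (i + h * dk) * G k (i + h * dk)) := by
          rw [Finset.expect_sub_distrib, Finset.expect_const hRne, Finset.expect_sum_comm]
          congr 1
          refine Finset.sum_congr rfl fun i _ => ?_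
          rw [Finset.mul_expect]
          refine Finset.expect_congr rfl fun h _ => ?_
          rw [hper', mul_comm]
        rw [this]
        refine (Finset.abs_expect_le _ _).trans (Finset.expect_le hRne fun h hh => ?_)
        refine (abs_sum_range_sub_sum_range_shift_le (fun i => F i * G k i)
          (fun i => abs_mul_le_one (hF1 i) (hG k i)) L (h * dk)).trans ?_
        have : (h : ℝ) ≤ q := by exact_mod_cast (Finset.mem_range.1 hh).le
        push_cast
        gcongr
      have h2 := abs_sub_abs_le_abs_sub (∑ i ∈ Finset.range L, F i * G k i)
        (∑ i ∈ Finset.range L, G k i * 𝔼 h ∈ Finset.range q, F (i + h * dk))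
      have hu' : u = |∑ i ∈ Finset.range L, F i * G k i| / L := by
        rw [hu]
        simp only [Finset.prod_range_succ, hF, mul_assoc]
      rw [hu', hV, ← mul_div_assoc, ← add_div]
      gcongr
      linarith
    -- Cauchy-Schwarz
    set W : ℕ → ℕ → ℝ := fun h h' =>
      |∑ i ∈ Finset.range L, F (i + h * dk) * F (i + h' * dk)| / L with hW
    have hVW : V ^ 2 ≤ 𝔼 h ∈ Finset.range q, 𝔼 h' ∈ Finset.range q, W h h' := by
      have hcs := Finset.sum_mul_sq_le_sq_mul_sq (Finset.range L) (G k)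
        (fun i => 𝔼 h ∈ Finset.range q, F (i + h * dk))
      have hG2 : ∑ i ∈ Finset.range L, G k i ^ 2 ≤ L := by
        refine (Finset.sum_le_sum fun i _ => (sq_le_one_iff_abs_le_one _).2 (hG k i)).trans ?_
        simp
      have hexp : ∑ i ∈ Finset.range L, (𝔼 h ∈ Finset.range q, F (i + h * dk)) ^ 2
          = 𝔼 h ∈ Finset.range q, 𝔼 h' ∈ Finset.range q,
            ∑ i ∈ Finset.range L, F (i + h * dk) * F (i + h' * dk) := by
        simp only [Finset.expect_sum_comm]
        refine Finset.sum_congr rfl fun i _ => ?_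
        rw [sq, Finset.expect_mul_expect]
      rw [hV, div_pow, sq_abs, div_le_iff₀ (by positivity)]
      calc _ ≤ _ := hcs
        _ ≤ L * ∑ i ∈ Finset.range L, (𝔼 h ∈ Finset.range q, F (i + h * dk)) ^ 2 := by
          gcongr
        _ ≤ L * 𝔼 h ∈ Finset.range q, 𝔼 h' ∈ Finset.range q, (W h h' * L) := by
          rw [hexp]
          refine mul_le_mul_of_nonneg_left ?_ hL'.le
          refine Finset.expect_le_expect fun h _ => Finset.expect_le_expect fun h' _ => ?_
          rw [hW]
          simp only
          rw [div_mul_cancel₀ _ hL'.ne']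
          exact le_abs_self _
        _ = _ := by
          simp only [← Finset.expect_mul]
          ring
    have hW0 : ∀ h h', 0 ≤ W h h' := fun h h' => by positivity
    have hWU : ∀ h h', W h h' ^ 2 ^ k ≤
        boxAvg k (fun a : ZMod q => f (a + h * dk) * f (a + h' * dk))
          + 4 * 2 ^ k * (q * D / L) := by
      intro h h'
      have := ih (fun j hj => hdq j (hj.trans (Nat.lt_succ_self k)))
        (fun j hj => hd j (hj.trans (Nat.lt_succ_self k)))
        (fun a : ZMod q => f (a + h * dk) * f (a + h' * dk))
        (fun a => abs_mul_le_one (hf _) (hf _))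
        (fun j n => G j (n + h * dk) * G j (n + h' * dk))
        (fun j n => abs_mul_le_one (hG _ _) (hG _ _))
        (fun j hj n => by
          have := hper j (hj.trans (Nat.lt_succ_self k))
          simp only [add_right_comm n (d j), this _])
      have heq : ∀ i : ℕ, f (i + h * dk) * f (i + h' * dk) *
          ∏ j ∈ Finset.range k, (G j (i + h * dk) * G j (i + h' * dk))
          = F (i + h * dk) * F (i + h' * dk) := by
        intro i
        simp only [hF, Finset.prod_mul_distrib]
        push_cast
        ring
      simp only [heq] at this
      exact this
    have hdu : IsUnit (dk : ZMod q) := (ZMod.isUnit_iff_coprime dk q).2 hco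
    have hreindex : ∀ g : ZMod q → ℝ, 𝔼 h ∈ Finset.range q, g (h * dk) = 𝔼 a, g a := by
      intro g
      rw [expect_range_natCast fun a : ZMod q => g (a * (dk : ZMod q))]
      exact Fintype.expect_equiv (Equiv.ofBijective (fun a : ZMod q => a * (dk : ZMod q))
        (IsUnit.isUnit_iff_mulRight_bijective.1 hdu)) _ _ fun _ => rfl
    have hpow := pow_le_pow_add_mul (by positivity) hu1 (by positivity) hV1 (by positivity) huV
      (2 ^ (k + 1))
    calc u ^ 2 ^ (k + 1) ≤ _ := hpow
      _ = (V ^ 2) ^ 2 ^ k + 4 * 2 ^ k * (q * D / L) := by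
        rw [← pow_mul, ← pow_succ']
        push_cast
        ring
      _ ≤ (𝔼 h ∈ Finset.range q, 𝔼 h' ∈ Finset.range q, W h h') ^ 2 ^ k
          + 4 * 2 ^ k * (q * D / L) := by gcongr
      _ ≤ 𝔼 h ∈ Finset.range q, 𝔼 h' ∈ Finset.range q, W h h' ^ 2 ^ k
          + 4 * 2 ^ k * (q * D / L) := by
        gcongr
        refine (expect_pow_le _ hRne _ (fun h _ => Finset.expect_nonneg fun h' _ => hW0 _ _)
          _).trans (Finset.expect_le_expect fun h _ => ?_)
        exact expect_pow_le _ hRne _ (fun h' _ => hW0 _ _) _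
      _ ≤ 𝔼 h ∈ Finset.range q, 𝔼 h' ∈ Finset.range q,
          (boxAvg k (fun a : ZMod q => f (a + h * dk) * f (a + h' * dk))
          + 4 * 2 ^ k * (q * D / L)) + 4 * 2 ^ k * (q * D / L) := by
        gcongr with h _ h' _
        exact hWU h h'
      _ = boxAvg (k + 1) f + 4 * 2 ^ (k + 1) * (q * D / L) := by
        simp only [Finset.expect_add_distrib]
        rw [Finset.expect_const hRne, Finset.expect_const hRne]
        have e1 : ∀ h : ℕ, 𝔼 h' ∈ Finset.range q,
            boxAvg k (fun a : ZMod q => f (a + h * dk) * f (a + h' * dk))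
            = 𝔼 b, boxAvg k (fun a : ZMod q => f (a + h * dk) * f (a + b)) := fun h =>
          hreindex fun b => boxAvg k (fun a : ZMod q => f (a + h * dk) * f (a + b))
        simp only [e1]
        rw [hreindex fun c => 𝔼 b, boxAvg k (fun a : ZMod q => f (a + c) * f (a + b))]
        simp only [boxAvg]
        ring

end VanDerCorput

section PeriodicProducts

/-- `g` is a `1`-bounded `q`-periodic function whose `k`-fold differencing average is at
most `B`. -/
def BoxBounded (k q : ℕ) (g : ℕ → ℝ) (B : ℝ) : Prop :=
  ∃ _ : NeZero q, ∃ f : ZMod q → ℝ, (∀ n : ℕ, g n = f n) ∧ (∀ a, |f a| ≤ 1) ∧ boxAvg k f ≤ B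

theorem BoxBounded.mul {k m n : ℕ} {g h : ℕ → ℝ} {B C : ℝ} (hmn : m.Coprime n)
    (hg : BoxBounded k m g B) (hh : BoxBounded k n h C) :
    BoxBounded k (m * n) (fun i => g i * h i) (B * C) := by
  obtain ⟨hm0, f, hf, hf1, hfB⟩ := hg
  obtain ⟨hn0, f', hf', hf1', hfB'⟩ := hh
  let e := ZMod.chineseRemainder hmn
  refine ⟨⟨mul_ne_zero hm0.ne hn0.ne⟩, fun x => f (e x).1 * f' (e x).2, fun i => ?_,
    fun a => abs_mul_le_one (hf1 _) (hf1' _), ?_⟩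
  · simp only [hf, hf', map_natCast, Prod.fst_natCast, Prod.snd_natCast]
  · have : NeZero (m * n) := ⟨mul_ne_zero hm0.ne hn0.ne⟩
    have h1 := boxAvg_comp_equiv e.toAddEquiv k fun x : ZMod m × ZMod n => f x.1 * f' x.2
    rw [boxAvg_prod] at h1
    refine (le_of_eq h1).trans ?_
    exact mul_le_mul hfB hfB' (boxAvg_nonneg _ _) ((boxAvg_nonneg _ _).trans hfB)

theorem BoxBounded.prod {k : ℕ} (Q : Finset ℕ) (hQ : ∀ p ∈ Q, p.Prime) (g : ℕ → ℕ → ℝ)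
    (B : ℕ → ℝ) (h : ∀ p ∈ Q, BoxBounded k p (g p) (B p)) :
    BoxBounded k (∏ p ∈ Q, p) (fun i => ∏ p ∈ Q, g p i) (∏ p ∈ Q, B p) := by
  induction Q using Finset.induction_on with
  | empty =>
    simp only [Finset.prod_empty]
    exact ⟨inferInstance, fun _ => 1, by simp, by simp, boxAvg_le_one _ _ (by simp)⟩
  | insert p Q hp ih =>
    simp only [Finset.prod_insert hp]
    refine (h p (Finset.mem_insert_self _ _)).mul ?_
      (ih (fun r hr => hQ r (Finset.mem_insert_of_mem hr))
        fun r hr => h r (Finset.mem_insert_of_mem hr))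
    refine Nat.Coprime.prod_right fun r hr => (Nat.coprime_primes (hQ p (Finset.mem_insert_self _ _))
      (hQ r (Finset.mem_insert_of_mem hr))).2 ?_
    rintro rfl
    exact hp hr

theorem sum_range_ite_modEq {p j₀ : ℕ} (hj : j₀ < p) (L : ℕ) (h : ℕ → ℝ) :
    ∑ i ∈ Finset.range L, (if i % p = j₀ then h i else 0)
      = ∑ j ∈ Finset.range ((L + (p - 1 - j₀)) / p), h (j₀ + p * j) := by
  have hp : 0 < p := by omega
  rw [← Finset.sum_filter]
  refine Finset.sum_nbij' (fun i => i / p) (fun j => j₀ + p * j) ?_ ?_ ?_ ?_ ?_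
  · intro i hi
    simp only [Finset.mem_filter, Finset.mem_range] at hi ⊢
    have := Nat.div_add_mod i p
    rw [Nat.lt_iff_add_one_le, Nat.le_div_iff_mul_le hp]
    have e : (i / p + 1) * p = p * (i / p) + p := by ring
    omega
  · intro j hj'
    simp only [Finset.mem_filter, Finset.mem_range] at hj' ⊢
    rw [Nat.lt_iff_add_one_le, Nat.le_div_iff_mul_le hp] at hj'
    have e : (j + 1) * p = p * j + p := by ring
    refine ⟨by omega, ?_⟩
    rw [Nat.add_mul_mod_self_left, Nat.mod_eq_of_lt hj]
  · intro i hi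
    simp only [Finset.mem_filter] at hi
    have := Nat.div_add_mod i p
    omega
  · intro j _
    rw [Nat.add_mul_div_left _ _ hp, Nat.div_eq_of_lt hj, zero_add]
  · intro i hi
    simp only [Finset.mem_filter] at hi
    have := Nat.div_add_mod i p
    congr 1
    omega

/-- The sieve of Eratosthenes-Legendre weighted by a `d`-periodic function. -/
theorem abs_sieve_sub_le {d : ℕ} [NeZero d] (E : Finset ℕ) (hE : ∀ p ∈ E, p.Prime)
    (hEd : ∀ p ∈ E, p.Coprime d) (u v : ℕ) (hEu : ∀ p ∈ E, p.Coprime u)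
    (φ : ZMod d → ℝ) (hφ : ∀ a, |φ a| ≤ 1) (L : ℕ) :
    |∑ i ∈ Finset.range L, φ i * ∏ p ∈ E, (if p ∣ u * i + v then (0 : ℝ) else 1)
      - L * (𝔼 a, φ a) * ∏ p ∈ E, (1 - 1 / (p : ℝ))| ≤ 2 ^ E.card * (2 * d + 1) - 1 := by
  induction E using Finset.induction_on generalizing u v φ L with
  | empty => simpa using abs_sum_range_sub_le φ hφ L
  | insert p E hp ih =>
    have hpp := hE p (Finset.mem_insert_self _ _)
    have : Fact p.Prime := ⟨hpp⟩
    have hpu := hEu p (Finset.mem_insert_self _ _)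
    have hpd := hEd p (Finset.mem_insert_self _ _)
    have hp0 : (0 : ℝ) < p := by exact_mod_cast hpp.pos
    have hEp : ∀ r ∈ E, r.Coprime p := fun r hr =>
      (Nat.coprime_primes (hE r (Finset.mem_insert_of_mem hr)) hpp).2 (by rintro rfl; exact hp hr)
    have ih' := ih (fun r hr => hE r (Finset.mem_insert_of_mem hr))
      (fun r hr => hEd r (Finset.mem_insert_of_mem hr))
    have hEu' : ∀ r ∈ E, r.Coprime u := fun r hr => hEu r (Finset.mem_insert_of_mem hr)
    obtain ⟨j₀, hj₀, hdvd⟩ : ∃ j₀ < p, ∀ i, p ∣ u * i + v ↔ i % p = j₀ := by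
      have hu0 : (u : ZMod p) ≠ 0 := by
        rw [Ne, ZMod.natCast_eq_zero_iff]
        exact (Nat.Prime.coprime_iff_not_dvd hpp).1 hpu
      refine ⟨(-(v : ZMod p) / u).val, ZMod.val_lt _, fun i => ?_⟩
      rw [← ZMod.natCast_eq_zero_iff, ← ZMod.val_natCast, (ZMod.val_injective p).eq_iff,
        eq_div_iff hu0, eq_neg_iff_add_eq_zero, mul_comm (i : ZMod p)]
      push_cast
      rfl
    set L' := (L + (p - 1 - j₀)) / p with hL'
    let φ' : ZMod d → ℝ := fun a => φ (j₀ + p * a)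
    have hmean : 𝔼 a, φ' a = 𝔼 a, φ a := by
      have hu : IsUnit (p : ZMod d) := (ZMod.isUnit_iff_coprime p d).2 hpd
      exact Fintype.expect_equiv ((Equiv.ofBijective (fun a : ZMod d => (p : ZMod d) * a)
        (IsUnit.isUnit_iff_mulLeft_bijective.1 hu)).trans (Equiv.addLeft (j₀ : ZMod d))) _ _
        fun _ => rfl
    have h1 := ih' u v hEu' φ hφ L
    have h2 := ih' (u * p) (u * j₀ + v) (fun r hr => (hEu' r hr).mul_right (hEp r hr)) φ'
      (fun a => hφ _) L'
    rw [hmean] at h2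
    set P := ∏ r ∈ E, (1 - 1 / (r : ℝ)) with hP
    set μ := 𝔼 a, φ a with hμ
    have hμ1 : |μ| ≤ 1 :=
      (Finset.abs_expect_le _ _).trans (Finset.expect_le Finset.univ_nonempty fun n _ => hφ n)
    have hP1 : |P| ≤ 1 := by
      rw [hP, Finset.abs_prod]
      refine Finset.prod_le_one (fun _ _ => abs_nonneg _) fun r hr => ?_
      have hr1 : (1 : ℝ) ≤ r := by
        exact_mod_cast (hE r (Finset.mem_insert_of_mem hr)).one_le
      have : 1 / (r : ℝ) ≤ 1 := by rw [div_le_one (by linarith)]; exact hr1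
      have : 0 ≤ 1 / (r : ℝ) := by positivity
      rw [abs_le]
      constructor <;> linarith
    have hL'' : |(L' : ℝ) - L / p| ≤ 1 := by
      have e := Nat.div_add_mod (L + (p - 1 - j₀)) p
      have e2 := Nat.mod_lt (L + (p - 1 - j₀)) hpp.pos
      rw [← hL'] at e
      have e3 : p * L' ≤ L + p := by omega
      have e4 : L ≤ p * L' + p := by omega
      have e3' : (p : ℝ) * L' ≤ L + p := by exact_mod_cast e3
      have e4' : (L : ℝ) ≤ p * L' + p := by exact_mod_cast e4
      have e5 : (L : ℝ) / p * p = L := by field_simp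
      rw [abs_le]
      constructor <;> nlinarith
    have hsplit : ∑ i ∈ Finset.range L, φ i * ∏ r ∈ insert p E,
        (if r ∣ u * i + v then (0 : ℝ) else 1)
        = ∑ i ∈ Finset.range L, φ i * ∏ r ∈ E, (if r ∣ u * i + v then (0 : ℝ) else 1)
        - ∑ j ∈ Finset.range L', φ' j *
          ∏ r ∈ E, (if r ∣ u * p * j + (u * j₀ + v) then (0 : ℝ) else 1) := by
      have := sum_range_ite_modEq hj₀ L fun i =>
        φ i * ∏ r ∈ E, (if r ∣ u * i + v then (0 : ℝ) else 1)
      have h3 : ∀ j, φ ((j₀ + p * j : ℕ) : ZMod d) *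
          ∏ r ∈ E, (if r ∣ u * (j₀ + p * j) + v then (0 : ℝ) else 1)
          = φ' j * ∏ r ∈ E, (if r ∣ u * p * j + (u * j₀ + v) then (0 : ℝ) else 1) := by
        intro j
        have : u * (j₀ + p * j) + v = u * p * j + (u * j₀ + v) := by ring
        rw [this]
        simp [φ']
      simp only [h3] at this
      rw [← this, ← Finset.sum_sub_distrib]
      refine Finset.sum_congr rfl fun i _ => ?_
      rw [Finset.prod_insert hp]
      by_cases hi : p ∣ u * i + v
      · simp [hi, (hdvd i).1 hi]
      · simp [hi, mt (hdvd i).2 hi]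
    rw [hsplit, Finset.prod_insert hp, Finset.card_insert_of_notMem hp]
    have h4 : |((L' : ℝ) - L / p) * (μ * P)| ≤ 1 :=
      abs_mul_le_one hL'' (abs_mul_le_one hμ1 hP1)
    rw [abs_le] at h1 h2 h4 ⊢
    have e6 : (L : ℝ) * μ * ((1 - 1 / p) * P) = L * μ * P - L' * μ * P
      + ((L' : ℝ) - L / p) * (μ * P) := by ring
    rw [e6, pow_succ]
    constructor <;> linarith

end PeriodicProducts

section LegendreBox

theorem legendre_eq_quadraticChar {p : ℕ} [hp : Fact p.Prime] (a : ℤ) :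
    legendre p a = quadraticChar (ZMod p) a := by
  rw [legendre, dif_pos hp.out]
  rfl

/-- The Legendre symbol along the progression `8 * (M + n) + 1` as a function on `ZMod p`. -/
theorem exists_legendre_eq {p : ℕ} [hp : Fact p.Prime] (hp2 : p ≠ 2) (M : ℕ) :
    ∃ c : ℝ, ∃ s : ZMod p, c ^ 2 = 1 ∧ ∀ n : ℕ, (legendre p ((8 * (M + n) + 1 : ℕ) : ℤ) : ℝ)
      = c * ((quadraticChar (ZMod p) ((n : ZMod p) + s) : ℤ) : ℝ) := by
  have h8 : (8 : ZMod p) ≠ 0 := by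
    have : ((8 : ℕ) : ZMod p) ≠ 0 := by
      rw [Ne, ZMod.natCast_eq_zero_iff]
      intro h
      have : p ∣ 2 := hp.out.dvd_of_dvd_pow (show p ∣ 2 ^ 3 by norm_num; exact h)
      exact hp2 ((Nat.prime_dvd_prime_iff_eq hp.out Nat.prime_two).1 this)
    exact_mod_cast this
  refine ⟨((quadraticChar (ZMod p) 8 : ℤ) : ℝ), M + 8⁻¹, ?_, fun n => ?_⟩
  · exact_mod_cast quadraticChar_sq_one h8
  · rw [legendre_eq_quadraticChar, ← Int.cast_mul, ← map_mul]
    congr 3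
    push_cast
    field_simp
    ring

theorem abs_quadraticChar_le_one {F : Type*} [Field F] [Fintype F] [DecidableEq F] (a : F) :
    |((quadraticChar F a : ℤ) : ℝ)| ≤ 1 := by
  rw [← Int.cast_abs]
  rcases quadraticChar_isQuadratic F a with h | h | h <;> rw [h] <;> norm_num

theorem abs_legendre_le_one (p : ℕ) (a : ℤ) : |(legendre p a : ℝ)| ≤ 1 := by
  by_cases hp : p.Prime
  · have : Fact p.Prime := ⟨hp⟩
    rw [legendre_eq_quadraticChar]
    exact abs_quadraticChar_le_one _
  · simp [legendre, hp]

theorem sq_eq_one_abs {c : ℝ} (hc : c ^ 2 = 1) : |c| ≤ 1 := by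
  rw [← sq_le_one_iff_abs_le_one, hc]

theorem boxBounded_legendre {p : ℕ} (hp : p.Prime) (hp2 : p ≠ 2) (M k t : ℕ) (ht : 0 < t)
    (h : 16 * (t ^ 2 * 2 ^ k) < p) :
    BoxBounded k p (fun n => (legendre p ((8 * (M + n) + 1 : ℕ) : ℤ) : ℝ))
      (5 * 2 ^ k / t + 4 ^ k / p) := by
  have : Fact p.Prime := ⟨hp⟩
  obtain ⟨c, s, hc, hs⟩ := exists_legendre_eq hp2 M
  refine ⟨inferInstance, fun a => c * ((quadraticChar (ZMod p) (a + s) : ℤ) : ℝ), hs,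
    fun a => abs_mul_le_one (sq_eq_one_abs hc) (abs_quadraticChar_le_one _), ?_⟩
  rw [boxAvg_const_mul k c hc]
  have := boxAvg_quadraticChar_prod_le hp2 k {s} (Finset.singleton_nonempty s) t ht (by simpa using h)
  simp only [Finset.prod_singleton, Finset.card_singleton, Nat.cast_one, mul_one, one_pow] at this
  refine this.trans ?_
  gcongr
  linarith

theorem boxBounded_zero_legendre {p : ℕ} (hp : p.Prime) (hp2 : p ≠ 2) (M : ℕ) :
    BoxBounded 0 p (fun n => (legendre p ((8 * (M + n) + 1 : ℕ) : ℤ) : ℝ)) 0 := by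
  have : Fact p.Prime := ⟨hp⟩
  obtain ⟨c, s, hc, hs⟩ := exists_legendre_eq hp2 M
  refine ⟨inferInstance, fun a => c * ((quadraticChar (ZMod p) (a + s) : ℤ) : ℝ), hs,
    fun a => abs_mul_le_one (sq_eq_one_abs hc) (abs_quadraticChar_le_one _), ?_⟩
  rw [boxAvg_const_mul 0 c hc]
  simp only [boxAvg]
  have h0 : ∑ a : ZMod p, quadraticChar (ZMod p) (a + s) = 0 := by
    refine (Equiv.sum_comp (Equiv.addRight s) fun a => quadraticChar (ZMod p) a).trans ?_
    exact quadraticChar_sum_zero (by rwa [ZMod.ringChar_zmod_n])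
  rw [Fintype.expect_eq_sum_div_card, ← Int.cast_sum, h0]
  simp

theorem periodic_legendre (p M : ℕ) :
    Function.Periodic (fun n : ℕ => (legendre p ((8 * (M + n) + 1 : ℕ) : ℤ) : ℝ)) p := by
  intro n
  by_cases hp : p.Prime
  · have : Fact p.Prime := ⟨hp⟩
    simp only [legendre_eq_quadraticChar]
    push_cast
    simp
  · simp [legendre, hp]

theorem legendre_sq {p : ℕ} (hp : p.Prime) (n : ℕ) :
    ((legendre p (n : ℤ) : ℝ)) ^ 2 = if p ∣ n then 0 else 1 := by
  have : Fact p.Prime := ⟨hp⟩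
  rw [legendre_eq_quadraticChar]
  split_ifs with h
  · have : ((n : ℤ) : ZMod p) = 0 := by
      rw [Int.cast_natCast, ZMod.natCast_eq_zero_iff]; exact h
    rw [this]
    simp
  · have : ((n : ℤ) : ZMod p) ≠ 0 := by
      rw [Int.cast_natCast, Ne, ZMod.natCast_eq_zero_iff]; exact h
    exact_mod_cast quadraticChar_sq_one this

end LegendreBox

section CharacterSums

/-- The sum over `n = 8 * (M + i) + 1`, `i < L`, of the product of the Legendre symbols `(n / p)` for
`p ∈ T`, restricted to `n` coprime to the primes in `P`. -/
noncomputable def legendreSum (P T : Finset ℕ) (M L : ℕ) : ℝ :=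
  ∑ i ∈ Finset.range L, (∏ p ∈ T, (legendre p ((8 * (M + i) + 1 : ℕ) : ℤ) : ℝ)) *
    ∏ p ∈ P \ T, (legendre p ((8 * (M + i) + 1 : ℕ) : ℤ) : ℝ) ^ 2

theorem coprime_eight_of_prime {p : ℕ} (hp : p.Prime) (hp2 : p ≠ 2) : p.Coprime 8 := by
  rw [show 8 = 2 ^ 3 by norm_num]
  exact Nat.Coprime.pow_right 3 ((Nat.coprime_primes hp Nat.prime_two).2 hp2)

theorem abs_legendreSum_sub_le (P T : Finset ℕ) (hP : ∀ p ∈ P, p.Prime) (hP2 : ∀ p ∈ P, p ≠ 2)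
    (hT : T ⊆ P) (M L : ℕ) :
    |legendreSum P T M L - if T = ∅ then L * ∏ p ∈ P, (1 - 1 / (p : ℝ)) else 0|
      ≤ 2 ^ P.card * (2 * (∏ p ∈ T, p : ℕ) + 1) := by
  have hbox : BoxBounded 0 (∏ p ∈ T, p) (fun i => ∏ p ∈ T,
      (legendre p ((8 * (M + i) + 1 : ℕ) : ℤ) : ℝ)) (∏ p ∈ T, 0) :=
    BoxBounded.prod T (fun p hp => hP p (hT hp)) _ _ fun p hp =>
      boxBounded_zero_legendre (hP p (hT hp)) (hP2 p (hT hp)) M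
  obtain ⟨hne, φ, hφ, hφ1, hφ0⟩ := hbox
  have hcop : ∀ p ∈ P \ T, p.Coprime (∏ r ∈ T, r) := fun p hp => by
    rw [Finset.mem_sdiff] at hp
    refine Nat.Coprime.prod_right fun r hr => (Nat.coprime_primes (hP p hp.1) (hP r (hT hr))).2 ?_
    rintro rfl
    exact hp.2 hr
  have hmain := abs_sieve_sub_le (P \ T) (fun p hp => hP p (Finset.mem_sdiff.1 hp).1) hcop 8
    (8 * M + 1) (fun p hp => coprime_eight_of_prime (hP p (Finset.mem_sdiff.1 hp).1)
      (hP2 p (Finset.mem_sdiff.1 hp).1)) φ hφ1 L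
  have hsum : ∑ i ∈ Finset.range L, φ i * ∏ p ∈ P \ T,
      (if p ∣ 8 * i + (8 * M + 1) then (0 : ℝ) else 1) = legendreSum P T M L := by
    refine Finset.sum_congr rfl fun i _ => ?_
    rw [← hφ]
    congr 1
    refine Finset.prod_congr rfl fun p hp => ?_
    rw [legendre_sq (hP p (Finset.mem_sdiff.1 hp).1),
      show 8 * (M + i) + 1 = 8 * i + (8 * M + 1) by ring]
  rw [hsum] at hmain
  have hcard : (2 : ℝ) ^ (P \ T).card ≤ 2 ^ P.card :=
    pow_le_pow_right₀ (by norm_num) (Finset.card_le_card Finset.sdiff_subset)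
  have hfin : (2 : ℝ) ^ (P \ T).card * (2 * ((∏ p ∈ T, p : ℕ) : ℝ) + 1) - 1
      ≤ 2 ^ P.card * (2 * ((∏ p ∈ T, p : ℕ) : ℝ) + 1) := by
    have := mul_le_mul_of_nonneg_right hcard
      (show (0 : ℝ) ≤ 2 * ((∏ p ∈ T, p : ℕ) : ℝ) + 1 by positivity)
    linarith
  refine le_trans (le_of_eq ?_) (hmain.trans hfin)
  congr 2
  split_ifs with hTe
  · subst hTe
    have h1 : ∀ a, φ a = 1 := by
      intro a
      have : NeZero (∏ p ∈ (∅ : Finset ℕ), p) := hne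
      have := hφ a.val
      rw [ZMod.natCast_zmod_val] at this
      rw [← this]
      exact Finset.prod_empty
    simp only [h1]
    rw [Fintype.expect_const]
    simp
  · rw [Finset.prod_const, zero_pow (by
      rw [Ne, Finset.card_eq_zero]; exact hTe)] at hφ0
    have : 𝔼 a, φ a = 0 := abs_nonpos_iff.1 hφ0
    rw [this]
    ring

theorem exists_bounded_coloring (R : Finset ℕ) (k w : ℕ) (hw : 0 < w) (hR : R.card ≤ k * w) :
    ∃ c : ℕ → ℕ, (∀ p ∈ R, c p < k) ∧ ∀ j, (R.filter fun p => c p = j).card ≤ w := by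
  let e := R.equivFin
  refine ⟨fun p => if h : p ∈ R then (e ⟨p, h⟩ : ℕ) / w else 0, fun p hp => ?_, fun j => ?_⟩
  · simp only [hp, dif_pos]
    rw [Nat.div_lt_iff_lt_mul hw]
    exact (e ⟨p, hp⟩).2.trans_le hR
  · have : (Finset.Ico (j * w) (j * w + w)).card = w := by simp
    refine le_of_le_of_eq ?_ this
    refine Finset.card_le_card_of_injOn (fun p => if h : p ∈ R then (e ⟨p, h⟩ : ℕ) else 0) ?_ ?_
    · intro p hp
      simp only [Finset.coe_filter, Set.mem_ofPred_eq] at hp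
      obtain ⟨hp, hj⟩ := hp
      simp only [hp, dif_pos] at hj ⊢
      rw [← hj, Finset.coe_Ico, Set.mem_Ico]
      exact ⟨Nat.div_mul_le_self _ _, by
        have := Nat.lt_div_mul_add (a := (e ⟨p, hp⟩ : ℕ)) hw; exact this⟩
    · intro p hp r hr hpr
      simp only [Finset.coe_filter, Set.mem_ofPred_eq] at hp hr
      simp only [hp.1, hr.1, dif_pos] at hpr
      have := e.injective (Fin.ext hpr)
      exact congrArg Subtype.val this

theorem legendreSum_pow_le (P T Q : Finset ℕ) (hP : ∀ p ∈ P, p.Prime)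
    (hT : T ⊆ P) (hQ : Q ⊆ T) (X : ℕ) (hX1 : 1 ≤ X) (hX : ∀ p ∈ P, p ≤ X) (k w : ℕ) (hw : 0 < w)
    (hk : P.card ≤ k * w) (M L : ℕ) (hL : 0 < L) (B : ℝ)
    (hB : ∀ p ∈ Q, BoxBounded k p (fun n => (legendre p ((8 * (M + n) + 1 : ℕ) : ℤ) : ℝ)) B) :
    (|legendreSum P T M L| / L) ^ 2 ^ k
      ≤ B ^ Q.card + 4 * 2 ^ k * ((X : ℝ) ^ Q.card * (X : ℝ) ^ w / L) := by
  have hL' : (0 : ℝ) < L := by exact_mod_cast hL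
  obtain ⟨hne, f, hf, hf1, hfB⟩ := BoxBounded.prod Q (fun p hp => hP p (hT (hQ hp))) _ _ hB
  set c : ℕ → ℕ → ℝ := fun p n => (legendre p ((8 * (M + n) + 1 : ℕ) : ℤ) : ℝ) with hc
  have hc1 : ∀ p n, |c p n| ≤ 1 := fun p n => abs_legendre_le_one _ _
  have hcper : ∀ p, Function.Periodic (c p) p := fun p => periodic_legendre p M
  let g : ℕ → ℕ → ℝ := fun p n => if p ∈ T then c p n else c p n ^ 2
  have hg1 : ∀ p n, |g p n| ≤ 1 := fun p n => by
    simp only [g]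
    split_ifs
    · exact hc1 p n
    · rw [sq]; exact abs_mul_le_one (hc1 p n) (hc1 p n)
  have hgper : ∀ p, Function.Periodic (g p) p := fun p n => by
    simp only [g, hcper p n]
  obtain ⟨col, hcol, hfib⟩ := exists_bounded_coloring (P \ Q) k w hw
    ((Finset.card_le_card Finset.sdiff_subset).trans hk)
  let R : ℕ → Finset ℕ := fun j => (P \ Q).filter fun p => col p = j
  have hRP : ∀ j, ∀ p ∈ R j, p ∈ P ∧ p ∉ Q := fun j p hp => by
    simpa using (Finset.mem_filter.1 hp).1
  have hvdc := vanDerCorput (X ^ w) (fun j => ∏ p ∈ R j, p) k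
    (fun j _ => by
      refine Nat.Coprime.prod_left fun p hp => Nat.Coprime.prod_right fun r hr =>
        (Nat.coprime_primes (hP p (hRP j p hp).1) (hP r (hT (hQ hr)))).2 ?_
      rintro rfl
      exact (hRP j p hp).2 hr)
    (fun j _ => (Finset.prod_le_pow_card _ _ X fun p hp => hX p (hRP j p hp).1).trans
      (Nat.pow_le_pow_right hX1 (hfib j)))
    (by positivity) f hf1 (fun j n => ∏ p ∈ R j, g p n)
    (fun j n => by
      rw [Finset.abs_prod]
      exact Finset.prod_le_one (fun _ _ => abs_nonneg _) fun p _ => hg1 p n)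
    (fun j _ n => by
      refine Finset.prod_congr rfl fun p hp => ?_
      obtain ⟨m, hm⟩ := Finset.dvd_prod_of_mem (fun p : ℕ => p) hp
      have := (hgper p).nat_mul m n
      rw [hm, mul_comm]
      exact_mod_cast this) L hL
  have hsum : ∑ i ∈ Finset.range L, f i * ∏ j ∈ Finset.range k, ∏ p ∈ R j, g p i
      = legendreSum P T M L := by
    refine Finset.sum_congr rfl fun i _ => ?_
    rw [Finset.prod_fiberwise_of_maps_to (fun p hp => Finset.mem_range.2 (hcol p hp)), ← hf]
    have e1 : P \ Q = (T \ Q) ∪ (P \ T) := by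
      ext p
      simp only [Finset.mem_sdiff, Finset.mem_union]
      constructor
      · rintro ⟨h1, h2⟩
        by_cases h : p ∈ T
        · exact Or.inl ⟨h, h2⟩
        · exact Or.inr ⟨h1, h⟩
      · rintro (⟨h1, h2⟩ | ⟨h1, h2⟩)
        · exact ⟨hT h1, h2⟩
        · exact ⟨h1, fun h => h2 (hQ h)⟩
    rw [e1, Finset.prod_union (Finset.disjoint_left.2 fun p hp hp' =>
      (Finset.mem_sdiff.1 hp').2 (Finset.mem_sdiff.1 hp).1)]
    rw [← Finset.prod_sdiff hQ, ← mul_assoc, mul_comm (∏ p ∈ T \ Q, _)]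
    congr 1
    · congr 1
      exact Finset.prod_congr rfl fun p hp => if_pos (Finset.mem_sdiff.1 hp).1
    · exact Finset.prod_congr rfl fun p hp => if_neg (Finset.mem_sdiff.1 hp).2
  rw [hsum] at hvdc
  refine hvdc.trans ?_
  rw [Finset.prod_const] at hfB
  have hq : ((∏ p ∈ Q, p : ℕ) : ℝ) ≤ (X : ℝ) ^ Q.card := by
    exact_mod_cast Finset.prod_le_pow_card _ _ X fun p hp => hX p (hT (hQ hp))
  push_cast at hq ⊢
  gcongr

end CharacterSums

section Counting

/-- The odd primes up to `x`. -/
noncomputable def oddPrimesUpTo (x : ℝ) : Finset ℕ := (primesUpTo x).erase 2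

theorem mem_oddPrimesUpTo {x : ℝ} (hx : 0 ≤ x) {p : ℕ} :
    p ∈ oddPrimesUpTo x ↔ p.Prime ∧ p ≠ 2 ∧ (p : ℝ) ≤ x := by
  simp only [oddPrimesUpTo, primesUpTo, Finset.mem_erase, Finset.mem_filter, Finset.mem_Iic,
    Nat.le_floor_iff hx]
  tauto

theorem two_pow_mul_card_eq_sum_legendreSum (P : Finset ℕ) (hP : ∀ p ∈ P, p.Prime) (M L : ℕ) :
    (2 : ℝ) ^ P.card * ((Finset.range L).filter fun i =>
      ∀ p ∈ P, legendre p ((8 * (M + i) + 1 : ℕ) : ℤ) = 1).card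
      = ∑ T ∈ P.powerset, legendreSum P T M L := by
  simp only [legendreSum]
  rw [Finset.sum_comm]
  simp only [← Finset.prod_add]
  rw [Finset.card_filter, Nat.cast_sum, Finset.mul_sum]
  refine Finset.sum_congr rfl fun i _ => ?_
  have hpt : ∀ p ∈ P, (legendre p ((8 * (M + i) + 1 : ℕ) : ℤ) : ℝ)
      + (legendre p ((8 * (M + i) + 1 : ℕ) : ℤ) : ℝ) ^ 2
      = 2 * if legendre p ((8 * (M + i) + 1 : ℕ) : ℤ) = 1 then 1 else 0 := by
    intro p hp
    have : Fact p.Prime := ⟨hP p hp⟩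
    rw [legendre_eq_quadraticChar]
    rcases quadraticChar_isQuadratic (ZMod p) (((8 * (M + i) + 1 : ℕ) : ℤ) : ZMod p) with h | h | h
      <;> rw [h] <;> norm_num
  rw [Finset.prod_congr rfl hpt, Finset.prod_mul_distrib, Finset.prod_const, Finset.prod_ite_zero]
  simp

theorem card_isSquare_Ioc_le (a b : ℕ) (hab : a ≤ b) :
    (((Finset.Ioc a b).filter IsSquare).card : ℝ) ≤ 1 + Real.sqrt (b - a) := by
  have hsub : (Finset.Ioc a b).filter IsSquare ⊆
      (Finset.Ioc (Nat.sqrt a) (Nat.sqrt b)).image fun s => s * s := by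
    intro n hn
    rw [Finset.mem_filter, Finset.mem_Ioc] at hn
    obtain ⟨⟨h1, h2⟩, s, rfl⟩ := hn
    exact Finset.mem_image.2 ⟨s, Finset.mem_Ioc.2 ⟨Nat.sqrt_lt.2 h1, Nat.le_sqrt.2 h2⟩, rfl⟩
  have hcard := (Finset.card_le_card hsub).trans Finset.card_image_le
  rw [Nat.card_Ioc] at hcard
  have hle : Nat.sqrt a ≤ Nat.sqrt b := Nat.sqrt_le_sqrt hab
  have h1 : ((Nat.sqrt b : ℝ)) * Nat.sqrt b ≤ b := by exact_mod_cast Nat.sqrt_le b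
  have h2 : (a : ℝ) ≤ (Nat.sqrt a + 1) * (Nat.sqrt a + 1) := by
    exact_mod_cast (Nat.lt_succ_sqrt a).le
  have h3 : (((Finset.Ioc a b).filter IsSquare).card : ℝ) ≤ Nat.sqrt b - Nat.sqrt a := by
    have : (((Finset.Ioc a b).filter IsSquare).card : ℝ) ≤ ((Nat.sqrt b - Nat.sqrt a : ℕ) : ℝ) := by
      exact_mod_cast hcard
    rwa [Nat.cast_sub hle] at this
  have h4 : (Nat.sqrt b : ℝ) - Nat.sqrt a - 1 ≤ Real.sqrt (b - a) := by
    by_cases hneg : (Nat.sqrt b : ℝ) - Nat.sqrt a - 1 ≤ 0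
    · exact hneg.trans (Real.sqrt_nonneg _)
    · apply Real.le_sqrt_of_sq_le
      have : (0 : ℝ) ≤ Nat.sqrt a := Nat.cast_nonneg _
      nlinarith
  linarith

open Classical in
theorem abs_pseudosquaresIn_sub_le (x A N ξ : ℝ) (hx : 2 ≤ x) (hA : 0 ≤ A) (hN : 0 ≤ N)
    (hξ : ∀ M L : ℕ, |(L : ℝ) - N / 8| ≤ 2 → ∀ T ⊆ oddPrimesUpTo x, T.Nonempty →
      |legendreSum (oddPrimesUpTo x) T M L| ≤ ξ) (hξ0 : 0 ≤ ξ) :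
    |(pseudosquaresIn x A N : ℝ) - N * (∏ p ∈ primesUpTo x, (1 - 1 / (p : ℝ))) / 2 ^ (piX x + 1)|
      ≤ 8 + Real.sqrt N + ξ := by
  have hx0 : 0 ≤ x := by linarith
  set P := oddPrimesUpTo x with hPdef
  have hP : ∀ p ∈ P, p.Prime := fun p hp => ((mem_oddPrimesUpTo hx0).1 hp).1
  have hP2 : ∀ p ∈ P, p ≠ 2 := fun p hp => ((mem_oddPrimesUpTo hx0).1 hp).2.1
  set a := ⌊A⌋₊ with ha
  set b := ⌊A + N⌋₊ with hb
  have hab : a ≤ b := Nat.floor_le_floor (by linarith)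
  have ha1 : (a : ℝ) ≤ A := Nat.floor_le hA
  have ha2 : A < a + 1 := Nat.lt_floor_add_one A
  have hb1 : (b : ℝ) ≤ A + N := Nat.floor_le (by linarith)
  have hb2 : A + N < b + 1 := Nat.lt_floor_add_one _
  set M := (a + 7) / 8 with hM
  set L := (b + 7) / 8 - M with hL
  have hLN : |(L : ℝ) - N / 8| ≤ 2 := by
    have e1 : 8 * L + a ≤ b + 7 := by omega
    have e2 : b ≤ 8 * L + a + 7 := by omega
    have e1' : (8 : ℝ) * L + a ≤ b + 7 := by exact_mod_cast e1
    have e2' : (b : ℝ) ≤ 8 * L + a + 7 := by exact_mod_cast e2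
    rw [abs_le]
    constructor <;> linarith
  set F := (Finset.range L).filter fun i =>
      ∀ p ∈ P, legendre p ((8 * (M + i) + 1 : ℕ) : ℤ) = 1 with hF
  -- main term
  set V := ∏ p ∈ P, (1 - 1 / (p : ℝ)) with hV
  have hV01 : 0 ≤ V ∧ V ≤ 1 := by
    have h : ∀ p ∈ P, 0 ≤ 1 - 1 / (p : ℝ) ∧ 1 - 1 / (p : ℝ) ≤ 1 := fun p hp => by
      have : (1 : ℝ) ≤ p := by exact_mod_cast (hP p hp).one_le
      have h1 : 1 / (p : ℝ) ≤ 1 := by rw [div_le_one (by linarith)]; exact this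
      have h2 : 0 ≤ 1 / (p : ℝ) := by positivity
      constructor <;> linarith
    exact ⟨Finset.prod_nonneg fun p hp => (h p hp).1, Finset.prod_le_one (fun p hp => (h p hp).1)
      fun p hp => (h p hp).2⟩
  have h2P : (0 : ℝ) < 2 ^ P.card := by positivity
  have hcount : |(F.card : ℝ) - L * V / 2 ^ P.card| ≤ 3 + ξ := by
    have h1 := two_pow_mul_card_eq_sum_legendreSum P hP M L
    rw [← Finset.add_sum_erase _ _ (Finset.empty_mem_powerset P)] at h1
    have h2 := abs_legendreSum_sub_le P ∅ hP hP2 (Finset.empty_subset _) M L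
    simp only [if_true, Finset.prod_empty, Nat.cast_one] at h2
    have h3 : |∑ T ∈ P.powerset.erase ∅, legendreSum P T M L| ≤ 2 ^ P.card * ξ := by
      refine (Finset.abs_sum_le_sum_abs _ _).trans ?_
      have : ∀ T ∈ P.powerset.erase ∅, |legendreSum P T M L| ≤ ξ := fun T hT => by
        rw [Finset.mem_erase, Finset.mem_powerset] at hT
        exact hξ M L hLN T hT.2 (Finset.nonempty_iff_ne_empty.2 hT.1)
      refine (Finset.sum_le_card_nsmul _ _ _ this).trans ?_
      rw [nsmul_eq_mul]
      gcongr
      have := Finset.card_le_card (Finset.erase_subset ∅ P.powerset)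
      rw [Finset.card_powerset] at this
      exact_mod_cast this
    have h4 : (F.card : ℝ) - L * V / 2 ^ P.card
        = ((legendreSum P ∅ M L - L * V) + ∑ T ∈ P.powerset.erase ∅, legendreSum P T M L)
          / 2 ^ P.card := by
      rw [eq_div_iff h2P.ne', sub_mul, div_mul_cancel₀ _ h2P.ne', mul_comm, h1]
      ring
    rw [h4, abs_div, abs_of_pos h2P, div_le_iff₀ h2P]
    refine (abs_add_le _ _).trans ?_
    linarith
  -- comparison of the two counts
  have himg : {n : ℕ | IsPseudosquare x n ∧ A < (n : ℝ) ∧ (n : ℝ) ≤ A + N}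
      = ((F.image fun i => 8 * (M + i) + 1).filter fun n => ¬ IsSquare n : Finset ℕ) := by
    ext n
    have e1 : A < (n : ℝ) ↔ a < n := (Nat.floor_lt hA).symm
    have e2 : (n : ℝ) ≤ A + N ↔ n ≤ b := (Nat.le_floor_iff (by linarith)).symm
    have e3 : (∀ p : ℕ, p.Prime → p ≠ 2 → (p : ℝ) ≤ x → legendre p (n : ℤ) = 1) ↔
        ∀ p ∈ P, legendre p (n : ℤ) = 1 := by
      constructor
      · intro h p hp
        obtain ⟨h1, h2, h3⟩ := (mem_oddPrimesUpTo hx0).1 hp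
        exact h p h1 h2 h3
      · intro h p h1 h2 h3
        exact h p ((mem_oddPrimesUpTo hx0).2 ⟨h1, h2, h3⟩)
    simp only [Set.mem_ofPred_eq, IsPseudosquare, e1, e2, e3, Finset.coe_filter, Finset.mem_image]
    constructor
    · rintro ⟨⟨h0, hsq, h8, hleg⟩, han, hnb⟩
      refine ⟨⟨n / 8 - M, ?_, by omega⟩, hsq⟩
      have hn : 8 * (M + (n / 8 - M)) + 1 = n := by omega
      rw [hF, Finset.mem_filter, Finset.mem_range, hn]
      exact ⟨by omega, hleg⟩
    · rintro ⟨⟨i, hi, rfl⟩, hsq⟩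
      rw [hF, Finset.mem_filter, Finset.mem_range] at hi
      exact ⟨⟨by omega, hsq, by omega, hi.2⟩, by omega, by omega⟩
  have hinj : Function.Injective fun i => 8 * (M + i) + 1 := fun i j hij => by
    simp only at hij
    omega
  have hsplit : (pseudosquaresIn x A N : ℝ) +
      (((F.image fun i => 8 * (M + i) + 1).filter IsSquare).card : ℝ) = F.card := by
    rw [pseudosquaresIn, himg, Set.ncard_coe_finset, ← Finset.card_image_of_injective F hinj,
      ← Finset.card_filter_add_card_filter_not (s := F.image fun i => 8 * (M + i) + 1) IsSquare]
    push_cast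
    ring
  have hsq : (((F.image fun i => 8 * (M + i) + 1).filter IsSquare).card : ℝ)
      ≤ 2 + Real.sqrt N := by
    have hsub : (F.image fun i => 8 * (M + i) + 1).filter IsSquare ⊆
        (Finset.Ioc a b).filter IsSquare := by
      refine Finset.filter_subset_filter _ fun n hn => ?_
      obtain ⟨i, hi, rfl⟩ := Finset.mem_image.1 hn
      rw [hF, Finset.mem_filter, Finset.mem_range] at hi
      rw [Finset.mem_Ioc]
      omega
    have h1 := card_isSquare_Ioc_le a b hab
    have h2 : Real.sqrt (b - a) ≤ 1 + Real.sqrt N := by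
      rw [Real.sqrt_le_iff]
      refine ⟨by positivity, ?_⟩
      nlinarith [Real.sq_sqrt hN, Real.sqrt_nonneg N]
    have h3 : (((F.image fun i => 8 * (M + i) + 1).filter IsSquare).card : ℝ) ≤
        ((Finset.Ioc a b).filter IsSquare).card := by
      exact_mod_cast Finset.card_le_card hsub
    linarith
  have hmem : 2 ∈ primesUpTo x := by
    simp only [primesUpTo, Finset.mem_filter, Finset.mem_Iic]
    exact ⟨Nat.le_floor (by exact_mod_cast hx), Nat.prime_two⟩
  have hpi : piX x = P.card + 1 := (Finset.card_erase_add_one hmem).symm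
  have hfull : ∏ p ∈ primesUpTo x, (1 - 1 / (p : ℝ)) = V / 2 := by
    rw [← Finset.mul_prod_erase _ _ hmem]
    norm_num
    rw [hV]
    simp only [one_div]
    rw [hPdef, oddPrimesUpTo]
    ring
  have hmain : N * (∏ p ∈ primesUpTo x, (1 - 1 / (p : ℝ))) / 2 ^ (piX x + 1)
      = L * V / 2 ^ P.card - (L - N / 8) * (V / 2 ^ P.card) := by
    rw [hfull, hpi, pow_succ, pow_succ]
    field_simp
    ring
  have hlast : |((L : ℝ) - N / 8) * (V / 2 ^ P.card)| ≤ 2 * 1 := by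
    rw [abs_mul]
    gcongr
    rw [abs_of_nonneg (by have := hV01.1; positivity), div_le_one h2P]
    exact hV01.2.trans (one_le_pow₀ (by norm_num))
  have hsq0 : (0 : ℝ) ≤ (((F.image fun i => 8 * (M + i) + 1).filter IsSquare).card : ℝ) :=
    Nat.cast_nonneg _
  rw [hmain]
  rw [abs_le] at hcount hlast ⊢
  constructor <;> linarith

end Counting

section MertensFirst

open Filter Topology

lemma log_factorial_eq_sum_factorization (n : ℕ) :
    Real.log n.factorial =
      ∑ p ∈ Finset.range (n + 1) with p.Prime, (n.factorial.factorization p : ℝ) * Real.log p := by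
  have h0 : n.factorial ≠ 0 := n.factorial_ne_zero
  have h := Nat.prod_factorization_pow_eq_self h0
  rw [Nat.prod_factorization_eq_prod_primeFactors] at h
  have hs : n.factorial.primeFactors = Finset.filter Nat.Prime (Finset.range (n + 1)) := by
    ext p
    simp only [Nat.mem_primeFactors, Finset.mem_filter, Finset.mem_range]
    constructor
    · rintro ⟨hp, hd, -⟩
      exact ⟨Nat.lt_succ_of_le ((hp.dvd_factorial).1 hd), hp⟩
    · rintro ⟨hl, hp⟩
      exact ⟨hp, (hp.dvd_factorial).2 (Nat.le_of_lt_succ hl), h0⟩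
  rw [hs] at h
  conv_lhs => rw [← h]
  push_cast
  rw [Real.log_prod]
  · exact Finset.sum_congr rfl fun p _ => by rw [Real.log_pow]
  · intro p hp
    have := (Finset.mem_filter.1 hp).2.pos
    positivity

lemma factorization_factorial_ge {p : ℕ} (hp : p.Prime) (n : ℕ) :
    (n : ℝ) / p - 1 ≤ n.factorial.factorization p := by
  have h : n / p ≤ n.factorial.factorization p := by
    rw [Nat.factorization_factorial hp (Nat.lt_succ_of_le (Nat.le_succ (Nat.log p n)))]
    have := Finset.single_le_sum (f := fun i => n / p ^ i) (fun i _ => Nat.zero_le _)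
      (show 1 ∈ Finset.Ico 1 (Nat.log p n + 1).succ by simp)
    simpa using this
  have h2 := Nat.lt_div_mul_add (a := n) hp.pos
  have hp0 : (0 : ℝ) < p := by exact_mod_cast hp.pos
  have h3 : (n : ℝ) < (n / p : ℕ) * p + p := by exact_mod_cast h2
  have h4 : ((n / p : ℕ) : ℝ) ≤ n.factorial.factorization p := by exact_mod_cast h
  have : (n : ℝ) / p < (n / p : ℕ) + 1 := by
    rw [div_lt_iff₀ hp0]; linarith
  linarith

lemma factorization_factorial_le {p : ℕ} (hp : p.Prime) (n : ℕ) :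
    (n.factorial.factorization p : ℝ) ≤ n / (p - 1) := by
  have h := Nat.sub_one_mul_factorization_factorial (n := n) hp
  have h1 : (p - 1) * n.factorial.factorization p ≤ n := by omega
  have hp1 : (1 : ℝ) < p := by exact_mod_cast hp.one_lt
  rw [le_div_iff₀ (by linarith)]
  have : (((p - 1 : ℕ) : ℝ)) * n.factorial.factorization p ≤ n := by exact_mod_cast h1
  rw [Nat.cast_sub hp.one_lt.le] at this
  push_cast at this
  linarith

lemma sum_log_div_le (n : ℕ) (hn : 1 ≤ n) :
    ∑ p ∈ Finset.range (n + 1) with p.Prime, Real.log p / p ≤ Real.log n + Real.log 4 := by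
  have hn0 : (0 : ℝ) < n := by exact_mod_cast hn
  have h1 : Real.log n.factorial ≤ n * Real.log n := by
    rw [← Real.log_pow]
    apply Real.log_le_log (by exact_mod_cast n.factorial_pos)
    exact_mod_cast Nat.factorial_le_pow n
  rw [log_factorial_eq_sum_factorization] at h1
  have h2 := Chebyshev.theta_le_log4_mul_x hn0.le
  rw [Chebyshev.theta_eq_sum_Icc, Nat.floor_natCast] at h2
  have hI : Finset.Icc 0 n = Finset.range (n + 1) := by ext; simp
  rw [hI] at h2
  have h3 : ∑ p ∈ Finset.range (n + 1) with p.Prime, ((n : ℝ) * (Real.log p / p) - Real.log p) ≤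
      ∑ p ∈ Finset.range (n + 1) with p.Prime, (n.factorial.factorization p : ℝ) * Real.log p := by
    apply Finset.sum_le_sum
    intro p hp
    have hp := (Finset.mem_filter.1 hp).2
    have := mul_le_mul_of_nonneg_right (factorization_factorial_ge hp n)
      (Real.log_nonneg (by exact_mod_cast hp.one_lt.le : (1 : ℝ) ≤ p))
    calc _ = ((n : ℝ) / p - 1) * Real.log p := by ring
      _ ≤ _ := this
  rw [Finset.sum_sub_distrib, ← Finset.mul_sum] at h3
  have : (n : ℝ) * ∑ p ∈ Finset.range (n + 1) with p.Prime, Real.log p / p ≤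
    n * (Real.log n + Real.log 4) := by linarith
  exact le_of_mul_le_mul_left this hn0

lemma exists_sum_log_div_ge :
    ∃ C : ℝ, ∀ n : ℕ, 1 ≤ n →
      Real.log n - C ≤ ∑ p ∈ Finset.range (n + 1) with p.Prime, Real.log p / p := by
  have hsum : Summable fun n : ℕ => 4 * (n : ℝ) ^ (-(3 / 2) : ℝ) :=
    (Real.summable_nat_rpow.2 (by norm_num)).mul_left 4
  refine ⟨1 + ∑' n : ℕ, 4 * (n : ℝ) ^ (-(3 / 2) : ℝ), fun n hn => ?_⟩
  have hn0 : (0 : ℝ) < n := by exact_mod_cast hn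
  have h1 := Stirling.le_log_factorial_stirling (n := n) (by omega)
  have h1a : 0 ≤ Real.log n := Real.log_nonneg (by exact_mod_cast hn)
  have h1b : 0 ≤ Real.log (2 * Real.pi) := Real.log_nonneg (by linarith [Real.pi_gt_three])
  rw [log_factorial_eq_sum_factorization] at h1
  have h3 : ∑ p ∈ Finset.range (n + 1) with p.Prime, (n.factorial.factorization p : ℝ) * Real.log p ≤
      ∑ p ∈ Finset.range (n + 1) with p.Prime,
        ((n : ℝ) * (Real.log p / p) + n * (4 * (p : ℝ) ^ (-(3 / 2) : ℝ))) := by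
    apply Finset.sum_le_sum
    intro p hp
    have hp := (Finset.mem_filter.1 hp).2
    have hp2 : (2 : ℝ) ≤ p := by exact_mod_cast hp.two_le
    have hl : 0 ≤ Real.log p := Real.log_nonneg (by linarith)
    have := mul_le_mul_of_nonneg_right (factorization_factorial_le hp n) hl
    refine this.trans ?_
    have e : (n : ℝ) / (p - 1) * Real.log p =
        n * (Real.log p / p) + n * (Real.log p / (p * (p - 1))) := by
      have : (p : ℝ) - 1 ≠ 0 := by linarith
      field_simp
      ring
    rw [e]
    gcongr
    have hlog := Real.log_le_rpow_div (x := p) (ε := 1 / 2) (by linarith) (by norm_num)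
    have hpp : (p : ℝ) ^ (-(3 / 2) : ℝ) = (p : ℝ) ^ (1 / 2 : ℝ) / p ^ 2 := by
      rw [← Real.rpow_natCast (p : ℝ) 2, ← Real.rpow_sub (by linarith)]
      norm_num
    rw [hpp, div_le_iff₀ (by nlinarith)]
    have hr : 0 ≤ (p : ℝ) ^ (1 / 2 : ℝ) := by positivity
    have : 4 * ((p : ℝ) ^ (1 / 2 : ℝ) / p ^ 2) * (p * (p - 1)) =
      4 * (p : ℝ) ^ (1 / 2 : ℝ) * ((p - 1) / p) := by field_simp
    rw [this]
    have h12 : (1 / 2 : ℝ) ≤ (p - 1) / p := by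
      rw [div_le_div_iff₀ (by norm_num) (by linarith)]
      linarith
    nlinarith
  rw [Finset.sum_add_distrib, ← Finset.mul_sum, ← Finset.mul_sum] at h3
  have h4 : ∑ p ∈ Finset.range (n + 1) with p.Prime, 4 * (p : ℝ) ^ (-(3 / 2) : ℝ) ≤
      ∑' n : ℕ, 4 * (n : ℝ) ^ (-(3 / 2) : ℝ) :=
    hsum.sum_le_tsum _ fun i _ => by positivity
  have h5 := mul_le_mul_of_nonneg_left h4 hn0.le
  have : (n : ℝ) * (Real.log n - (1 + ∑' n : ℕ, 4 * (n : ℝ) ^ (-(3 / 2) : ℝ))) ≤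
      n * ∑ p ∈ Finset.range (n + 1) with p.Prime, Real.log p / p := by linarith
  exact le_of_mul_le_mul_left this hn0

end MertensFirst

section MertensSecond

open Filter Topology

/-- The partial sum of the reciprocals of the primes up to `n`. -/
noncomputable def sumPrimeInv (n : ℕ) : ℝ := ∑ p ∈ Finset.range (n + 1) with p.Prime, 1 / (p : ℝ)

lemma sum_filter_range_succ_succ (f : ℕ → ℝ) (m : ℕ) :
    ∑ p ∈ Finset.range (m + 1 + 1) with p.Prime, f p =
      ∑ i ∈ Finset.range m, if (i + 2).Prime then f (i + 2) else 0 := by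
  rw [Finset.sum_filter, Finset.sum_range_succ', Finset.sum_range_succ']
  simp [Nat.not_prime_zero, Nat.not_prime_one]

lemma exists_tendsto_sum_log_diff_div :
    ∃ c : ℝ, Tendsto (fun m : ℕ =>
      (∑ i ∈ Finset.range m, (Real.log (i + 2 : ℕ) - Real.log (i + 1 : ℕ)) / Real.log (i + 2 : ℕ))
        - Real.log (Real.log (m + 1 : ℕ))) atTop (𝓝 c) := by
  set G : ℕ → ℝ := fun m => (∑ i ∈ Finset.range m, (Real.log (i + 2 : ℕ) - Real.log (i + 1 : ℕ)) /
      Real.log (i + 2 : ℕ)) - Real.log (Real.log (m + 1 : ℕ)) with hG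
  have key : ∀ k : ℕ, G (k + 1 + 1) ≤ G (k + 1) ∧ G (k + 1) - 1 / Real.log (k + 2 : ℕ) ≤
      G (k + 1 + 1) - 1 / Real.log (k + 3 : ℕ) := by
    intro k
    simp only [hG, Finset.sum_range_succ _ (k + 1)]
    have e1 : k + 1 + 2 = k + 3 := rfl
    have e2 : k + 1 + 1 = k + 2 := rfl
    simp only [e1, e2]
    have ha : 0 < Real.log (k + 2 : ℕ) :=
      Real.log_pos (by push_cast; linarith [(Nat.cast_nonneg k : (0:ℝ) ≤ k)])
    have hab : Real.log (k + 2 : ℕ) ≤ Real.log (k + 3 : ℕ) :=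
      Real.log_le_log (by positivity) (by push_cast; linarith)
    have hb1 : Real.log (k + 3 : ℕ) - Real.log (k + 2 : ℕ) ≤ 1 := by
      rw [← Real.log_div (by positivity) (by positivity)]
      have := Real.log_le_sub_one_of_pos (x := ((k + 3 : ℕ) : ℝ) / (k + 2 : ℕ)) (by positivity)
      have h2 : ((k + 3 : ℕ) : ℝ) / (k + 2 : ℕ) ≤ 2 := by
        rw [div_le_iff₀ (by positivity)]; push_cast; linarith [(Nat.cast_nonneg k : (0:ℝ) ≤ k)]
      linarith
    generalize Real.log (k + 2 : ℕ) = a at *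
    generalize Real.log (k + 3 : ℕ) = b at *
    have hb : 0 < b := by linarith
    have h1 : 1 - a / b ≤ Real.log b - Real.log a := by
      rw [← Real.log_div hb.ne' ha.ne']
      have := Real.one_sub_inv_le_log_of_pos (x := b / a) (by positivity)
      rwa [inv_div] at this
    have h2 : Real.log b - Real.log a ≤ b / a - 1 := by
      rw [← Real.log_div hb.ne' ha.ne']
      exact Real.log_le_sub_one_of_pos (by positivity)
    have e : (b - a) / b = 1 - a / b := by field_simp
    constructor
    · linarith
    · have h3 : (b - a) * (1 / a - 1 / b) ≤ 1 * (1 / a - 1 / b) := by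
        apply mul_le_mul_of_nonneg_right hb1
        rw [sub_nonneg]
        exact one_div_le_one_div_of_le ha hab
      have h4 : (b - a) * (1 / a - 1 / b) = b / a - 1 - (1 - a / b) := by field_simp
      linarith
  have hanti : Antitone fun k => G (k + 1) := antitone_nat_of_succ_le fun k => (key k).1
  have hmono : Monotone fun k : ℕ => G (k + 1) - 1 / Real.log (k + 2 : ℕ) :=
    monotone_nat_of_le_succ fun k => (key k).2
  have hbdd : BddBelow (Set.range fun k => G (k + 1)) := by
    refine ⟨G 1 - 1 / Real.log (2 : ℕ), ?_⟩
    rintro _ ⟨k, rfl⟩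
    have h := hmono (Nat.zero_le k)
    simp only [zero_add] at h
    have : 0 ≤ 1 / Real.log (k + 2 : ℕ) :=
      one_div_nonneg.2 (Real.log_nonneg (by push_cast; linarith [(Nat.cast_nonneg k : (0:ℝ) ≤ k)]))
    simp only at *
    linarith
  exact ⟨_, (tendsto_add_atTop_iff_nat 1).1 (tendsto_atTop_ciInf hanti hbdd)⟩

/-- Mertens' second theorem, with an unspecified constant. -/
lemma exists_tendsto_sumPrimeInv_sub_log_log :
    ∃ c : ℝ, Tendsto (fun n : ℕ => sumPrimeInv n - Real.log (Real.log n)) atTop (𝓝 c) := by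
  obtain ⟨c₁, hc₁⟩ := exists_tendsto_sum_log_diff_div
  obtain ⟨C, hC⟩ := exists_sum_log_div_ge
  set f : ℕ → ℝ := fun i => 1 / Real.log (i + 2 : ℕ) with hf
  set z : ℕ → ℝ := fun i => (if (i + 2).Prime then Real.log (i + 2 : ℕ) / (i + 2 : ℕ) else 0) -
    (Real.log (i + 2 : ℕ) - Real.log (i + 1 : ℕ)) with hz
  have hlog : ∀ i : ℕ, 0 < Real.log (i + 2 : ℕ) := fun i =>
    Real.log_pos (by push_cast; linarith [(Nat.cast_nonneg i : (0:ℝ) ≤ i)])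
  have hfa : Antitone f := antitone_nat_of_succ_le fun i =>
    one_div_le_one_div_of_le (hlog i) (Real.log_le_log (by positivity) (by push_cast; linarith))
  have hf0 : Tendsto f atTop (𝓝 0) := by
    have : Tendsto (fun i : ℕ => Real.log (i + 2 : ℕ)) atTop atTop :=
      Real.tendsto_log_atTop.comp (tendsto_natCast_atTop_atTop.comp (tendsto_add_atTop_nat 2))
    simp only [hf, one_div]
    exact this.inv_tendsto_atTop
  have hzs : ∀ m, ∑ i ∈ Finset.range m, z i =
      ∑ p ∈ Finset.range (m + 1 + 1) with p.Prime, Real.log p / p - Real.log (m + 1 : ℕ) := by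
    intro m
    rw [sum_filter_range_succ_succ (fun p : ℕ => Real.log p / p)]
    simp only [hz]
    rw [Finset.sum_sub_distrib, Finset.sum_range_sub (fun i : ℕ => Real.log (i + 1 : ℕ))]
    simp
  have hzb : ∀ m, ‖∑ i ∈ Finset.range m, z i‖ ≤ max C (Real.log 4) := by
    intro m
    rw [hzs, Real.norm_eq_abs, abs_le]
    have h1 := hC (m + 1) (by omega)
    have h2 := sum_log_div_le (m + 1) (by omega)
    constructor
    · linarith [le_max_left C (Real.log 4)]
    · linarith [le_max_right C (Real.log 4)]
  obtain ⟨c₂, hc₂⟩ := cauchySeq_tendsto_of_complete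
    (hfa.cauchySeq_series_mul_of_tendsto_zero_of_bounded hf0 hzb)
  refine ⟨c₂ + c₁, (tendsto_add_atTop_iff_nat 1).1 ((hc₂.add hc₁).congr fun m => ?_)⟩
  have : sumPrimeInv (m + 1) = ∑ i ∈ Finset.range m, (f i • z i +
      (Real.log (i + 2 : ℕ) - Real.log (i + 1 : ℕ)) / Real.log (i + 2 : ℕ)) := by
    rw [sumPrimeInv, sum_filter_range_succ_succ (fun p : ℕ => 1 / (p : ℝ))]
    refine Finset.sum_congr rfl fun i _ => ?_
    have h := (hlog i).ne'
    have h2 : ((i + 2 : ℕ) : ℝ) ≠ 0 := by positivity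
    simp only [hf, hz, smul_eq_mul]
    split_ifs <;> field_simp <;> ring
  rw [this, Finset.sum_add_distrib]
  ring

end MertensSecond

section MertensDifference

open Filter Topology

/-- The difference between the sum of `1 / p` over primes `p ≤ exp t` and the harmonic sum up
to `t`. -/
noncomputable def mertensDiff (t : ℝ) : ℝ := sumPrimeInv ⌊Real.exp t⌋₊ - (harmonic ⌊t⌋₊ : ℝ)

lemma tendsto_log_floor_sub_log :
    Tendsto (fun t : ℝ => Real.log ⌊t⌋₊ - Real.log t) atTop (𝓝 0) := by
  have h : Tendsto (fun t : ℝ => (⌊t⌋₊ : ℝ) / t) atTop (𝓝 1) := tendsto_nat_floor_div_atTop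
  have h2 := (Real.continuousAt_log one_ne_zero).tendsto.comp h
  rw [Real.log_one] at h2
  refine h2.congr' ?_
  filter_upwards [eventually_ge_atTop (1 : ℝ)] with t ht
  have : (0 : ℝ) < ⌊t⌋₊ := by exact_mod_cast Nat.floor_pos.2 ht
  simp only [Function.comp]
  rw [Real.log_div this.ne' (by linarith)]

lemma tendsto_log_log_floor_exp_sub_log :
    Tendsto (fun t : ℝ => Real.log (Real.log ⌊Real.exp t⌋₊) - Real.log t) atTop (𝓝 0) := by
  have h := tendsto_log_floor_sub_log.comp Real.tendsto_exp_atTop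
  have h1 : Tendsto (fun t : ℝ => Real.log ⌊Real.exp t⌋₊ / t) atTop (𝓝 1) := by
    have h2 : Tendsto (fun t : ℝ => 1 + (Real.log ⌊Real.exp t⌋₊ - Real.log (Real.exp t)) * t⁻¹)
        atTop (𝓝 (1 + 0 * 0)) := tendsto_const_nhds.add (h.mul tendsto_inv_atTop_zero)
    rw [zero_mul, add_zero] at h2
    refine h2.congr' ?_
    filter_upwards [eventually_gt_atTop (0 : ℝ)] with t ht
    rw [Real.log_exp]
    field_simp
    ring
  have h2 := (Real.continuousAt_log one_ne_zero).tendsto.comp h1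
  rw [Real.log_one] at h2
  refine h2.congr' ?_
  filter_upwards [eventually_gt_atTop (0 : ℝ), h1.eventually (lt_mem_nhds zero_lt_one)] with t ht ht2
  simp only [Function.comp]
  rw [Real.log_div _ ht.ne']
  rintro h0
  rw [h0, zero_div] at ht2
  exact lt_irrefl _ ht2

lemma tendsto_mertensDiff {c : ℝ}
    (hc : Tendsto (fun n : ℕ => sumPrimeInv n - Real.log (Real.log n)) atTop (𝓝 c)) :
    Tendsto mertensDiff atTop (𝓝 (c - Real.eulerMascheroniConstant)) := by
  have h1 := hc.comp (tendsto_nat_floor_atTop.comp Real.tendsto_exp_atTop)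
  have h2 := Real.tendsto_harmonic_sub_log.comp (tendsto_nat_floor_atTop (α := ℝ))
  have h3 := (h1.sub h2).add (tendsto_log_log_floor_exp_sub_log.sub tendsto_log_floor_sub_log)
  simp only [sub_zero, add_zero] at h3
  refine h3.congr fun t => ?_
  simp only [Function.comp, mertensDiff]
  ring

lemma sumPrimeInv_mono : Monotone sumPrimeInv := by
  intro m n h
  apply Finset.sum_le_sum_of_subset_of_nonneg
  · exact Finset.filter_subset_filter _ (Finset.range_subset_range.2 (by omega))
  · intros; positivity

lemma sumPrimeInv_nonneg (n : ℕ) : 0 ≤ sumPrimeInv n := Finset.sum_nonneg fun _ _ => by positivity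

lemma harmonic_eq_sum_range (n : ℕ) :
    (harmonic n : ℝ) = ∑ i ∈ Finset.range (n + 1), 1 / (i : ℝ) := by
  rw [Finset.sum_range_succ', harmonic]
  simp

lemma exists_abs_mertensDiff_le {c : ℝ}
    (hc : Tendsto (fun n : ℕ => sumPrimeInv n - Real.log (Real.log n)) atTop (𝓝 c)) :
    ∃ C : ℝ, 0 ≤ C ∧ ∀ t : ℝ, |mertensDiff t| ≤ C := by
  have h := (tendsto_mertensDiff hc).abs
  obtain ⟨T, hT⟩ := eventually_atTop.1 (h.eventually (gt_mem_nhds (lt_add_one _)))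
  have hT0 : 0 ≤ (harmonic ⌊T⌋₊ : ℝ) := by
    rw [harmonic_eq_sum_range]; exact Finset.sum_nonneg fun _ _ => by positivity
  have hT1 := sumPrimeInv_nonneg ⌊Real.exp T⌋₊
  refine ⟨(|c - Real.eulerMascheroniConstant| + 1) +
    (sumPrimeInv ⌊Real.exp T⌋₊ + (harmonic ⌊T⌋₊ : ℝ)), by positivity, fun t => ?_⟩
  rcases le_or_gt T t with ht | ht
  · linarith [hT t ht]
  · have h1 : sumPrimeInv ⌊Real.exp t⌋₊ ≤ sumPrimeInv ⌊Real.exp T⌋₊ :=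
      sumPrimeInv_mono (Nat.floor_mono (Real.exp_le_exp.2 ht.le))
    have h2 : (harmonic ⌊t⌋₊ : ℝ) ≤ (harmonic ⌊T⌋₊ : ℝ) := by
      rw [harmonic_eq_sum_range, harmonic_eq_sum_range]
      apply Finset.sum_le_sum_of_subset_of_nonneg
      · exact (Finset.range_subset_range.2 (Nat.succ_le_succ (Nat.floor_mono ht.le)))
      · intros; positivity
    have h3 := sumPrimeInv_nonneg ⌊Real.exp t⌋₊
    have h4 : 0 ≤ (harmonic ⌊t⌋₊ : ℝ) := by
      rw [harmonic_eq_sum_range]; exact Finset.sum_nonneg fun _ _ => by positivity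
    have h5 := abs_nonneg (c - Real.eulerMascheroniConstant)
    rw [mertensDiff, abs_le]
    constructor <;> linarith

lemma measurable_mertensDiff : Measurable mertensDiff := by
  apply Measurable.sub
  · exact (measurable_from_nat (f := sumPrimeInv)).comp (Nat.measurable_floor.comp Real.measurable_exp)
  · exact (measurable_from_nat (f := fun n : ℕ => (harmonic n : ℝ))).comp Nat.measurable_floor

end MertensDifference

section MertensLaplace

open Filter Topology MeasureTheory

/-- The coefficients `1 / p` supported on primes. -/
noncomputable def primeInv (n : ℕ) : ℝ := if n.Prime then 1 / (n : ℝ) else 0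

lemma primeInv_nonneg (n : ℕ) : 0 ≤ primeInv n := by
  unfold primeInv; split_ifs <;> positivity

lemma integrable_indicator_exp_neg (c : ℝ) :
    Integrable ((Set.Ici c).indicator fun u : ℝ => Real.exp (-u)) := by
  rw [integrable_indicator_iff measurableSet_Ici, integrableOn_Ici_iff_integrableOn_Ioi]
  exact integrableOn_exp_neg_Ioi c

lemma integral_indicator_exp_neg (c : ℝ) :
    ∫ u, (Set.Ici c).indicator (fun u : ℝ => Real.exp (-u)) u = Real.exp (-c) := by
  rw [integral_indicator measurableSet_Ici, integral_Ici_eq_integral_Ioi, integral_exp_neg_Ioi]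

lemma tsum_laplace_eq (σ : ℝ) (hσ : 0 < σ) (u : ℝ) :
    ∑' n : ℕ, (primeInv n * (Set.Ici (σ * Real.log n)).indicator (fun u : ℝ => Real.exp (-u)) u -
      1 / (n : ℝ) * (Set.Ici (σ * n)).indicator (fun u : ℝ => Real.exp (-u)) u) =
    (Set.Ioi 0).indicator (fun u => Real.exp (-u) * mertensDiff (u / σ)) u := by
  have h1 : ∀ n : ℕ, primeInv n * (Set.Ici (σ * Real.log n)).indicator
      (fun u : ℝ => Real.exp (-u)) u =
      if n ∈ Finset.range (⌊Real.exp (u / σ)⌋₊ + 1) then Real.exp (-u) * primeInv n else 0 := by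
    intro n
    unfold primeInv
    by_cases hn : n.Prime
    · have hn0 : (0 : ℝ) < n := by exact_mod_cast hn.pos
      have : u ∈ Set.Ici (σ * Real.log n) ↔ n ∈ Finset.range (⌊Real.exp (u / σ)⌋₊ + 1) := by
        rw [Set.mem_Ici, Finset.mem_range, Nat.lt_succ_iff, Nat.le_floor_iff (by positivity),
          ← Real.log_le_iff_le_exp hn0, le_div_iff₀ hσ, mul_comm]
      rw [Set.indicator_apply]
      simp only [this, hn, if_true]
      split_ifs <;> ring
    · simp [hn]
  have h2 : ∀ n : ℕ, 1 / (n : ℝ) * (Set.Ici (σ * n)).indicator (fun u : ℝ => Real.exp (-u)) u =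
      if n ∈ Finset.range (⌊u / σ⌋₊ + 1) then Real.exp (-u) * (1 / (n : ℝ)) else 0 := by
    intro n
    rcases Nat.eq_zero_or_pos n with rfl | hn
    · simp
    · have : u ∈ Set.Ici (σ * n) ↔ n ∈ Finset.range (⌊u / σ⌋₊ + 1) := by
        rw [Set.mem_Ici, Finset.mem_range, Nat.lt_succ_iff, Nat.le_floor_iff' (by omega),
          le_div_iff₀ hσ, mul_comm]
      rw [Set.indicator_apply]
      simp only [this]
      split_ifs <;> ring
  simp_rw [h1, h2]
  rw [Summable.tsum_sub (summable_of_hasFiniteSupport ((Finset.finite_toSet _).subset (by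
      intro n hn; by_contra h; exact hn (if_neg h))))
      (summable_of_hasFiniteSupport ((Finset.finite_toSet _).subset (by
      intro n hn; by_contra h; exact hn (if_neg h)))),
    tsum_eq_sum (s := Finset.range (⌊Real.exp (u / σ)⌋₊ + 1)) (fun n hn => if_neg hn),
    tsum_eq_sum (s := Finset.range (⌊u / σ⌋₊ + 1)) (fun n hn => if_neg hn),
    Finset.sum_congr rfl (fun n hn => if_pos hn),
    Finset.sum_congr (s₂ := Finset.range (⌊u / σ⌋₊ + 1)) rfl (fun n hn => if_pos hn),
    ← Finset.mul_sum, ← Finset.mul_sum, ← harmonic_eq_sum_range]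
  have h3 : ∑ i ∈ Finset.range (⌊Real.exp (u / σ)⌋₊ + 1), primeInv i =
      sumPrimeInv ⌊Real.exp (u / σ)⌋₊ := by
    rw [sumPrimeInv, Finset.sum_filter]; rfl
  rw [h3, ← mul_sub, Set.indicator_apply]
  split_ifs with h
  · rfl
  · have hu : u / σ ≤ 0 := div_nonpos_of_nonpos_of_nonneg (not_lt.1 h) hσ.le
    have e1 : ⌊u / σ⌋₊ = 0 := Nat.floor_of_nonpos hu
    have e2 : ⌊Real.exp (u / σ)⌋₊ ≤ 1 := by
      have : Real.exp (u / σ) ≤ 1 := Real.exp_le_one_iff.2 hu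
      exact (Nat.floor_mono this).trans (by simp)
    have e3 : sumPrimeInv ⌊Real.exp (u / σ)⌋₊ = 0 := by
      rw [sumPrimeInv, Finset.sum_eq_zero]
      intro p hp
      have := (Finset.mem_filter.1 hp)
      have h1 := Finset.mem_range.1 this.1
      have h2 := this.2.two_le
      omega
    rw [e1, e3]
    simp

lemma hasSum_exp_neg_div (σ : ℝ) (hσ : 0 < σ) :
    HasSum (fun n : ℕ => 1 / (n : ℝ) * Real.exp (-(σ * n))) (-Real.log (1 - Real.exp (-σ))) := by
  have h1 : |Real.exp (-σ)| < 1 := by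
    rw [abs_of_pos (Real.exp_pos _)]
    rw [Real.exp_lt_one_iff]; linarith
  have h := Real.hasSum_pow_div_log_of_abs_lt_one h1
  rw [← hasSum_nat_add_iff' 1]
  simp only [Finset.range_one, Finset.sum_singleton, Nat.cast_zero, div_zero, zero_mul, sub_zero]
  refine h.congr_fun fun n => ?_
  rw [← Real.exp_nat_mul]
  push_cast
  rw [show -(σ * ((n : ℝ) + 1)) = (n + 1) * -σ by ring]
  ring

lemma exp_neg_mul_log {n : ℕ} (hn : 0 < n) (σ : ℝ) :
    1 / (n : ℝ) * Real.exp (-(σ * Real.log n)) = (n : ℝ) ^ (-(1 + σ)) := by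
  have : (0 : ℝ) < n := by exact_mod_cast hn
  rw [Real.rpow_def_of_pos this, show Real.log n * -(1 + σ) = -Real.log n + -(σ * Real.log n) by ring,
    Real.exp_add, Real.exp_neg (Real.log n), Real.exp_log this, one_div]

lemma primeInv_mul_exp (n : ℕ) (σ : ℝ) :
    primeInv n * Real.exp (-(σ * Real.log n)) =
      if n.Prime then (n : ℝ) ^ (-(1 + σ)) else 0 := by
  unfold primeInv
  split_ifs with h
  · exact exp_neg_mul_log h.pos σ
  · simp

lemma summable_primeInv_mul_exp (σ : ℝ) (hσ : 0 < σ) :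
    Summable fun n : ℕ => primeInv n * Real.exp (-(σ * Real.log n)) := by
  have h : Summable fun n : ℕ => (n : ℝ) ^ (-(1 + σ)) := Real.summable_nat_rpow.2 (by linarith)
  refine Summable.of_nonneg_of_le (fun n => mul_nonneg (primeInv_nonneg n) (Real.exp_pos _).le)
    (fun n => ?_) h
  rw [primeInv_mul_exp]
  split_ifs
  · exact le_rfl
  · positivity

lemma laplace_mertensDiff (σ : ℝ) (hσ : 0 < σ) :
    ∫ u, (Set.Ioi 0).indicator (fun u => Real.exp (-u) * mertensDiff (u / σ)) u =
      (∑' n : ℕ, primeInv n * Real.exp (-(σ * Real.log n))) + Real.log (1 - Real.exp (-σ)) := by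
  set F : ℕ → ℝ → ℝ := fun n u =>
    primeInv n * (Set.Ici (σ * Real.log n)).indicator (fun u : ℝ => Real.exp (-u)) u -
      1 / (n : ℝ) * (Set.Ici (σ * n)).indicator (fun u : ℝ => Real.exp (-u)) u with hF
  have hi1 : ∀ n : ℕ, Integrable fun u => primeInv n *
      (Set.Ici (σ * Real.log n)).indicator (fun u : ℝ => Real.exp (-u)) u := fun n =>
    (integrable_indicator_exp_neg _).const_mul _
  have hi2 : ∀ n : ℕ, Integrable fun u => 1 / (n : ℝ) *
      (Set.Ici (σ * n)).indicator (fun u : ℝ => Real.exp (-u)) u := fun n =>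
    (integrable_indicator_exp_neg _).const_mul _
  have hi : ∀ n, Integrable (F n) := fun n => (hi1 n).sub (hi2 n)
  have hS := summable_primeInv_mul_exp σ hσ
  have hT := hasSum_exp_neg_div σ hσ
  have hval : ∀ n, ∫ u, F n u = primeInv n * Real.exp (-(σ * Real.log n)) -
      1 / (n : ℝ) * Real.exp (-(σ * n)) := by
    intro n
    simp only [hF]
    rw [integral_sub (hi1 n) (hi2 n), integral_const_mul, integral_const_mul,
      integral_indicator_exp_neg, integral_indicator_exp_neg]
  have hnorm : Summable fun n => ∫ u, ‖F n u‖ := by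
    refine Summable.of_nonneg_of_le (fun n => integral_nonneg fun u => norm_nonneg _)
      (fun n => ?_) (hS.add hT.summable)
    have hle : ∀ u, ‖F n u‖ ≤ primeInv n *
        (Set.Ici (σ * Real.log n)).indicator (fun u : ℝ => Real.exp (-u)) u +
        1 / (n : ℝ) * (Set.Ici (σ * n)).indicator (fun u : ℝ => Real.exp (-u)) u := by
      intro u
      refine (norm_sub_le _ _).trans (le_of_eq ?_)
      rw [Real.norm_of_nonneg, Real.norm_of_nonneg]
      · exact mul_nonneg (by positivity) (Set.indicator_nonneg (fun _ _ => (Real.exp_pos _).le) _)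
      · exact mul_nonneg (primeInv_nonneg n)
          (Set.indicator_nonneg (fun _ _ => (Real.exp_pos _).le) _)
    refine (integral_mono (hi n).norm ((hi1 n).add (hi2 n)) hle).trans (le_of_eq ?_)
    simp only [Pi.add_apply]
    rw [integral_add (hi1 n) (hi2 n), integral_const_mul, integral_const_mul,
      integral_indicator_exp_neg, integral_indicator_exp_neg]
  have h := hasSum_integral_of_summable_integral_norm hi hnorm
  simp only [hF, tsum_laplace_eq σ hσ] at h
  have h2 := hS.hasSum.sub hT
  rw [sub_neg_eq_add] at h2
  refine h.unique ?_
  convert! h2 using 2 with n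
  exact hval n

lemma tendsto_laplace_mertensDiff {c : ℝ}
    (hc : Tendsto (fun n : ℕ => sumPrimeInv n - Real.log (Real.log n)) atTop (𝓝 c)) :
    Tendsto (fun σ : ℝ => (∑' n : ℕ, primeInv n * Real.exp (-(σ * Real.log n))) +
      Real.log (1 - Real.exp (-σ))) (𝓝[>] 0) (𝓝 (c - Real.eulerMascheroniConstant)) := by
  obtain ⟨C, hC0, hC⟩ := exists_abs_mertensDiff_le hc
  have hint : Integrable ((Set.Ioi 0).indicator fun u : ℝ => Real.exp (-u)) := by
    rw [integrable_indicator_iff measurableSet_Ioi]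
    exact integrableOn_exp_neg_Ioi 0
  have hlim : ∫ u, (Set.Ioi 0).indicator
      (fun u => Real.exp (-u) * (c - Real.eulerMascheroniConstant)) u =
      c - Real.eulerMascheroniConstant := by
    rw [integral_indicator measurableSet_Ioi, integral_mul_const, integral_exp_neg_Ioi]
    simp
  have h : Tendsto (fun σ : ℝ => ∫ u, (Set.Ioi 0).indicator
      (fun u => Real.exp (-u) * mertensDiff (u / σ)) u) (𝓝[>] 0)
      (𝓝 (c - Real.eulerMascheroniConstant)) := by
    rw [← hlim]
    refine tendsto_integral_filter_of_dominated_convergence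
      (fun u => C * (Set.Ioi 0).indicator (fun u : ℝ => Real.exp (-u)) u) ?_ ?_
      (hint.const_mul C) ?_
    · refine Eventually.of_forall fun σ => Measurable.aestronglyMeasurable ?_
      refine Measurable.indicator ?_ measurableSet_Ioi
      exact (Real.measurable_exp.comp measurable_neg).mul
        (measurable_mertensDiff.comp (measurable_id.div_const σ))
    · refine Eventually.of_forall fun σ => Eventually.of_forall fun u => ?_
      simp only [Set.indicator_apply]
      split_ifs
      · rw [norm_mul, Real.norm_of_nonneg (Real.exp_pos _).le, mul_comm]
        exact mul_le_mul_of_nonneg_right (hC _) (Real.exp_pos _).le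
      · simp
    · refine Eventually.of_forall fun u => ?_
      simp only [Set.indicator_apply]
      split_ifs with hu
      · refine tendsto_const_nhds.mul ((tendsto_mertensDiff hc).comp ?_)
        exact tendsto_inv_nhdsGT_zero.const_mul_atTop hu
      · exact tendsto_const_nhds
  refine h.congr' ?_
  filter_upwards [self_mem_nhdsWithin] with σ hσ
  exact laplace_mertensDiff σ hσ

end MertensLaplace

section MertensThird

open Filter Topology

/-- The remainder `-log (1 - z) - z` of the logarithm series. -/
noncomputable def logRem (z : ℝ) : ℝ := -Real.log (1 - z) - z

lemma logRem_nonneg {z : ℝ} (h : z ≤ 1 / 2) : 0 ≤ logRem z := by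
  have := Real.log_le_sub_one_of_pos (x := 1 - z) (by linarith)
  unfold logRem; linarith

lemma logRem_le {z : ℝ} (h : z ≤ 1 / 2) : logRem z ≤ 2 * z ^ 2 := by
  have h1 := Real.one_sub_inv_le_log_of_pos (x := 1 - z) (by linarith)
  have h2 : (1 - z)⁻¹ - 1 - z ≤ 2 * z ^ 2 := by
    have e : (1 - z)⁻¹ - 1 - z = (1 - z)⁻¹ * z ^ 2 := by
      have : 1 - z ≠ 0 := by linarith
      field_simp
      ring
    rw [e]
    apply mul_le_mul_of_nonneg_right _ (sq_nonneg z)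
    rw [inv_le_comm₀ (by linarith) (by norm_num)]
    linarith
  unfold logRem; linarith

lemma Nat.Prime.rpow_neg_le_inv {p : ℕ} (hp : p.Prime) {s : ℝ} (hs : 1 ≤ s) :
    (p : ℝ) ^ (-s) ≤ 1 / p := by
  have h1 : (1 : ℝ) ≤ p := by exact_mod_cast hp.one_lt.le
  rw [one_div, ← Real.rpow_neg_one]
  exact Real.rpow_le_rpow_of_exponent_le h1 (by linarith)

lemma Nat.Prime.inv_le_half {p : ℕ} (hp : p.Prime) : 1 / (p : ℝ) ≤ 1 / 2 := by
  have h1 : (2 : ℝ) ≤ p := by exact_mod_cast hp.two_le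
  exact one_div_le_one_div_of_le (by norm_num) h1

lemma summable_two_div_sq : Summable fun n : ℕ => 2 * (1 / (n : ℝ)) ^ 2 := by
  have : Summable fun n : ℕ => 1 / (n : ℝ) ^ 2 := Real.summable_one_div_nat_pow.2 (by norm_num)
  simpa [div_pow] using this.mul_left 2

lemma norm_logRem_ite_le {s : ℝ} (hs : 1 ≤ s) (n : ℕ) :
    ‖if n.Prime then logRem ((n : ℝ) ^ (-s)) else 0‖ ≤ 2 * (1 / (n : ℝ)) ^ 2 := by
  split_ifs with hn
  · have h1 := hn.rpow_neg_le_inv hs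
    have h2 := hn.inv_le_half
    rw [Real.norm_of_nonneg (logRem_nonneg (h1.trans h2))]
    refine (logRem_le (h1.trans h2)).trans ?_
    gcongr
  · rw [norm_zero]; positivity

lemma summable_logRem_ite {s : ℝ} (hs : 1 ≤ s) :
    Summable fun n : ℕ => if n.Prime then logRem ((n : ℝ) ^ (-s)) else 0 :=
  Summable.of_norm_bounded summable_two_div_sq (norm_logRem_ite_le hs)

lemma tendsto_tsum_logRem :
    Tendsto (fun σ : ℝ => ∑' n : ℕ, if n.Prime then logRem ((n : ℝ) ^ (-(1 + σ))) else 0)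
      (𝓝[>] 0) (𝓝 (∑' n : ℕ, if n.Prime then logRem ((n : ℝ) ^ (-1 : ℝ)) else 0)) := by
  refine tendsto_tsum_of_dominated_convergence summable_two_div_sq (fun n => ?_) ?_
  · split_ifs with hn
    · have hn0 : (0 : ℝ) < n := by exact_mod_cast hn.pos
      have hlt : (n : ℝ) ^ (-(1 + 0) : ℝ) ≤ 1 / 2 :=
        (hn.rpow_neg_le_inv (by norm_num)).trans hn.inv_le_half
      have : ContinuousAt (fun σ : ℝ => logRem ((n : ℝ) ^ (-(1 + σ)))) 0 := by
        unfold logRem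
        have hc : ContinuousAt (fun σ : ℝ => (n : ℝ) ^ (-(1 + σ))) 0 :=
          ContinuousAt.rpow continuousAt_const (by fun_prop) (Or.inl hn0.ne')
        have hne : (1 : ℝ) - (n : ℝ) ^ (-(1 + 0) : ℝ) ≠ 0 :=
          (sub_pos.2 (hlt.trans_lt (by norm_num))).ne'
        exact ((continuousAt_const.sub hc).log hne).neg.sub hc
      have h := this.tendsto
      rw [add_zero] at h
      exact h.mono_left nhdsWithin_le_nhds
    · exact tendsto_const_nhds
  · filter_upwards [self_mem_nhdsWithin] with σ hσ n
    exact norm_logRem_ite_le (by linarith [Set.mem_Ioi.1 hσ]) n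

lemma log_tsum_rpow_eq (s : ℝ) (hs : 1 < s) :
    Real.log (∑' n : ℕ, 1 / (n : ℝ) ^ s) =
      ∑' n : ℕ, if n.Prime then -Real.log (1 - (n : ℝ) ^ (-s)) else 0 := by
  have hsum : Summable fun n : ℕ => (n : ℝ) ^ (-s) := Real.summable_nat_rpow.2 (by linarith)
  let f : ℕ →*₀ ℝ :=
    { toFun := fun n => (n : ℝ) ^ (-s)
      map_zero' := by simp [Real.zero_rpow (by linarith : -s ≠ 0)]
      map_one' := by simp
      map_mul' := fun m n => by
        push_cast
        rw [Real.mul_rpow (by positivity) (by positivity)] }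
  have hprod := EulerProduct.eulerProduct_completely_multiplicative_hasProd (f := f)
    (by simpa [f] using hsum.norm)
  have hpos : ∀ p : Nat.Primes, 0 < (1 - f p)⁻¹ := fun p => by
    have h1 := (p.2.rpow_neg_le_inv hs.le).trans p.2.inv_le_half
    have : f p = ((p : ℕ) : ℝ) ^ (-s) := rfl
    rw [this]
    apply inv_pos.2
    linarith
  have hfull : Summable fun n : ℕ => if n.Prime then -Real.log (1 - (n : ℝ) ^ (-s)) else 0 := by
    have h2 : Summable fun n : ℕ => if n.Prime then (n : ℝ) ^ (-s) else 0 := by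
      refine Summable.of_nonneg_of_le (fun n => ?_) (fun n => ?_) hsum
      · split_ifs <;> positivity
      · split_ifs
        · exact le_rfl
        · positivity
    refine ((summable_logRem_ite hs.le).add h2).congr fun n => ?_
    unfold logRem
    split_ifs <;> ring
  have hlogs : ∀ p : Nat.Primes, Real.log ((1 - f p)⁻¹) = -Real.log (1 - ((p : ℕ) : ℝ) ^ (-s)) :=
    fun p => Real.log_inv _
  have hind : (fun n : ℕ => if n.Prime then -Real.log (1 - (n : ℝ) ^ (-s)) else 0) =
      ({p | p.Prime} : Set ℕ).indicator fun n : ℕ => -Real.log (1 - (n : ℝ) ^ (-s)) := by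
    ext n; simp [Set.indicator_apply]
  have hsub : Summable fun p : Nat.Primes => Real.log ((1 - f p)⁻¹) := by
    simp_rw [hlogs]
    rw [hind] at hfull
    exact summable_subtype_iff_indicator.2 hfull
  have h := Real.rexp_tsum_eq_tprod hpos hsub
  rw [hprod.tprod_eq] at h
  have hz : ∑' n : ℕ, 1 / (n : ℝ) ^ s = ∑' n, f n :=
    tsum_congr fun n => by rw [one_div, ← Real.rpow_neg (by positivity)]; rfl
  rw [hz, ← h, Real.log_exp, hind]
  simp_rw [hlogs]
  exact tsum_subtype ({p | p.Prime} : Set ℕ) fun n : ℕ => -Real.log (1 - (n : ℝ) ^ (-s))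

lemma tendsto_log_one_sub_exp_neg_sub_log :
    Tendsto (fun σ : ℝ => Real.log (1 - Real.exp (-σ)) - Real.log σ) (𝓝[>] 0) (𝓝 0) := by
  have hd : HasDerivAt (fun σ : ℝ => 1 - Real.exp (-σ)) 1 0 := by
    have := ((hasDerivAt_neg (0 : ℝ)).exp).const_sub 1
    simpa using this
  have h := hd.tendsto_slope_zero_right
  have h2 : Tendsto (fun σ : ℝ => (1 - Real.exp (-σ)) / σ) (𝓝[>] 0) (𝓝 1) := by
    refine h.congr fun σ => ?_
    simp [div_eq_inv_mul]
  have h3 := (Real.continuousAt_log one_ne_zero).tendsto.comp h2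
  rw [Real.log_one] at h3
  refine h3.congr' ?_
  filter_upwards [self_mem_nhdsWithin] with σ hσ
  have hσ : 0 < σ := hσ
  have : Real.exp (-σ) < 1 := by rw [Real.exp_lt_one_iff]; linarith
  simp only [Function.comp]
  rw [Real.log_div (by linarith) hσ.ne']

lemma tendsto_log_zeta_add_log :
    Tendsto (fun σ : ℝ => Real.log (∑' n : ℕ, 1 / (n : ℝ) ^ (1 + σ)) + Real.log σ)
      (𝓝[>] 0) (𝓝 0) := by
  have ht : Tendsto (fun σ : ℝ => 1 + σ) (𝓝[>] 0) (𝓝[>] 1) := by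
    refine tendsto_nhdsWithin_iff.2 ⟨?_, ?_⟩
    · have : Tendsto (fun σ : ℝ => 1 + σ) (𝓝 0) (𝓝 (1 + 0)) := tendsto_const_nhds.add tendsto_id
      rw [add_zero] at this
      exact this.mono_left nhdsWithin_le_nhds
    · filter_upwards [self_mem_nhdsWithin] with σ hσ
      have : 0 < σ := hσ
      exact Set.mem_Ioi.2 (by linarith)
  have h := tendsto_sub_mul_tsum_nat_rpow.comp ht
  have h3 := (Real.continuousAt_log one_ne_zero).tendsto.comp h
  rw [Real.log_one] at h3
  refine h3.congr' ?_
  filter_upwards [self_mem_nhdsWithin, h.eventually (lt_mem_nhds zero_lt_one)] with σ hσ hpos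
  have hσ : 0 < σ := hσ
  simp only [Function.comp, add_sub_cancel_left] at hpos ⊢
  rw [Real.log_mul hσ.ne' (by rintro h0; rw [h0, mul_zero] at hpos; exact lt_irrefl _ hpos),
    add_comm]

lemma tendsto_sum_neg_log_sub_log_log :
    Tendsto (fun n : ℕ => ∑ p ∈ Finset.range (n + 1) with p.Prime, -Real.log (1 - 1 / (p : ℝ)) -
      Real.log (Real.log n)) atTop (𝓝 Real.eulerMascheroniConstant) := by
  obtain ⟨c, hc⟩ := exists_tendsto_sumPrimeInv_sub_log_log
  set B := ∑' n : ℕ, if n.Prime then logRem ((n : ℝ) ^ (-1 : ℝ)) else 0 with hB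
  have h1 := ((tendsto_laplace_mertensDiff hc).sub tendsto_log_one_sub_exp_neg_sub_log).add
    tendsto_tsum_logRem
  have h2 : c - Real.eulerMascheroniConstant - 0 + B = 0 := by
    refine tendsto_nhds_unique h1 (tendsto_log_zeta_add_log.congr' ?_)
    filter_upwards [self_mem_nhdsWithin] with σ hσ
    have hσ : 0 < σ := hσ
    have hs1 := summable_primeInv_mul_exp σ hσ
    have hs2 := summable_logRem_ite (s := 1 + σ) (by linarith)
    have : Real.log (∑' n : ℕ, 1 / (n : ℝ) ^ (1 + σ)) =
        (∑' n : ℕ, primeInv n * Real.exp (-(σ * Real.log n))) +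
        ∑' n : ℕ, if n.Prime then logRem ((n : ℝ) ^ (-(1 + σ))) else 0 := by
      rw [log_tsum_rpow_eq _ (by linarith), ← hs1.tsum_add hs2]
      refine tsum_congr fun n => ?_
      rw [primeInv_mul_exp]
      unfold logRem
      split_ifs <;> ring
    rw [this]
    ring
  have h3 := ((summable_logRem_ite le_rfl).hasSum.tendsto_sum_nat).comp (tendsto_add_atTop_nat 1)
  have h4 := hc.add h3
  have h5 : c + B = Real.eulerMascheroniConstant := by linarith
  rw [← hB, h5] at h4
  refine h4.congr fun n => ?_
  simp only [Function.comp]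
  rw [sumPrimeInv, Finset.sum_filter, Finset.sum_filter, sub_add_eq_add_sub,
    ← Finset.sum_add_distrib]
  congr 1
  refine Finset.sum_congr rfl fun p _ => ?_
  rw [Real.rpow_neg_one]
  unfold logRem
  split_ifs
  · rw [one_div]; ring
  · ring

lemma primesUpTo_eq_filter_range (x : ℝ) :
    primesUpTo x = (Finset.range (⌊x⌋₊ + 1)).filter Nat.Prime := by
  ext p; simp [primesUpTo]

/-- Mertens' third theorem. -/
theorem tendsto_prod_one_sub_inv_mul_log :
    Tendsto (fun x : ℝ => (∏ p ∈ primesUpTo x, (1 - 1 / (p : ℝ))) * Real.log x) atTop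
      (𝓝 (Real.exp (-Real.eulerMascheroniConstant))) := by
  have h1 : Tendsto (fun x : ℝ => Real.exp (-(∑ p ∈ Finset.range (⌊x⌋₊ + 1) with p.Prime,
      -Real.log (1 - 1 / (p : ℝ)) - Real.log (Real.log ⌊x⌋₊)))) atTop
      (𝓝 (Real.exp (-Real.eulerMascheroniConstant))) :=
    (Real.continuous_exp.tendsto _).comp
      ((tendsto_sum_neg_log_sub_log_log.comp (tendsto_nat_floor_atTop (α := ℝ))).neg)
  have h2 : Tendsto (fun x : ℝ => 1 - (Real.log ⌊x⌋₊ - Real.log x) / Real.log ⌊x⌋₊) atTop (𝓝 1) := by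
    have := tendsto_const_nhds (x := (1 : ℝ)) |>.sub (tendsto_log_floor_sub_log.div_atTop
      (Real.tendsto_log_atTop.comp (tendsto_natCast_atTop_atTop.comp
        (tendsto_nat_floor_atTop (α := ℝ)))))
    rwa [sub_zero] at this
  have h3 := h1.mul h2
  rw [mul_one] at h3
  refine h3.congr' ?_
  filter_upwards [eventually_ge_atTop (2 : ℝ)] with x hx
  have hf : 2 ≤ ⌊x⌋₊ := Nat.le_floor (by exact_mod_cast hx)
  have hl : 0 < Real.log ⌊x⌋₊ := Real.log_pos (by exact_mod_cast hf)
  rw [primesUpTo_eq_filter_range, Finset.sum_neg_distrib, neg_sub, sub_neg_eq_add, Real.exp_add,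
    Real.exp_log hl, Real.exp_sum, Finset.prod_congr rfl (fun p hp => Real.exp_log (by
      have := (Finset.mem_filter.1 hp).2.inv_le_half
      linarith))]
  field_simp
  ring

end MertensThird

section ParameterGrowth

open Filter Topology

lemma cube_div_six_le_exp {t : ℝ} (ht : 0 ≤ t) : t ^ 3 / 6 ≤ Real.exp t := by
  have := Real.pow_div_factorial_le_exp t ht 3
  norm_num [Nat.factorial] at this
  exact this

/-- The standing assumptions on the iterated logarithms `y = log x` and `z = log log x`. -/
structure LargeLogs (x y z : ℝ) : Prop where
  exp_y : Real.exp y = x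
  exp_z : Real.exp z = y
  hz : 1000 ≤ z

namespace LargeLogs

variable {x y z : ℝ}

lemma z_le (h : LargeLogs x y z) : 1000 * z ≤ y := by
  have h1 := cube_div_six_le_exp (t := z) (by linarith [h.hz])
  rw [h.exp_z] at h1
  have := h.hz
  nlinarith [mul_self_nonneg z, mul_le_mul this this (by norm_num) (by linarith)]

lemma y_ge (h : LargeLogs x y z) : 1000000 ≤ y := by linarith [h.z_le, h.hz]

lemma cube_le (h : LargeLogs x y z) : y ^ 3 / 6 ≤ x := by
  rw [← h.exp_y]
  exact cube_div_six_le_exp (by linarith [h.y_ge])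

lemma mul_le (h : LargeLogs x y z) : 1000 * (y * z) ≤ x := by
  have h1 := h.cube_le
  have h2 := h.z_le
  have h3 := h.y_ge
  have h4 : y * (1000 * z) ≤ y * y := mul_le_mul_of_nonneg_left h2 (by linarith)
  have h5 : 1000000 * (y * y) ≤ y * (y * y) := mul_le_mul_of_nonneg_right h3 (by positivity)
  nlinarith

lemma x_pos (h : LargeLogs x y z) : 0 < x := by rw [← h.exp_y]; positivity

lemma y_pos (h : LargeLogs x y z) : 0 < y := by linarith [h.y_ge]

lemma z_pos (h : LargeLogs x y z) : 0 < z := by linarith [h.hz]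

/-- `x / z` dominates `y`. -/
lemma y_le_div (h : LargeLogs x y z) : 1000 * y ≤ x / z := by
  rw [le_div_iff₀ h.z_pos]
  linarith [h.mul_le]

lemma div_y_le_div_z (h : LargeLogs x y z) : 1000 * (x / y) ≤ x / z := by
  rw [le_div_iff₀ h.z_pos, mul_assoc, div_mul_eq_mul_div, mul_div_assoc']
  rw [div_le_iff₀ h.y_pos]
  have := mul_le_mul_of_nonneg_left h.z_le h.x_pos.le
  linarith

lemma sqrt_mul_le (h : LargeLogs x y z) : y * Real.sqrt x ≤ x / z / 100 := by
  have h1 : Real.sqrt x = Real.exp (y / 2) := by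
    rw [← h.exp_y, Real.exp_half]
  have h2 := cube_div_six_le_exp (t := y / 2) (by linarith [h.y_ge])
  have h3 := h.y_ge
  have h4 : 100 * (y * z) ≤ Real.exp (y / 2) := by
    have a := mul_le_mul_of_nonneg_left h.z_le h.y_pos.le
    have b : 1000000 * (y * y) ≤ y * (y * y) := mul_le_mul_of_nonneg_right h3 (by positivity)
    nlinarith
  have hx : x = Real.exp (y / 2) * Real.exp (y / 2) := by
    rw [← Real.exp_add, add_halves, h.exp_y]
  rw [h1, div_div, le_div_iff₀ (by linarith [h.z_pos])]
  have h5 := mul_le_mul_of_nonneg_right h4 (Real.exp_pos (y / 2)).le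
  calc y * Real.exp (y / 2) * (z * 100) = 100 * (y * z) * Real.exp (y / 2) := by ring
    _ ≤ Real.exp (y / 2) * Real.exp (y / 2) := h5
    _ = x := hx.symm

lemma two_pow_le (h : LargeLogs x y z) : (2 : ℝ) ^ ⌊1.3 * z⌋₊ ≤ Real.exp (0.902 * z) := by
  rw [← Real.rpow_natCast, Real.rpow_def_of_pos (by norm_num)]
  apply Real.exp_le_exp.2
  have h1 : (⌊1.3 * z⌋₊ : ℝ) ≤ 1.3 * z := Nat.floor_le (by linarith [h.z_pos])
  have h2 := Real.log_two_lt_d9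
  have h3 : 0 < Real.log 2 := Real.log_pos (by norm_num)
  have h4 := h.z_pos
  nlinarith

/-- The loss incurred by extracting a `2 ^ k`-th root is acceptable. -/
lemma root_loss (h : LargeLogs x y z) :
    2 * (x / y) * Real.exp (0.902 * z) ≤ 0.06 * (x / z) := by
  have h1 := cube_div_six_le_exp (t := 0.098 * z) (by linarith [h.z_pos])
  have hz := h.hz
  have h2 : 34 * z ≤ Real.exp (0.098 * z) := by
    have : 1000 * 1000 ≤ z * z := mul_le_mul hz hz (by norm_num) (by linarith)
    nlinarith
  have hy : y = Real.exp (0.098 * z) * Real.exp (0.902 * z) := by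
    rw [← Real.exp_add, ← h.exp_z]; ring_nf
  have hpos := Real.exp_pos (0.902 * z)
  have h3 := mul_le_mul_of_nonneg_right h2 hpos.le
  rw [← hy] at h3
  have h4 : x / y * (34 * z * Real.exp (0.902 * z)) ≤ x := by
    calc _ ≤ x / y * y := mul_le_mul_of_nonneg_left h3 (div_nonneg h.x_pos.le h.y_pos.le)
      _ = x := div_mul_cancel₀ _ h.y_pos.ne'
  rw [← mul_div_assoc 0.06 x z, le_div_iff₀ h.z_pos]
  linarith [h.x_pos]

lemma le_div_mul (h : LargeLogs x y z) : 1000 ≤ x / (y * z) := by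
  rw [le_div_iff₀ (mul_pos h.y_pos h.z_pos)]
  exact h.mul_le

lemma w_mul_le (h : LargeLogs x y z) : (⌊1.2 * (x / (y * z))⌋₊ : ℝ) * y ≤ 1.2 * (x / z) := by
  have h1 : (⌊1.2 * (x / (y * z))⌋₊ : ℝ) ≤ 1.2 * (x / (y * z)) :=
    Nat.floor_le (by linarith [h.le_div_mul])
  refine (mul_le_mul_of_nonneg_right h1 h.y_pos.le).trans (le_of_eq ?_)
  have := h.y_pos
  have := h.z_pos
  field_simp

lemma le_w_mul (h : LargeLogs x y z) : 1.1 * (x / z) ≤ (⌊1.2 * (x / (y * z))⌋₊ : ℝ) * y := by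
  have h1 := Nat.lt_floor_add_one (1.2 * (x / (y * z)))
  have h2 := h.le_div_mul
  have h3 : 1.1 * (x / (y * z)) ≤ (⌊1.2 * (x / (y * z))⌋₊ : ℝ) := by linarith
  refine le_trans (le_of_eq ?_) (mul_le_mul_of_nonneg_right h3 h.y_pos.le)
  have := h.y_pos
  have := h.z_pos
  field_simp

lemma w_pos (h : LargeLogs x y z) : 0 < ⌊1.2 * (x / (y * z))⌋₊ :=
  Nat.floor_pos.2 (by linarith [h.le_div_mul])

lemma le_k_mul_w (h : LargeLogs x y z) :
    1.4 * (x / y) ≤ (⌊1.3 * z⌋₊ : ℝ) * ⌊1.2 * (x / (y * z))⌋₊ := by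
  have h1 := Nat.lt_floor_add_one (1.2 * (x / (y * z)))
  have h2 := h.le_div_mul
  have h3 : 1.1 * (x / (y * z)) ≤ (⌊1.2 * (x / (y * z))⌋₊ : ℝ) := by linarith
  have h4 := Nat.lt_floor_add_one (1.3 * z)
  have h5 : 1.29 * z ≤ (⌊1.3 * z⌋₊ : ℝ) := by linarith [h.hz]
  have h6 := mul_le_mul h5 h3 (by linarith) (by linarith [h.z_pos])
  refine le_trans ?_ h6
  have e : 1.29 * z * (1.1 * (x / (y * z))) = 1.419 * (x / y) := by
    have := h.y_pos
    have := h.z_pos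
    field_simp
    ring
  rw [e]
  have : 0 ≤ x / y := div_nonneg h.x_pos.le h.y_pos.le
  linarith

end LargeLogs

end ParameterGrowth

section CharacterSumBounds

open Filter Topology

lemma BoxBounded.mono {k q : ℕ} {g : ℕ → ℝ} {B C : ℝ} (hB : BoxBounded k q g B) (h : B ≤ C) :
    BoxBounded k q g C := by
  obtain ⟨h0, f, h1, h2, h3⟩ := hB
  exact ⟨h0, f, h1, h2, h3.trans h⟩

namespace LargeLogs

variable {x y z : ℝ}

lemma sqrt_eq (h : LargeLogs x y z) : Real.sqrt x = Real.exp (y / 2) := by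
  rw [← h.exp_y, Real.exp_half]

lemma boxBounded (h : LargeLogs x y z) {p : ℕ} (hp : p.Prime) (hp2 : p ≠ 2)
    (hpx : Real.sqrt x < p) (M : ℕ) :
    BoxBounded ⌊1.3 * z⌋₊ p (fun n => (legendre p ((8 * (M + n) + 1 : ℕ) : ℤ) : ℝ))
      (Real.exp (-(y / 16))) := by
  rw [h.sqrt_eq] at hpx
  have hy := h.y_ge
  have hzy := h.z_le
  have hz := h.z_pos
  have h2 := h.two_pow_le
  set k := ⌊1.3 * z⌋₊
  set t := ⌊Real.exp (y / 8)⌋₊ with ht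
  have he : (2 : ℝ) ≤ Real.exp (y / 8) := by linarith [Real.add_one_le_exp (y / 8)]
  have ht1 : (t : ℝ) ≤ Real.exp (y / 8) := Nat.floor_le (Real.exp_pos _).le
  have ht2 : Real.exp (y / 8) / 2 ≤ t := by linarith [Nat.lt_floor_add_one (Real.exp (y / 8))]
  have ht0 : 0 < t := by
    have : (0 : ℝ) < t := by linarith
    exact_mod_cast this
  have h40 : (40 : ℝ) ≤ Real.exp (y / 64) := by linarith [Real.add_one_le_exp (y / 64)]
  have h64 : Real.exp (0.902 * z) ≤ Real.exp (y / 64) := Real.exp_le_exp.2 (by linarith)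
  have h2' : (2 : ℝ) ^ k ≤ Real.exp (y / 64) := h2.trans h64
  have hlt : 16 * (t ^ 2 * 2 ^ k) < p := by
    have : (16 : ℝ) * ((t : ℝ) ^ 2 * 2 ^ k) < p := by
      refine lt_of_le_of_lt ?_ hpx
      calc (16 : ℝ) * ((t : ℝ) ^ 2 * 2 ^ k) ≤
          Real.exp (y / 64) * (Real.exp (y / 8) ^ 2 * Real.exp (y / 64)) := by
            gcongr; linarith
        _ = Real.exp (y / 64 + (y / 8 + y / 8 + y / 64)) := by
            rw [Real.exp_add, Real.exp_add, Real.exp_add, sq]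
        _ ≤ Real.exp (y / 2) := Real.exp_le_exp.2 (by linarith)
    exact_mod_cast this
  refine (boxBounded_legendre hp hp2 M k t ht0 hlt).mono ?_
  have a : 5 * (2 : ℝ) ^ k / t ≤ Real.exp (-(y / 16)) / 2 := by
    rw [div_le_div_iff₀ (by exact_mod_cast ht0) (by norm_num)]
    calc 5 * (2 : ℝ) ^ k * 2 ≤ Real.exp (y / 64) / 2 * Real.exp (y / 64) := by
          nlinarith [Real.exp_pos (y / 64), pow_pos (two_pos : (0 : ℝ) < 2) k]
      _ = Real.exp (y / 64 + y / 64) / 2 := by rw [Real.exp_add]; ring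
      _ ≤ Real.exp (-(y / 16) + y / 8) / 2 :=
          div_le_div_of_nonneg_right (Real.exp_le_exp.2 (by linarith)) (by norm_num)
      _ = Real.exp (-(y / 16)) * (Real.exp (y / 8) / 2) := by rw [Real.exp_add]; ring
      _ ≤ Real.exp (-(y / 16)) * t := by gcongr
  have b : (4 : ℝ) ^ k / p ≤ Real.exp (-(y / 16)) / 2 := by
    have hp0 : (0 : ℝ) < p := (Real.exp_pos _).trans hpx
    rw [div_le_div_iff₀ hp0 (by norm_num)]
    calc (4 : ℝ) ^ k * 2 = 2 ^ k * 2 ^ k * 2 := by rw [← mul_pow]; norm_num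
      _ ≤ Real.exp (y / 64) * Real.exp (y / 64) * Real.exp (y / 64) := by gcongr; linarith
      _ = Real.exp (y / 64 + y / 64 + y / 64) := by rw [Real.exp_add, Real.exp_add]
      _ ≤ Real.exp (-(y / 16) + y / 2) := Real.exp_le_exp.2 (by linarith)
      _ = Real.exp (-(y / 16)) * Real.exp (y / 2) := Real.exp_add _ _
      _ ≤ Real.exp (-(y / 16)) * p := by gcongr
  linarith

lemma length_bounds (h : LargeLogs x y z) {N : ℝ} (hN : Real.exp (3 * (x / z)) ≤ N) {L : ℕ}
    (hL : |(L : ℝ) - N / 8| ≤ 2) : Real.exp (3 * (x / z)) / 16 ≤ L ∧ (L : ℝ) ≤ N := by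
  have h1 := abs_le.1 hL
  have h2 := Real.add_one_le_exp (3 * (x / z))
  have h3 := h.y_le_div
  have h4 := h.y_ge
  constructor <;> linarith [h1.1, h1.2]

lemma abs_legendreSum_le_of_many (h : LargeLogs x y z)
    (hπ : ((oddPrimesUpTo x).card : ℝ) ≤ 1.4 * (x / y)) {N : ℝ}
    (hN : Real.exp (3 * (x / z)) ≤ N) {M L : ℕ} (hL : |(L : ℝ) - N / 8| ≤ 2) {T : Finset ℕ}
    (hT : T ⊆ oddPrimesUpTo x)
    (hmany : ⌊1.2 * (x / (y * z))⌋₊ ≤ (T.filter fun p : ℕ => Real.sqrt x < p).card) :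
    |legendreSum (oddPrimesUpTo x) T M L| ≤ N * Real.exp (-(2 * (x / y))) := by
  obtain ⟨hL1, hL2⟩ := h.length_bounds hN hL
  have hLpos : (0 : ℝ) < L := lt_of_lt_of_le (by positivity) hL1
  obtain ⟨Q, hQT, hQc⟩ := Finset.exists_subset_card_eq hmany
  have hw := h.w_pos
  have hw1 := h.w_mul_le
  have hw2 := h.le_w_mul
  have hkw := h.le_k_mul_w
  have hloss := h.root_loss
  have hk2 := h.two_pow_le
  have hbox := fun {p : ℕ} (hp : p.Prime) (hp2 : p ≠ 2) (hpx : Real.sqrt x < p) =>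
    h.boxBounded hp hp2 hpx M
  set w := ⌊1.2 * (x / (y * z))⌋₊
  set k := ⌊1.3 * z⌋₊
  have hx0 := h.x_pos
  have hy0 := h.y_ge
  have hz0 := h.z_le
  have hzp := h.z_pos
  have hyz := h.y_le_div
  have hP : ∀ p ∈ oddPrimesUpTo x, p.Prime := fun p hp => ((mem_oddPrimesUpTo hx0.le).1 hp).1
  have hx1 : 1 ≤ x := by rw [← h.exp_y]; exact Real.one_le_exp (by linarith)
  have hmain := legendreSum_pow_le (oddPrimesUpTo x) T Q hP hT
    (hQT.trans (Finset.filter_subset _ _)) ⌊x⌋₊ (Nat.floor_pos.2 hx1)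
    (fun p hp => Nat.le_floor ((mem_oddPrimesUpTo hx0.le).1 hp).2.2) k w hw
    (by exact_mod_cast hπ.trans hkw) M L (by exact_mod_cast hLpos) (Real.exp (-(y / 16)))
    (fun p hp => by
      have hp' := Finset.mem_filter.1 (hQT hp)
      have hp2 := (mem_oddPrimesUpTo hx0.le).1 (hT hp'.1)
      exact hbox hp2.1 hp2.2.1 hp'.2)
  rw [hQc] at hmain
  set s := x / z with hs
  have t1 : Real.exp (-(y / 16)) ^ w ≤ Real.exp (-(0.068 * s)) := by
    rw [← Real.exp_nat_mul]
    apply Real.exp_le_exp.2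
    linarith
  have t2 : 4 * (2 : ℝ) ^ k * ((⌊x⌋₊ : ℝ) ^ w * (⌊x⌋₊ : ℝ) ^ w / L) ≤ Real.exp (-(0.068 * s)) := by
    have hX : (⌊x⌋₊ : ℝ) ^ w ≤ Real.exp (1.2 * s) := by
      calc (⌊x⌋₊ : ℝ) ^ w ≤ Real.exp y ^ w := by
            rw [h.exp_y]; gcongr; exact Nat.floor_le hx0.le
        _ = Real.exp (w * y) := (Real.exp_nat_mul _ _).symm
        _ ≤ Real.exp (1.2 * s) := Real.exp_le_exp.2 hw1
    have h64 : (64 : ℝ) ≤ Real.exp y := by linarith [Real.add_one_le_exp y]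
    calc 4 * (2 : ℝ) ^ k * ((⌊x⌋₊ : ℝ) ^ w * (⌊x⌋₊ : ℝ) ^ w / L) ≤
        4 * Real.exp (0.902 * z) * (Real.exp (1.2 * s) * Real.exp (1.2 * s) /
          (Real.exp (3 * s) / 16)) := by gcongr
      _ = 64 * Real.exp (0.902 * z) * Real.exp (1.2 * s + 1.2 * s - 3 * s) := by
          rw [Real.exp_sub, Real.exp_add]; field_simp; norm_num
      _ ≤ Real.exp y * Real.exp (0.902 * z) * Real.exp (1.2 * s + 1.2 * s - 3 * s) := by gcongr
      _ = Real.exp (y + 0.902 * z + (1.2 * s + 1.2 * s - 3 * s)) := by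
          rw [Real.exp_add (y + 0.902 * z), Real.exp_add]
      _ ≤ _ := Real.exp_le_exp.2 (by linarith)
  have t3 : 2 * Real.exp (-(0.068 * s)) ≤ Real.exp (-(0.06 * s)) := by
    have h2 : (2 : ℝ) ≤ Real.exp (0.008 * s) := by linarith [Real.add_one_le_exp (0.008 * s)]
    calc 2 * Real.exp (-(0.068 * s)) ≤ Real.exp (0.008 * s) * Real.exp (-(0.068 * s)) := by gcongr
      _ = _ := by rw [← Real.exp_add]; ring_nf
  have t4 : (|legendreSum (oddPrimesUpTo x) T M L| / L) ^ 2 ^ k ≤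
      Real.exp (-(2 * (x / y))) ^ 2 ^ k := by
    calc _ ≤ Real.exp (-(0.06 * s)) := by linarith
      _ ≤ Real.exp (-(2 * (x / y))) ^ 2 ^ k := by
        rw [← Real.exp_nat_mul]
        apply Real.exp_le_exp.2
        push_cast
        have : 0 ≤ 2 * (x / y) := by have := h.y_pos; positivity
        have := mul_le_mul_of_nonneg_left hk2 this
        linarith
  have t5 := le_of_pow_le_pow_left₀ (by positivity) (Real.exp_pos _).le t4
  rw [div_le_iff₀ hLpos] at t5
  calc _ ≤ _ := t5
    _ = L * Real.exp (-(2 * (x / y))) := mul_comm _ _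
    _ ≤ _ := by gcongr

lemma abs_legendreSum_le_of_few (h : LargeLogs x y z)
    (hπ : ((oddPrimesUpTo x).card : ℝ) ≤ 1.4 * (x / y)) {N : ℝ}
    (hN : Real.exp (3 * (x / z)) ≤ N) {M L : ℕ} {T : Finset ℕ}
    (hT : T ⊆ oddPrimesUpTo x) (hTne : T.Nonempty)
    (hfew : (T.filter fun p : ℕ => Real.sqrt x < p).card < ⌊1.2 * (x / (y * z))⌋₊) :
    |legendreSum (oddPrimesUpTo x) T M L| ≤ N * Real.exp (-(2 * (x / y))) := by
  have hx0 := h.x_pos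
  have hy0 := h.y_ge
  have hw1 := h.w_mul_le
  have hsq := h.sqrt_mul_le
  have hyz := h.y_le_div
  have hdd := h.div_y_le_div_z
  have hP := fun p (hp : p ∈ oddPrimesUpTo x) => (mem_oddPrimesUpTo hx0.le).1 hp
  set w := ⌊1.2 * (x / (y * z))⌋₊
  set s := x / z with hs
  have h1 := abs_legendreSum_sub_le (oddPrimesUpTo x) T (fun p hp => (hP p hp).1)
    (fun p hp => (hP p hp).2.1) hT M L
  rw [if_neg hTne.ne_empty, sub_zero] at h1
  have hcard : (T.card : ℝ) ≤ w + Real.sqrt x := by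
    rw [← Finset.card_filter_add_card_filter_not (s := T) (fun p : ℕ => Real.sqrt x < p)]
    push_cast
    have a : ((T.filter fun p : ℕ => Real.sqrt x < p).card : ℝ) ≤ w := by exact_mod_cast hfew.le
    have b : ((T.filter fun p : ℕ => ¬ Real.sqrt x < p).card : ℝ) ≤ Real.sqrt x := by
      have hsub : (T.filter fun p : ℕ => ¬ Real.sqrt x < p) ⊆ Finset.Icc 1 ⌊Real.sqrt x⌋₊ := by
        intro p hp
        have hp' := Finset.mem_filter.1 hp
        exact Finset.mem_Icc.2 ⟨(hP p (hT hp'.1)).1.one_lt.le, Nat.le_floor (not_lt.1 hp'.2)⟩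
      have hc := Finset.card_le_card hsub
      rw [Nat.card_Icc, Nat.add_sub_cancel] at hc
      exact le_trans (by exact_mod_cast hc) (Nat.floor_le (Real.sqrt_nonneg x))
    linarith
  have hprod : ((∏ p ∈ T, p : ℕ) : ℝ) ≤ Real.exp (1.21 * s) := by
    push_cast
    calc ∏ p ∈ T, (p : ℝ) ≤ ∏ p ∈ T, Real.exp y := by
          apply Finset.prod_le_prod
          · intros; positivity
          · intro p hp; rw [h.exp_y]; exact (hP p (hT hp)).2.2
      _ = Real.exp (T.card * y) := by rw [Finset.prod_const, ← Real.exp_nat_mul]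
      _ ≤ _ := by
        apply Real.exp_le_exp.2
        have := mul_le_mul_of_nonneg_right hcard h.y_pos.le
        linarith
  have hpow : (2 : ℝ) ^ (oddPrimesUpTo x).card ≤ Real.exp (x / y) := by
    rw [← Real.rpow_natCast, Real.rpow_def_of_pos (by norm_num)]
    apply Real.exp_le_exp.2
    have h2 := Real.log_two_lt_d9
    have h3 : 0 < Real.log 2 := Real.log_pos (by norm_num)
    have h4 : 0 ≤ x / y := by have := h.y_pos; positivity
    nlinarith
  have hone : (1 : ℝ) ≤ Real.exp (1.21 * s) := Real.one_le_exp (by linarith)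
  have h3 : (3 : ℝ) ≤ Real.exp y := by linarith [Real.add_one_le_exp y]
  calc |legendreSum (oddPrimesUpTo x) T M L| ≤
      2 ^ (oddPrimesUpTo x).card * (2 * (∏ p ∈ T, p : ℕ) + 1) := h1
    _ ≤ Real.exp (x / y) * (Real.exp y * Real.exp (1.21 * s)) := by
        gcongr
        nlinarith
    _ = Real.exp (x / y + (y + 1.21 * s)) := by rw [Real.exp_add, Real.exp_add]
    _ ≤ Real.exp (3 * s + -(2 * (x / y))) := Real.exp_le_exp.2 (by linarith)
    _ = Real.exp (3 * s) * Real.exp (-(2 * (x / y))) := Real.exp_add _ _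
    _ ≤ _ := by gcongr

end LargeLogs

end CharacterSumBounds

section Main

open Filter Topology

lemma piX_eq_card_add_one {x : ℝ} (hx : 2 ≤ x) : piX x = (oddPrimesUpTo x).card + 1 := by
  have hmem : 2 ∈ primesUpTo x := by
    simp only [primesUpTo, Finset.mem_filter, Finset.mem_Iic]
    exact ⟨Nat.le_floor (by exact_mod_cast hx), Nat.prime_two⟩
  exact (Finset.card_erase_add_one hmem).symm

lemma two_pow_piX_le {x y z : ℝ} (h : LargeLogs x y z)
    (hπ : (piX x : ℝ) ≤ 1.4 * (x / y)) : (2 : ℝ) ^ piX x ≤ Real.exp (x / y) := by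
  rw [← Real.rpow_natCast, Real.rpow_def_of_pos (by norm_num)]
  apply Real.exp_le_exp.2
  have h2 := Real.log_two_lt_d9
  have h3 : 0 < Real.log 2 := Real.log_pos (by norm_num)
  have h4 : 0 ≤ x / y := div_nonneg h.x_pos.le h.y_pos.le
  nlinarith

lemma eventually_piX_le : ∀ᶠ x : ℝ in atTop, (piX x : ℝ) ≤ 1.4 * (x / Real.log x) := by
  have h4 : Real.log 4 = 2 * Real.log 2 := by
    rw [show (4 : ℝ) = 2 ^ 2 by norm_num, Real.log_pow]; norm_num
  filter_upwards [Chebyshev.eventually_primeCounting_le (ε := 0.01) (by norm_num),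
    eventually_ge_atTop (1 : ℝ)] with x hx hx1
  have e : piX x = Nat.primeCounting ⌊x⌋₊ := by
    rw [piX, primesUpTo_eq_filter_range, Nat.primeCounting, Nat.primeCounting',
      Nat.count_eq_card_filter_range]
  rw [e]
  refine hx.trans ?_
  rw [mul_div_assoc]
  apply mul_le_mul_of_nonneg_right
  · linarith [Real.log_two_lt_d9]
  · exact div_nonneg (by linarith) (Real.log_nonneg hx1)

lemma eventually_largeLogs :
    ∀ᶠ x : ℝ in atTop, LargeLogs x (Real.log x) (Real.log (Real.log x)) := by
  have h1 : Tendsto (fun x : ℝ => Real.log (Real.log x)) atTop atTop :=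
    Real.tendsto_log_atTop.comp Real.tendsto_log_atTop
  filter_upwards [eventually_gt_atTop (0 : ℝ), Real.tendsto_log_atTop.eventually_gt_atTop 0,
    h1.eventually_ge_atTop 1000] with x hx hy hz
  exact ⟨Real.exp_log hx, Real.exp_log hy, hz⟩

/-- The sieve count with its error term, uniformly in the interval. -/
lemma abs_pseudosquaresIn_sub_le_exp {x y z : ℝ} (h : LargeLogs x y z)
    (hπ : (piX x : ℝ) ≤ 1.4 * (x / y)) {A N : ℝ} (hA : 0 ≤ A)
    (hN : Real.exp (3 * (x / z)) ≤ N) :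
    |(pseudosquaresIn x A N : ℝ) -
      N * (∏ p ∈ primesUpTo x, (1 - 1 / (p : ℝ))) / 2 ^ (piX x + 1)| ≤
      3 * (N * Real.exp (-(2 * (x / y)))) := by
  have hy0 := h.y_ge
  have hdd := h.div_y_le_div_z
  have hyz := h.y_le_div
  have hx2 : 2 ≤ x := by
    rw [← h.exp_y]; linarith [Real.add_one_le_exp y]
  have hN0 : 0 < N := (Real.exp_pos _).trans_le hN
  have hπ' : ((oddPrimesUpTo x).card : ℝ) ≤ 1.4 * (x / y) := by
    rw [piX_eq_card_add_one hx2] at hπ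
    push_cast at hπ
    linarith
  have hmain := abs_pseudosquaresIn_sub_le x A N (N * Real.exp (-(2 * (x / y)))) hx2 hA hN0.le
    (fun M L hL T hT hTne => by
      by_cases hc : ⌊1.2 * (x / (y * z))⌋₊ ≤ (T.filter fun p : ℕ => Real.sqrt x < p).card
      · exact h.abs_legendreSum_le_of_many hπ' hN hL hT hc
      · exact h.abs_legendreSum_le_of_few hπ' hN hT hTne (not_le.1 hc))
    (by positivity)
  have h8 : 8 ≤ N * Real.exp (-(2 * (x / y))) := by
    calc (8 : ℝ) ≤ Real.exp y := by linarith [Real.add_one_le_exp y]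
      _ ≤ Real.exp (3 * (x / z) + -(2 * (x / y))) := Real.exp_le_exp.2 (by linarith)
      _ = Real.exp (3 * (x / z)) * Real.exp (-(2 * (x / y))) := Real.exp_add _ _
      _ ≤ _ := by gcongr
  have hs : Real.sqrt N ≤ N * Real.exp (-(2 * (x / y))) := by
    have h1 : Real.exp (2 * (x / y)) ≤ Real.sqrt N := by
      apply Real.le_sqrt_of_sq_le
      refine le_trans ?_ hN
      rw [← Real.exp_nat_mul]
      exact Real.exp_le_exp.2 (by push_cast; linarith)
    have h2 := mul_le_mul_of_nonneg_left h1 (Real.sqrt_nonneg N)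
    rw [Real.mul_self_sqrt hN0.le] at h2
    rw [Real.exp_neg, ← div_eq_mul_inv, le_div_iff₀ (Real.exp_pos _)]
    exact h2
  linarith

lemma tendsto_log_mul_exp_neg_div_log :
    Tendsto (fun x : ℝ => Real.log x * Real.exp (-(x / Real.log x))) atTop (𝓝 0) := by
  have h1 : Tendsto (fun t : ℝ => t ^ 1 * Real.exp (-t)) atTop (𝓝 0) :=
    Real.tendsto_pow_mul_exp_neg_atTop_nhds_zero 1
  have h2 := h1.comp Real.tendsto_log_atTop
  refine squeeze_zero' ?_ ?_ h2
  · filter_upwards [eventually_ge_atTop (1 : ℝ)] with x hx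
    exact mul_nonneg (Real.log_nonneg hx) (Real.exp_pos _).le
  · filter_upwards [eventually_largeLogs] with x h
    simp only [Function.comp, pow_one]
    have h3 := h.y_pos
    refine mul_le_mul_of_nonneg_left (Real.exp_le_exp.2 (neg_le_neg ?_)) h3.le
    rw [le_div_iff₀ h3]
    have h4 := h.cube_le
    have h5 := h.y_ge
    nlinarith [mul_le_mul_of_nonneg_right h5 (mul_self_nonneg (Real.log x))]

end Main

/-- Uniformly for `A ≥ 0` and `N ≥ exp(3x / log log x)`,
`#(S_x ∩ (A, A+N]) = (1+o(1)) · N / (2^{π(x)+1} e^γ log x)` as `x → ∞`. -/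
theorem pseudosquares_in_interval_asymptotic :
    ∀ ε : ℝ, 0 < ε → ∃ x₀ : ℝ, ∀ x : ℝ, x₀ ≤ x → ∀ A : ℝ, 0 ≤ A →
      ∀ N : ℝ, Real.exp (3 * x / Real.log (Real.log x)) ≤ N →
        |(pseudosquaresIn x A N : ℝ) -
            N / (2 ^ (piX x + 1) *
              Real.exp Real.eulerMascheroniConstant * Real.log x)| ≤
          ε * (N / (2 ^ (piX x + 1) *
              Real.exp Real.eulerMascheroniConstant * Real.log x)) := by
  intro ε hε
  set E := Real.exp Real.eulerMascheroniConstant with hE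
  have hE0 : 0 < E := Real.exp_pos _
  have hmertens := (tendsto_prod_one_sub_inv_mul_log.mul_const E).sub_const 1
  rw [← Real.exp_add, neg_add_cancel, Real.exp_zero, sub_self] at hmertens
  have hsmall := tendsto_log_mul_exp_neg_div_log.const_mul (6 * E)
  rw [mul_zero] at hsmall
  have hev := (((hmertens.abs.eventually (ge_mem_nhds (show |(0 : ℝ)| < ε / 2 by simpa using hε))).and
    (hsmall.eventually (ge_mem_nhds (half_pos hε)))).and
    (eventually_largeLogs.and eventually_piX_le))
  obtain ⟨x₀, hx₀⟩ := Filter.eventually_atTop.1 hev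
  refine ⟨x₀, fun x hx A hA N hN => ?_⟩
  obtain ⟨⟨h1, h2⟩, hLL, hπ⟩ := hx₀ x hx
  rw [mul_div_assoc] at hN
  have hmain := abs_pseudosquaresIn_sub_le_exp hLL hπ hA hN
  have h2pi := two_pow_piX_le hLL hπ
  have hy := hLL.y_pos
  have hN0 : 0 < N := (Real.exp_pos _).trans_le hN
  set y := Real.log x
  set V := ∏ p ∈ primesUpTo x, (1 - 1 / (p : ℝ))
  set D : ℝ := 2 ^ (piX x + 1) with hD
  have hD0 : 0 < D := by positivity
  have hDle : D ≤ 2 * Real.exp (x / y) := by rw [hD, pow_succ]; linarith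
  set R := N / (D * E * y) with hR
  have hR0 : 0 < R := by positivity
  have hA1 : |N * V / D - R| ≤ ε / 2 * R := by
    have e : N * V / D - R = (V * y * E - 1) * R := by
      rw [hR]; field_simp
    rw [e, abs_mul, abs_of_pos hR0]
    exact mul_le_mul_of_nonneg_right h1 hR0.le
  have hA2 : 3 * (N * Real.exp (-(2 * (x / y)))) ≤ ε / 2 * R := by
    have e : 3 * (N * Real.exp (-(2 * (x / y)))) =
        3 * D * E * y * Real.exp (-(2 * (x / y))) * R := by
      rw [hR]; field_simp
    rw [e]
    apply mul_le_mul_of_nonneg_right _ hR0.le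
    have e2 : Real.exp (-(2 * (x / y))) = Real.exp (-(x / y)) * Real.exp (-(x / y)) := by
      rw [← Real.exp_add]; ring_nf
    have e3 : Real.exp (x / y) * Real.exp (-(x / y)) = 1 := by
      rw [← Real.exp_add, add_neg_cancel, Real.exp_zero]
    calc 3 * D * E * y * Real.exp (-(2 * (x / y)))
        ≤ 3 * (2 * Real.exp (x / y)) * E * y * Real.exp (-(2 * (x / y))) := by gcongr
      _ = 6 * E * (y * Real.exp (-(x / y))) * (Real.exp (x / y) * Real.exp (-(x / y))) := by
          rw [e2]; ring
      _ = 6 * E * (y * Real.exp (-(x / y))) := by rw [e3, mul_one]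
      _ ≤ ε / 2 := h2
  calc |(pseudosquaresIn x A N : ℝ) - R|
      ≤ |(pseudosquaresIn x A N : ℝ) - N * V / D| + |N * V / D - R| := abs_sub_le _ _ _
    _ ≤ ε * R := by linarith
end

section
/- For all sufficiently large real x, there exist two distinct primes ℓ₁ and ℓ₂ with x < ℓ₁ < ℓ₂ ≤ 2^{π(x)} x such that ℓ₁ ≡ ℓ₂ (mod 8) and the Legendre symbols (ℓ₁/p) and (ℓ₂/p) agree for every odd prime p ≤ x; for any such pair, the product ℓ₁ℓ₂ is an x-pseudosquare. -/
open scoped BigOperators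

open Filter in
/-- The logarithm of `2 ^ π(x) * x` is at most `x / 100` for large `x`. -/
lemma eventually_primeCounting_mul_log_two_add_log_le :
    ∀ᶠ x : ℝ in atTop,
      (Nat.primeCounting ⌊x⌋₊ : ℝ) * Real.log 2 + Real.log x ≤ x / 100 := by
  have hlog : ∀ᶠ x : ℝ in atTop, (1000 : ℝ) ≤ Real.log x :=
    Real.tendsto_log_atTop.eventually_ge_atTop 1000
  have hlittle : ∀ᶠ x : ℝ in atTop, ‖Real.log x‖ ≤ 1 / 1000 * ‖id x‖ :=
    Real.isLittleO_log_id_atTop.bound (by norm_num)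
  filter_upwards [hlog, hlittle, Chebyshev.eventually_primeCounting_le one_pos,
    eventually_ge_atTop 2] with x hx hlx hpi hx2
  have hlog4 : Real.log 4 ≤ 2 := by
    rw [show (4 : ℝ) = 2 ^ 2 by norm_num, Real.log_pow]
    have := Real.log_two_lt_d9
    push_cast
    linarith
  have hlog_le : Real.log x ≤ x / 1000 := by
    rw [id_eq, Real.norm_of_nonneg (by linarith), Real.norm_of_nonneg (by linarith)] at hlx
    linarith
  have hpi_le : (Nat.primeCounting ⌊x⌋₊ : ℝ) ≤ 3 * x / 1000 := by
    refine hpi.trans ?_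
    gcongr
    linarith
  have hlog2 : Real.log 2 ≤ 1 := by linarith [Real.log_two_lt_d9]
  have := mul_le_of_le_one_right (Nat.cast_nonneg (α := ℝ) (Nat.primeCounting ⌊x⌋₊)) hlog2
  linarith

/-- There are at least `3 * 2 ^ k` primes up to `2 ^ k * x` if `log (2 ^ k * x) ≤ x / 100`. -/
lemma three_mul_two_pow_le_primeCounting {x : ℝ} (hx : 4 ≤ x) {k : ℕ}
    (hk : k * Real.log 2 + Real.log x ≤ x / 100) :
    3 * 2 ^ k ≤ Nat.primeCounting ⌊2 ^ k * x⌋₊ := by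
  have hK : (1 : ℝ) ≤ 2 ^ k := one_le_pow₀ one_le_two
  have hKx : x ≤ 2 ^ k * x := le_mul_of_one_le_left (by linarith) hK
  have hlog : Real.log (2 ^ k * x) ≤ x / 100 := by
    rwa [Real.log_mul (by positivity) (by positivity), Real.log_pow]
  have hlog_pos : 0 < Real.log (2 ^ k * x) := Real.log_pos (by linarith)
  have hlog_add : Real.log (2 ^ k * x + 2) ≤ 2 * Real.log (2 ^ k * x) := by
    rw [← Nat.cast_ofNat, ← Real.log_pow]
    exact Real.log_le_log (by positivity) (by push_cast; nlinarith)
  have hpi := Chebyshev.pi_ge' (x := 2 ^ k * x) (by linarith)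
  have hcount : (3 * 2 ^ k : ℝ) ≤
      ((2 ^ k * x - 1) * Real.log 2 - Real.log (2 ^ k * x + 2)) / Real.log (2 ^ k * x) := by
    rw [le_div_iff₀ hlog_pos]
    have hmain : (2 ^ k * x - 1) * (1 / 2) ≤ (2 ^ k * x - 1) * Real.log 2 :=
      mul_le_mul_of_nonneg_left (by linarith [Real.log_two_gt_d9]) (by linarith)
    have := mul_le_mul_of_nonneg_left hlog (show (0 : ℝ) ≤ 3 * 2 ^ k by positivity)
    linarith
  exact_mod_cast hcount.trans hpi

lemma primesUpTo_eq_primesLE (x : ℝ) : primesUpTo x = Nat.primesLE ⌊x⌋₊ := by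
  ext p
  simp [primesUpTo, Nat.mem_primesLE]

lemma piX_eq_primeCounting (x : ℝ) : piX x = Nat.primeCounting ⌊x⌋₊ := by
  rw [piX, primesUpTo_eq_primesLE, Nat.primesLE_card_eq_primeCounting]

lemma legendre_mul (p : ℕ) (a b : ℤ) : legendre p (a * b) = legendre p a * legendre p b := by
  unfold legendre
  split_ifs with hp
  · have : Fact p.Prime := ⟨hp⟩
    exact legendreSym.mul p a b
  · simp

lemma legendre_eq_one_or_neg_one {p ℓ : ℕ} (hp : p.Prime) (hℓ : ℓ.Prime) (hne : p ≠ ℓ) :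
    legendre p ℓ = 1 ∨ legendre p ℓ = -1 := by
  have : Fact p.Prime := ⟨hp⟩
  rw [legendre, dif_pos hp]
  refine legendreSym.eq_one_or_neg_one p ?_
  rw [Int.cast_natCast, Ne, ZMod.natCast_eq_zero_iff, Nat.prime_dvd_prime_iff_eq hp hℓ]
  exact hne

lemma isPseudosquare_mul_of_legendre_eq {x : ℝ} (hx : 2 ≤ x) {ℓ₁ ℓ₂ : ℕ} (h₁ : ℓ₁.Prime)
    (h₂ : ℓ₂.Prime) (hxℓ : x < ℓ₁) (hlt : ℓ₁ < ℓ₂) (hmod : ℓ₁ % 8 = ℓ₂ % 8)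
    (hleg : ∀ p : ℕ, p.Prime → p ≠ 2 → (p : ℝ) ≤ x → legendre p ℓ₁ = legendre p ℓ₂) :
    IsPseudosquare x (ℓ₁ * ℓ₂) := by
  refine ⟨Nat.mul_pos h₁.pos h₂.pos, ?_, ?_, fun p hp hp2 hpx => ?_⟩
  · rintro ⟨r, hr⟩
    have hdvd : ℓ₁ ∣ r := (or_self_iff).mp (h₁.dvd_mul.mp (hr ▸ dvd_mul_right ℓ₁ ℓ₂))
    have hsq : ℓ₁ * ℓ₁ ∣ ℓ₁ * ℓ₂ := hr ▸ mul_dvd_mul hdvd hdvd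
    have := (Nat.prime_dvd_prime_iff_eq h₁ h₂).mp (Nat.dvd_of_mul_dvd_mul_left h₁.pos hsq)
    omega
  · have hℓ2 : 2 < ℓ₁ := by exact_mod_cast hx.trans_lt hxℓ
    have hodd : ℓ₁ % 2 = 1 := h₁.eq_two_or_odd.resolve_left hℓ2.ne'
    rw [Nat.mul_mod, ← hmod]
    have : ℓ₁ % 8 = 1 ∨ ℓ₁ % 8 = 3 ∨ ℓ₁ % 8 = 5 ∨ ℓ₁ % 8 = 7 := by omega
    rcases this with h | h | h | h <;> rw [h]
  · have hne : p ≠ ℓ₁ := by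
      rintro rfl
      linarith
    rw [Nat.cast_mul, legendre_mul, ← hleg p hp hp2 hpx]
    rcases legendre_eq_one_or_neg_one hp h₁ hne with h | h <;> rw [h] <;> norm_num

/-- Pigeonhole on the residue modulo `8` and the set of odd primes `p ≤ x` with symbol `1`. -/
lemma exists_primes_legendre_eq {x : ℝ} (hx : 2 ≤ x) {N : ℕ}
    (hcard : 2 ^ (piX x + 1) + piX x < Nat.primeCounting N) :
    ∃ ℓ₁ ℓ₂ : ℕ, ℓ₁.Prime ∧ ℓ₂.Prime ∧ x < (ℓ₁ : ℝ) ∧ ℓ₁ < ℓ₂ ∧ ℓ₂ ≤ N ∧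
      ℓ₁ % 8 = ℓ₂ % 8 ∧
      ∀ p : ℕ, p.Prime → p ≠ 2 → (p : ℝ) ≤ x → legendre p ℓ₁ = legendre p ℓ₂ := by
  classical
  set S := Nat.primesLE N \ primesUpTo x
  set T := ({1, 3, 5, 7} : Finset ℕ) ×ˢ ((primesUpTo x).erase 2).powerset with hT
  have h2 : 2 ∈ primesUpTo x := by
    rw [primesUpTo_eq_primesLE, Nat.mem_primesLE]
    exact ⟨Nat.le_floor (by exact_mod_cast hx), Nat.prime_two⟩
  have hS : ∀ ℓ ∈ S, ℓ ≤ N ∧ ℓ.Prime ∧ x < ℓ := by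
    intro ℓ hℓ
    rw [Finset.mem_sdiff, primesUpTo_eq_primesLE, Nat.mem_primesLE, Nat.mem_primesLE] at hℓ
    exact ⟨hℓ.1.1, hℓ.1.2, (Nat.floor_lt (by linarith)).mp
      (not_le.mp fun h => hℓ.2 ⟨h, hℓ.1.2⟩)⟩
  have hTcard : T.card = 2 ^ (piX x + 1) := by
    have hpos : 0 < piX x := Finset.card_pos.mpr ⟨2, h2⟩
    rw [hT, Finset.card_product, Finset.card_powerset, Finset.card_erase_of_mem h2]
    change 2 ^ 2 * 2 ^ (piX x - 1) = _
    rw [← pow_add]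
    congr 1
    omega
  have hST : T.card < S.card := by
    have := Finset.le_card_sdiff (primesUpTo x) (Nat.primesLE N)
    rw [Nat.primesLE_card_eq_primeCounting] at this
    change _ - piX x ≤ S.card at this
    omega
  obtain ⟨a, ha, b, hb, hab, hf⟩ := Finset.exists_ne_map_eq_of_card_lt_of_maps_to hST
    (f := fun ℓ : ℕ => (ℓ % 8, ((primesUpTo x).erase 2).filter fun p => legendre p ℓ = 1))
    (by
      intro ℓ hℓ
      obtain ⟨-, hprime, hxℓ⟩ := hS ℓ hℓ
      have hℓ2 : 2 < ℓ := by exact_mod_cast hx.trans_lt hxℓ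
      have hodd := hprime.eq_two_or_odd.resolve_left hℓ2.ne'
      simp only [hT, Finset.coe_product, Set.mem_prod, Finset.mem_coe, Finset.mem_powerset,
        Finset.filter_subset, and_true, Finset.mem_insert, Finset.mem_singleton]
      omega)
  wlog hlt : a < b generalizing a b
  · exact this b hb a ha hab.symm hf.symm (by omega)
  obtain ⟨-, ha', hxa⟩ := hS a ha
  obtain ⟨hbN, hb', hxb⟩ := hS b hb
  rw [Prod.mk.injEq] at hf
  refine ⟨a, b, ha', hb', hxa, hlt, hbN, hf.1, fun p hp hp2 hpx => ?_⟩
  have hmem : p ∈ (primesUpTo x).erase 2 := by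
    rw [Finset.mem_erase, primesUpTo_eq_primesLE, Nat.mem_primesLE]
    exact ⟨hp2, Nat.le_floor hpx, hp⟩
  have hiff : legendre p a = 1 ↔ legendre p b = 1 := by
    simpa [hmem] using Finset.ext_iff.mp hf.2 p
  have hpa : p ≠ a := by
    rintro rfl
    linarith
  have hpb : p ≠ b := by
    rintro rfl
    linarith
  rcases legendre_eq_one_or_neg_one hp ha' hpa with h | h <;>
    rcases legendre_eq_one_or_neg_one hp hb' hpb with h' | h' <;> simp_all

/-- For all sufficiently large `x` there are distinct primes
`x < ℓ₁ < ℓ₂ ≤ 2^{π(x)} x` with `ℓ₁ ≡ ℓ₂ (mod 8)` and matching Legendre symbols at all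
odd primes `p ≤ x`; moreover for any such pair, `ℓ₁ℓ₂` is an `x`-pseudosquare. -/
theorem pseudosquare_from_prime_pair :
    ∃ x₀ : ℝ, ∀ x : ℝ, x₀ ≤ x →
      (∃ ℓ₁ ℓ₂ : ℕ, ℓ₁.Prime ∧ ℓ₂.Prime ∧ x < (ℓ₁ : ℝ) ∧ ℓ₁ < ℓ₂ ∧
        (ℓ₂ : ℝ) ≤ 2 ^ piX x * x ∧ ℓ₁ % 8 = ℓ₂ % 8 ∧
        ∀ p : ℕ, p.Prime → p ≠ 2 → (p : ℝ) ≤ x →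
          legendre p (ℓ₁ : ℤ) = legendre p (ℓ₂ : ℤ)) ∧
      (∀ ℓ₁ ℓ₂ : ℕ, ℓ₁.Prime → ℓ₂.Prime → x < (ℓ₁ : ℝ) → ℓ₁ < ℓ₂ →
        (ℓ₂ : ℝ) ≤ 2 ^ piX x * x → ℓ₁ % 8 = ℓ₂ % 8 →
        (∀ p : ℕ, p.Prime → p ≠ 2 → (p : ℝ) ≤ x →
          legendre p (ℓ₁ : ℤ) = legendre p (ℓ₂ : ℤ)) →
        IsPseudosquare x (ℓ₁ * ℓ₂)) := by
  obtain ⟨x₀, hx₀⟩ := Filter.eventually_atTop.mp eventually_primeCounting_mul_log_two_add_log_le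
  refine ⟨max x₀ 4, fun x hx => ?_⟩
  have hx4 : 4 ≤ x := (le_max_right _ _).trans hx
  refine ⟨?_, fun ℓ₁ ℓ₂ h₁ h₂ hxℓ hlt _ hmod hleg =>
    isPseudosquare_mul_of_legendre_eq (by linarith) h₁ h₂ hxℓ hlt hmod hleg⟩
  have hcount : 3 * 2 ^ piX x ≤ Nat.primeCounting ⌊2 ^ piX x * x⌋₊ :=
    three_mul_two_pow_le_primeCounting hx4 (by
      rw [piX_eq_primeCounting]
      exact hx₀ x ((le_max_left _ _).trans hx))
  obtain ⟨ℓ₁, ℓ₂, h₁, h₂, hxℓ, hlt, hle, hmod, hleg⟩ :=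
    exists_primes_legendre_eq (x := x) (by linarith) (N := ⌊2 ^ piX x * x⌋₊) (by
      have := Nat.lt_two_pow_self (n := piX x)
      rw [pow_succ]
      omega)
  exact ⟨ℓ₁, ℓ₂, h₁, h₂, hxℓ, hlt, (Nat.le_floor_iff (by positivity)).mp hle, hmod, hleg⟩
end
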